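/- Let X be any surface over an algebraically closed field of characteristic 0, and let φ : X → ℙ^N be a morphism that is birational onto its image Y = φ(X). Let x ∈ X be a general point with y = φ(x), let β_x : X̃ → X be the blow-up of X at x with exceptional curve E, and let φ̃ : X̃ → ℙ^{N−1} be the resolution of the inner projection π_y ∘ φ from x. If φ̃ is ramified along the exceptional curve E ⊂ X̃ (that is, E ⊆ Ram(φ̃)), then Y is a 2-plane. -/

import Mathlib

/-!
Common framework: classical projective varieties over an algebraically closed
field, formalized via `Projectivization`.
-/

open MvPolynomial Module Set Filter

namespace PinchPaper

variable (k : Type) [Field k]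

/-- The classical points of projective `N`-space over `k`. -/
abbrev Pr (N : ℕ) := Projectivization k (Fin (N + 1) → k)

variable {k}

/-- A (homogeneous) polynomial vanishes at a point of projective space. -/
def Vanishes {N : ℕ} (f : MvPolynomial (Fin (N + 1)) k) (p : Pr k N) : Prop :=
  ∀ (v : Fin (N + 1) → k) (hv : v ≠ 0), Projectivization.mk k v hv = p → eval v f = 0

/-- Zariski-closed (projective algebraic) subsets of projective space: common zero
loci of families of homogeneous polynomials. -/
def IsAlgSet {N : ℕ} (Z : Set (Pr k N)) : Prop :=
  ∃ S : Set (MvPolynomial (Fin (N + 1)) k),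
    (∀ f ∈ S, ∃ d, f.IsHomogeneous d) ∧ Z = {p | ∀ f ∈ S, Vanishes f p}

/-- A projective variety: a nonempty algebraic set which is irreducible. -/
def IsVariety {N : ℕ} (Z : Set (Pr k N)) : Prop :=
  IsAlgSet Z ∧ Z.Nonempty ∧
    ∀ Z₁ Z₂ : Set (Pr k N), IsAlgSet Z₁ → IsAlgSet Z₂ → Z ⊆ Z₁ ∪ Z₂ → Z ⊆ Z₁ ∨ Z ⊆ Z₂

/-- `Z` has dimension `n`, via lengths of chains of subvarieties. -/
def HasDim {N : ℕ} (Z : Set (Pr k N)) (n : ℕ) : Prop :=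
  Order.krullDim {W : Set (Pr k N) // IsVariety W ∧ W ⊆ Z} = (n : ℕ∞)

/-- The polynomials vanishing identically on `Z` (as a `k`-submodule). -/
noncomputable def vanishingIdeal {N : ℕ} (Z : Set (Pr k N)) :
    Submodule k (MvPolynomial (Fin (N + 1)) k) :=
  ⨅ p ∈ Z, LinearMap.ker (MvPolynomial.aeval (R := k) (Projectivization.rep p)).toLinearMap

/-- The Hilbert function of the homogeneous coordinate ring of `Z`. -/
noncomputable def hilb {N : ℕ} (Z : Set (Pr k N)) (m : ℕ) : ℕ :=
  finrank k (↥(homogeneousSubmodule (Fin (N + 1)) k m) ⧸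
    (Submodule.comap (homogeneousSubmodule (Fin (N + 1)) k m).subtype (vanishingIdeal Z)))

/-- `Z` (of dimension `n`) has degree `d`: the Hilbert polynomial of `Z` has degree `n`
and leading coefficient `d / n!`. -/
def HasDegree {N : ℕ} (Z : Set (Pr k N)) (n d : ℕ) : Prop :=
  ∃ P : Polynomial ℚ, P.degree = (n : ℕ) ∧ P.leadingCoeff * (n.factorial : ℚ) = (d : ℚ) ∧
    ∀ᶠ m : ℕ in atTop, (hilb Z m : ℚ) = P.eval (m : ℚ)

/-- A curve `B` has (arithmetic, hence for smooth curves geometric) genus `g`: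
its Hilbert polynomial is `P(m) = d·m + (1 - g)`. -/
def HasGenus {N : ℕ} (B : Set (Pr k N)) (g : ℕ) : Prop :=
  ∃ d : ℕ, ∀ᶠ m : ℕ in atTop, (hilb B m : ℤ) = d * m + 1 - g

/-- A line in projective space: the set of points lying in a 2-dimensional linear subspace. -/
def IsLine {N : ℕ} (L : Set (Pr k N)) : Prop :=
  ∃ W : Submodule k (Fin (N + 1) → k), finrank k W = 2 ∧
    L = {p | Projectivization.submodule p ≤ W}

/-- A 2-plane in projective space. -/
def Is2Plane {N : ℕ} (L : Set (Pr k N)) : Prop :=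
  ∃ W : Submodule k (Fin (N + 1) → k), finrank k W = 3 ∧
    L = {p | Projectivization.submodule p ≤ W}

/-- `Y` is non-degenerate: no nonzero linear form vanishes on it. -/
def Nondegenerate {N : ℕ} (Y : Set (Pr k N)) : Prop :=
  ∀ f : MvPolynomial (Fin (N + 1)) k, f.IsHomogeneous 1 → (∀ p ∈ Y, Vanishes f p) → f = 0

/-- `Y` is ruled by lines: it contains infinitely many lines (equivalently, its Fano
scheme of lines is positive-dimensional). -/
def RuledByLines {N : ℕ} (Y : Set (Pr k N)) : Prop :=
  {L : Set (Pr k N) | IsLine L ∧ L ⊆ Y}.Infinite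

/-- The differential of `f` at `v`, as a linear functional. -/
noncomputable def diffAt {N : ℕ} (f : MvPolynomial (Fin (N + 1)) k) (v : Fin (N + 1) → k) :
    (Fin (N + 1) → k) →ₗ[k] k :=
  ∑ j, eval v (pderiv j f) • (LinearMap.proj j : (Fin (N + 1) → k) →ₗ[k] k)

/-- The affine cone over the embedded Zariski tangent space of `Z` at `p`. -/
noncomputable def embTangent {N : ℕ} (Z : Set (Pr k N)) (p : Pr k N) :
    Submodule k (Fin (N + 1) → k) :=
  ⨅ f ∈ {f : MvPolynomial (Fin (N + 1)) k |
      (∃ d, f.IsHomogeneous d) ∧ ∀ q ∈ Z, Vanishes f q},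
    LinearMap.ker (diffAt f (Projectivization.rep p))

/-- A smooth projective surface (embedded in some projective space). -/
def IsSmoothSurface {N : ℕ} (Z : Set (Pr k N)) : Prop :=
  IsVariety Z ∧ HasDim Z 2 ∧ ∀ p ∈ Z, finrank k (embTangent Z p) = 3

/-- A smooth projective curve. -/
def IsSmoothCurve {N : ℕ} (Z : Set (Pr k N)) : Prop :=
  IsVariety Z ∧ HasDim Z 1 ∧ ∀ p ∈ Z, finrank k (embTangent Z p) = 2

/-- `F` is a local homogeneous representation of `φ` near `p ∈ X`. -/
def LocalRep {M N : ℕ} (X : Set (Pr k M)) (φ : Pr k M → Pr k N) (p : Pr k M)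
    (F : Fin (N + 1) → MvPolynomial (Fin (M + 1)) k) : Prop :=
  (∃ d, ∀ i, (F i).IsHomogeneous d) ∧
  (fun i => eval (Projectivization.rep p) (F i)) ≠ 0 ∧
  ∀ q ∈ X, ∀ (v : Fin (M + 1) → k) (hv : v ≠ 0), Projectivization.mk k v hv = q →
    ∀ hFv : (fun i => eval v (F i)) ≠ 0,
      φ q = Projectivization.mk k (fun i => eval v (F i)) hFv

/-- `φ` is a morphism on the projective set `X`: locally given by homogeneous polynomials. -/
def IsMorphismOn {M N : ℕ} (X : Set (Pr k M)) (φ : Pr k M → Pr k N) : Prop :=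
  ∀ p ∈ X, ∃ F, LocalRep X φ p F

/-- The Jacobian of a tuple of polynomials at `v`, as a linear map. -/
noncomputable def jacobian {M N : ℕ} (F : Fin (N + 1) → MvPolynomial (Fin (M + 1)) k)
    (v : Fin (M + 1) → k) : (Fin (M + 1) → k) →ₗ[k] (Fin (N + 1) → k) :=
  Matrix.mulVecLin (Matrix.of fun i j => eval v (pderiv j (F i)))

/-- `φ` (defined on the surface `X`) is ramified at `p`: its differential has rank ≤ 1,
i.e. the image of the affine tangent cone has rank ≤ 2. -/
def RamifiedAt {M N : ℕ} (X : Set (Pr k M)) (φ : Pr k M → Pr k N) (p : Pr k M) : Prop :=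
  ∀ F, LocalRep X φ p F →
    finrank k ((embTangent X p).map (jacobian F (Projectivization.rep p))) ≤ 2

/-- The ramification locus of `φ` on `X`. -/
def RamLocus {M N : ℕ} (X : Set (Pr k M)) (φ : Pr k M → Pr k N) : Set (Pr k M) :=
  {p | p ∈ X ∧ RamifiedAt X φ p}

/-- `φ` is unramified at `p` (injective differential on Zariski tangent spaces). -/
def UnramifiedAt {M N : ℕ} (X : Set (Pr k M)) (φ : Pr k M → Pr k N) (p : Pr k M) : Prop :=
  ∀ F, LocalRep X φ p F → ∀ w ∈ embTangent X p,
    jacobian F (Projectivization.rep p) w ∈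
      Submodule.span k {(fun i => eval (Projectivization.rep p) (F i))} →
    w ∈ Submodule.span k {Projectivization.rep p}

/-- `φ` is a closed embedding on `X`: injective, closed image, unramified, and the
embedded tangent spaces of the image match those of `X`. -/
def IsClosedEmbeddingOn {M N : ℕ} (X : Set (Pr k M)) (φ : Pr k M → Pr k N) : Prop :=
  InjOn φ X ∧ IsAlgSet (φ '' X) ∧ (∀ p ∈ X, UnramifiedAt X φ p) ∧
    ∀ p ∈ X, finrank k (embTangent (φ '' X) (φ p)) = finrank k (embTangent X p)

/-- `φ` is generically injective on `X` (i.e. birational onto its image). -/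
def GenericallyInjectiveOn {M N : ℕ} (X : Set (Pr k M)) (φ : Pr k M → Pr k N) : Prop :=
  ∃ Z : Set (Pr k M), IsAlgSet Z ∧ ¬ X ⊆ Z ∧ InjOn φ (X \ Z)

/-- An uncrumpled map: a morphism with non-degenerate image, birational onto its
image, with finite ramification locus. -/
def Uncrumpled {M N : ℕ} (X : Set (Pr k M)) (φ : Pr k M → Pr k N) : Prop :=
  IsMorphismOn X φ ∧ Nondegenerate (φ '' X) ∧ GenericallyInjectiveOn X φ ∧
    (RamLocus X φ).Finite

/-- The ramification locus of the composite of `φ` with the linear projection given by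
the matrix `L`; ramification means the image of the affine tangent cone has rank ≤ `r`. -/
def ProjRamLocus {M N T : ℕ} (X : Set (Pr k M)) (φ : Pr k M → Pr k N)
    (L : Matrix (Fin T) (Fin (N + 1)) k) (r : ℕ) : Set (Pr k M) :=
  {p | p ∈ X ∧ ∀ F, LocalRep X φ p F →
    finrank k ((embTangent X p).map
      ((Matrix.mulVecLin L).comp (jacobian F (Projectivization.rep p)))) ≤ r}

/-- A property holds for a general matrix: it holds on a nonempty Zariski-open set. -/
def ForGenericMatrix {a b : ℕ} (P : Matrix (Fin a) (Fin b) k → Prop) : Prop :=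
  ∃ G : MvPolynomial (Fin a × Fin b) k, G ≠ 0 ∧
    ∀ L : Matrix (Fin a) (Fin b) k, eval (fun ij => L ij.1 ij.2) G ≠ 0 → P L

/-- A property holds for a general vector. -/
def ForGenericVector {b : ℕ} (P : (Fin b → k) → Prop) : Prop :=
  ∃ G : MvPolynomial (Fin b) k, G ≠ 0 ∧ ∀ a : Fin b → k, eval a G ≠ 0 → P a

/-- A property holds for a general point of `X`: it holds away from a proper closed subset. -/
def ForGeneralPointOn {M : ℕ} (X : Set (Pr k M)) (P : Pr k M → Prop) : Prop :=
  ∃ Z : Set (Pr k M), IsAlgSet Z ∧ ¬ X ⊆ Z ∧ ∀ x ∈ X \ Z, P x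

/-- The pinch point scheme length: `𝔓(φ) = n` iff the composition of `φ` with a general
linear projection to `ℙ³` has exactly `n` pinch (ramification) points.  (By
[Eisenbud–Harris, 12.6] this equals `deg (6ζ² + 4ζK + K² − c₂)`.) -/
def HasPinch {M N : ℕ} (X : Set (Pr k M)) (φ : Pr k M → Pr k N) (n : ℕ) : Prop :=
  ForGenericMatrix (fun L : Matrix (Fin 4) (Fin (N + 1)) k =>
    (∀ p ∈ X, L.mulVec (Projectivization.rep (φ p)) ≠ 0) ∧
    (ProjRamLocus X φ L 2).ncard = n ∧ (ProjRamLocus X φ L 2).Finite)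

/-- A rational normal scroll in `ℙ^N`: a smooth non-degenerate surface of minimal
degree `N − 1` which is ruled by lines. -/
def IsRationalNormalScroll {N : ℕ} (Y : Set (Pr k N)) : Prop :=
  IsSmoothSurface Y ∧ Nondegenerate Y ∧ RuledByLines Y ∧ HasDegree Y 2 (N - 1)

/-- The exceptional fiber of `β` over `x`. -/
def ExcFiber {M' M : ℕ} (Xt : Set (Pr k M')) (β : Pr k M' → Pr k M) (x : Pr k M) :
    Set (Pr k M') := {q | q ∈ Xt ∧ β q = x}

/-- `β : X̃ → X` is the blow-up of the surface `X` at the (smooth) point `x`: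
a birational morphism which is an isomorphism away from `x`, whose fiber over `x`
is an irreducible curve, smooth along that fiber. -/
def IsBlowupAt {M' M : ℕ} (Xt : Set (Pr k M')) (X : Set (Pr k M))
    (β : Pr k M' → Pr k M) (x : Pr k M) : Prop :=
  x ∈ X ∧ IsVariety Xt ∧ HasDim Xt 2 ∧ IsMorphismOn Xt β ∧ β '' Xt = X ∧
    InjOn β {q | q ∈ Xt ∧ β q ≠ x} ∧
    IsVariety (ExcFiber Xt β x) ∧ HasDim (ExcFiber Xt β x) 1 ∧
    ∀ q ∈ ExcFiber Xt β x, finrank k (embTangent Xt q) = 3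

/-- `φ̃ : X̃ → ℙ^{N'}` resolves the inner projection of `φ : X → ℙ^N` from `y = φ x`
(via the blow-up `β : X̃ → X` and with projection given by a linear map `L` whose
kernel is the line of `y`). -/
def ResolvesInnerProj {M M' N N' : ℕ} (X : Set (Pr k M)) (φ : Pr k M → Pr k N)
    (x : Pr k M) (Xt : Set (Pr k M')) (β : Pr k M' → Pr k M)
    (φt : Pr k M' → Pr k N') (L : (Fin (N + 1) → k) →ₗ[k] (Fin (N' + 1) → k)) : Prop :=
  IsMorphismOn Xt φt ∧ LinearMap.ker L = Projectivization.submodule (φ x) ∧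
    ∀ q ∈ Xt, β q ≠ x → ∀ (v : Fin (N + 1) → k) (hv : v ≠ 0),
      Projectivization.mk k v hv = φ (β q) → ∀ hLv : L v ≠ 0,
        φt q = Projectivization.mk k (L v) hLv

/-- The standard quadratic (Veronese) monomials. -/
def veroneseVec (v : Fin 3 → k) : Fin 6 → k :=
  ![v 0 * v 0, v 0 * v 1, v 0 * v 2, v 1 * v 1, v 1 * v 2, v 2 * v 2]

/-- The image of the Veronese embedding `ℙ² → ℙ⁵`. -/
def veroneseImage (k : Type) [Field k] : Set (Pr k 5) :=
  {p | ∃ (v : Fin 3 → k) (hv : veroneseVec v ≠ 0), p = Projectivization.mk k (veroneseVec v) hv}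

/-- `Y` is (projectively equivalent to) the Veronese surface in `ℙ⁵`
(the existence of the linear isomorphism forces `N = 5`). -/
def IsVeroneseSurface {N : ℕ} (Y : Set (Pr k N)) : Prop :=
  ∃ σ : (Fin 6 → k) ≃ₗ[k] (Fin (N + 1) → k),
    Y = Projectivization.map σ.toLinearMap σ.injective '' veroneseImage k

/-- `Y ⊂ ℙ^N` is linearly normal: it is not an isomorphic linear projection of a
non-degenerate variety in `ℙ^{N+1}`. -/
def LinearlyNormal {N : ℕ} (Y : Set (Pr k N)) : Prop :=
  ¬ ∃ (Y' : Set (Pr k (N + 1))) (π : Pr k (N + 1) → Pr k N)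
      (L : (Fin (N + 1 + 1) → k) →ₗ[k] (Fin (N + 1) → k)),
      IsVariety Y' ∧ Nondegenerate Y' ∧
      (∀ q ∈ Y', ∀ (v : Fin (N + 1 + 1) → k) (hv : v ≠ 0),
        Projectivization.mk k v hv = q →
          ∃ hLv : L v ≠ 0, π q = Projectivization.mk k (L v) hLv) ∧
      π '' Y' = Y ∧ InjOn π Y' ∧
      ∀ q ∈ Y', Disjoint (LinearMap.ker L) (embTangent Y' q)

/-- A del Pezzo surface of degree `d` in `ℙ^N`: a smooth non-degenerate linearly normal
surface of degree `d` (for `d = N` this characterizes anticanonically embedded del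
Pezzo surfaces). -/
def IsDelPezzoOfDegree {N : ℕ} (Y : Set (Pr k N)) (d : ℕ) : Prop :=
  IsSmoothSurface Y ∧ Nondegenerate Y ∧ LinearlyNormal Y ∧ HasDegree Y 2 d

/-- `F` is isomorphic to `ℙ¹` (as a projective variety). -/
def IsIsoToP1 {M : ℕ} (F : Set (Pr k M)) : Prop :=
  ∃ ψ : Pr k 1 → Pr k M, IsMorphismOn Set.univ ψ ∧ Set.BijOn ψ Set.univ F ∧
    ∃ ψ' : Pr k M → Pr k 1, IsMorphismOn F ψ' ∧ ∀ t, ψ' (ψ t) = t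

/-- `ρ : X → B` exhibits `X` as a `ℙ¹`-bundle over the curve `B`
(all fibers are isomorphic to `ℙ¹`). -/
def IsP1Bundle {M m : ℕ} (X : Set (Pr k M)) (B : Set (Pr k m))
    (ρ : Pr k M → Pr k m) : Prop :=
  IsMorphismOn X ρ ∧ ρ '' X = B ∧ ∀ b ∈ B, IsIsoToP1 {p | p ∈ X ∧ ρ p = b}

/-- The hyperplane cut out by the linear form with coefficients `a`. -/
def hyperplaneOf {N : ℕ} (a : Fin (N + 1) → k) : Set (Pr k N) :=
  {p | Vanishes (∑ i, MvPolynomial.C (a i) * MvPolynomial.X i) p}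

/-- A rational normal curve of degree `N` in `ℙ^N`: a non-degenerate curve of degree `N`. -/
def IsRationalNormalCurve {N : ℕ} (C : Set (Pr k N)) : Prop :=
  IsVariety C ∧ HasDim C 1 ∧ Nondegenerate C ∧ HasDegree C 1 N

/-- The Gauss degree `γ₁` of an embedded curve `X ⊂ ℙ^N`: the number of ramification
points of a general linear projection `X → ℙ¹`. -/
def HasGaussDegree {N : ℕ} (X : Set (Pr k N)) (γ : ℕ) : Prop :=
  ForGenericMatrix (fun L : Matrix (Fin 2) (Fin (N + 1)) k =>
    (∀ p ∈ X, L.mulVec (Projectivization.rep p) ≠ 0) ∧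
    (ProjRamLocus X id L 1).ncard = γ ∧ (ProjRamLocus X id L 1).Finite)


end PinchPaper

namespace PinchPaper

section Cones
variable {k : Type} [Field k]

/-- The homogeneous ideal of a subset of projective space. -/
def coneIdeal {N : ℕ} (Z : Set (Pr k N)) : Ideal (MvPolynomial (Fin (N + 1)) k) where
  carrier := {f | ∀ (v : Fin (N + 1) → k) (hv : v ≠ 0), Projectivization.mk k v hv ∈ Z → eval v f = 0}
  add_mem' := by
    intro a b ha hb v hv hz
    rw [map_add, ha v hv hz, hb v hv hz, add_zero]
  zero_mem' := by intro v hv _; simp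
  smul_mem' := by
    intro c a ha v hv hz
    rw [smul_eq_mul, map_mul, ha v hv hz, mul_zero]

theorem mem_coneIdeal {N : ℕ} {Z : Set (Pr k N)} {f : MvPolynomial (Fin (N + 1)) k} :
    f ∈ coneIdeal Z ↔
      ∀ (v : Fin (N + 1) → k) (hv : v ≠ 0), Projectivization.mk k v hv ∈ Z → eval v f = 0 :=
  Iff.rfl

theorem mem_coneIdeal_iff_vanishes {N : ℕ} {Z : Set (Pr k N)}
    {f : MvPolynomial (Fin (N + 1)) k} : f ∈ coneIdeal Z ↔ ∀ p ∈ Z, Vanishes f p := by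
  constructor
  · intro h p hp v hv hvp
    exact h v hv (hvp ▸ hp)
  · intro h v hv hz
    exact h _ hz v hv rfl

/-- An ideal is stable under taking homogeneous components. -/
def CompStable {σ : Type} (J : Ideal (MvPolynomial σ k)) : Prop :=
  ∀ f ∈ J, ∀ d, homogeneousComponent d f ∈ J

theorem eval_eq_sum_homogeneousComponent {σ : Type} (v : σ → k) (f : MvPolynomial σ k) :
    eval v f = ∑ d ∈ Finset.range (f.totalDegree + 1), eval v (homogeneousComponent d f) := by
  conv_lhs => rw [← sum_homogeneousComponent f]
  rw [map_sum]

theorem eval_smul_of_isHomogeneous {σ : Type} {f : MvPolynomial σ k} {d : ℕ}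
    (hf : f.IsHomogeneous d) (c : k) (v : σ → k) : eval (c • v) f = c ^ d * eval v f := by
  rw [eval_eq, eval_eq, Finset.mul_sum]
  refine Finset.sum_congr rfl fun m hm => ?_
  have hdeg : ∑ i ∈ m.support, m i = d := by
    have := hf (mem_support_iff.mp hm)
    simpa [Finsupp.weight_apply, Finsupp.sum] using this
  simp only [Pi.smul_apply, smul_eq_mul, mul_pow, Finset.prod_mul_distrib]
  rw [Finset.prod_pow_eq_pow_sum, hdeg]
  ring

theorem mk_smul_eq {N : ℕ} {v : Fin (N + 1) → k} (hv : v ≠ 0) {c : k}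
    (hcv : c • v ≠ 0) : Projectivization.mk k (c • v) hcv = Projectivization.mk k v hv :=
  (Projectivization.mk_eq_mk_iff' k _ _ hcv hv).2 ⟨c, rfl⟩

theorem compStable_coneIdeal [Infinite k] {N : ℕ} (Z : Set (Pr k N)) :
    CompStable (coneIdeal Z) := by
  intro f hf d v hv hz
  let P : Polynomial k := ∑ d ∈ Finset.range (f.totalDegree + 1),
    Polynomial.C (eval v (homogeneousComponent d f)) * Polynomial.X ^ d
  have hP : P = 0 := by
    apply Polynomial.eq_zero_of_infinite_isRoot
    refine ((Set.finite_singleton (0 : k)).infinite_compl).mono ?_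
    intro t ht
    have ht : t ≠ 0 := by simpa using ht
    have htv : t • v ≠ 0 := smul_ne_zero ht hv
    have h := hf (t • v) htv (by rw [mk_smul_eq hv]; exact hz)
    rw [eval_eq_sum_homogeneousComponent] at h
    simp only [Set.mem_ofPred_eq, Polynomial.IsRoot, P, Polynomial.eval_finsetSum,
      Polynomial.eval_mul, Polynomial.eval_C, Polynomial.eval_pow, Polynomial.eval_X]
    rw [← h]
    refine Finset.sum_congr rfl fun e _ => ?_
    rw [eval_smul_of_isHomogeneous (homogeneousComponent_isHomogeneous e f), mul_comm]
  by_cases hd : d ∈ Finset.range (f.totalDegree + 1)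
  · have : P.coeff d = eval v (homogeneousComponent d f) := by
      simp only [P, Polynomial.finsetSum_coeff, Polynomial.coeff_C_mul, Polynomial.coeff_X_pow]
      rw [Finset.sum_eq_single d]
      · simp
      · intro b _ hb; simp [Ne.symm hb]
      · intro h; exact absurd hd h
    rw [← this, hP, Polynomial.coeff_zero]
  · rw [homogeneousComponent_eq_zero, map_zero]
    simpa using hd

theorem IsAlgSet.mem_iff {N : ℕ} {Z : Set (Pr k N)} (hZ : IsAlgSet Z)
    {v : Fin (N + 1) → k} (hv : v ≠ 0) :
    Projectivization.mk k v hv ∈ Z ↔ ∀ f ∈ coneIdeal Z, eval v f = 0 := by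
  refine ⟨fun h f hf => hf v hv h, fun h => ?_⟩
  obtain ⟨S, hS, rfl⟩ := hZ
  intro f hf w hw hwv
  have h1 : f ∈ coneIdeal {p | ∀ f ∈ S, Vanishes f p} :=
    mem_coneIdeal_iff_vanishes.2 fun p hp => hp f hf
  obtain ⟨a, rfl⟩ := (Projectivization.mk_eq_mk_iff' k _ _ hw hv).1 hwv
  obtain ⟨d, hd⟩ := hS f hf
  rw [eval_smul_of_isHomogeneous hd, h f h1, mul_zero]

/-- The projective zero locus of an ideal. -/
def projZero {N : ℕ} (J : Ideal (MvPolynomial (Fin (N + 1)) k)) : Set (Pr k N) :=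
  {p | ∀ f ∈ J, Vanishes f p}

theorem projZero_isAlgSet {N : ℕ} {J : Ideal (MvPolynomial (Fin (N + 1)) k)}
    (hJ : CompStable J) : IsAlgSet (projZero J) := by
  refine ⟨{f | f ∈ J ∧ ∃ d, f.IsHomogeneous d}, fun f hf => hf.2, ?_⟩
  ext p
  constructor
  · intro h f hf
    exact h f hf.1
  · intro h f hf v hv hvp
    rw [eval_eq_sum_homogeneousComponent]
    refine Finset.sum_eq_zero fun d _ => ?_
    exact h _ ⟨hJ f hf d, d, homogeneousComponent_isHomogeneous d f⟩ v hv hvp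

theorem mk_mem_projZero {N : ℕ} {J : Ideal (MvPolynomial (Fin (N + 1)) k)}
    (hJ : CompStable J) {v : Fin (N + 1) → k} (hv : v ≠ 0) :
    Projectivization.mk k v hv ∈ projZero J ↔ ∀ f ∈ J, eval v f = 0 := by
  refine ⟨fun h f hf => h f hf v hv rfl, fun h f hf w hw hwv => ?_⟩
  obtain ⟨a, rfl⟩ := (Projectivization.mk_eq_mk_iff' k _ _ hw hv).1 hwv
  rw [eval_eq_sum_homogeneousComponent]
  refine Finset.sum_eq_zero fun d _ => ?_
  rw [eval_smul_of_isHomogeneous (homogeneousComponent_isHomogeneous d f),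
    h _ (hJ f hf d), mul_zero]

theorem exists_mk_eq {N : ℕ} (p : Pr k N) :
    ∃ (v : Fin (N + 1) → k) (hv : v ≠ 0), Projectivization.mk k v hv = p :=
  ⟨p.rep, p.rep_nonzero, p.mk_rep⟩

theorem coneIdeal_anti {N : ℕ} {Z W : Set (Pr k N)} (h : Z ⊆ W) : coneIdeal W ≤ coneIdeal Z :=
  fun _ hf v hv hz => hf v hv (h hz)

theorem IsAlgSet.subset_of_coneIdeal_le {N : ℕ} {Z W : Set (Pr k N)}
    (hW : IsAlgSet W) (h : coneIdeal W ≤ coneIdeal Z) : Z ⊆ W := by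
  intro p hp
  obtain ⟨v, hv, rfl⟩ := exists_mk_eq p
  exact (hW.mem_iff hv).2 fun f hf => h hf v hv hp

theorem IsAlgSet.inter {N : ℕ} {Z W : Set (Pr k N)} (hZ : IsAlgSet Z) (hW : IsAlgSet W) :
    IsAlgSet (Z ∩ W) := by
  obtain ⟨S, hS, rfl⟩ := hZ
  obtain ⟨T, hT, rfl⟩ := hW
  refine ⟨S ∪ T, ?_, ?_⟩
  · rintro f (hf | hf)
    exacts [hS f hf, hT f hf]
  · ext p
    constructor
    · rintro ⟨h1, h2⟩ f (hf | hf)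
      exacts [h1 f hf, h2 f hf]
    · intro h
      exact ⟨fun f hf => h f (Or.inl hf), fun f hf => h f (Or.inr hf)⟩

/-- Hypersurface sections of homogeneous polynomials are algebraic. -/
theorem isAlgSet_vanishes {N : ℕ} {f : MvPolynomial (Fin (N + 1)) k} {d : ℕ}
    (hf : f.IsHomogeneous d) : IsAlgSet {p : Pr k N | Vanishes f p} :=
  ⟨{f}, by simpa using ⟨d, hf⟩, by simp⟩

theorem vanishes_mk_iff {N : ℕ} {f : MvPolynomial (Fin (N + 1)) k} {d : ℕ}
    (hf : f.IsHomogeneous d) {v : Fin (N + 1) → k} (hv : v ≠ 0) :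
    Vanishes f (Projectivization.mk k v hv) ↔ eval v f = 0 := by
  refine ⟨fun h => h v hv rfl, fun h w hw hwv => ?_⟩
  obtain ⟨a, rfl⟩ := (Projectivization.mk_eq_mk_iff' k _ _ hw hv).1 hwv
  rw [eval_smul_of_isHomogeneous hf, h, mul_zero]

attribute [local instance] MvPolynomial.gradedAlgebra

/-- Primality of a component-stable ideal may be tested on homogeneous elements. -/
theorem isPrime_of_homogeneous {σ : Type} {J : Ideal (MvPolynomial σ k)}
    (hJ : CompStable J) (h1 : J ≠ ⊤)
    (h : ∀ f g : MvPolynomial σ k, ∀ d e, f.IsHomogeneous d → g.IsHomogeneous e →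
      f * g ∈ J → f ∈ J ∨ g ∈ J) : J.IsPrime := by
  have hh : J.IsHomogeneous (homogeneousSubmodule σ k) := by
    intro i x hx
    have := hJ x hx i
    rwa [← decomposition.decompose'_apply] at this
  refine hh.isPrime_of_homogeneous_mem_or_mem h1 ?_
  rintro x y ⟨d, hd⟩ ⟨e, he⟩ hxy
  exact h x y d e ((mem_homogeneousSubmodule _ _).1 hd) ((mem_homogeneousSubmodule _ _).1 he) hxy

theorem IsVariety.isPrime [Infinite k] {N : ℕ} {Z : Set (Pr k N)} (hZ : IsVariety Z) :
    (coneIdeal Z).IsPrime := by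
  obtain ⟨hZa, ⟨p, hp⟩, hirr⟩ := hZ
  refine isPrime_of_homogeneous (compStable_coneIdeal Z) ?_ ?_
  · intro h
    have : (1 : MvPolynomial (Fin (N + 1)) k) ∈ coneIdeal Z := h ▸ Submodule.mem_top
    obtain ⟨v, hv, rfl⟩ := exists_mk_eq p
    simpa using this v hv hp
  · intro f g d e hf hg hfg
    have hsub : Z ⊆ {p | Vanishes f p} ∪ {p | Vanishes g p} := by
      intro q hq
      obtain ⟨v, hv, rfl⟩ := exists_mk_eq q
      have := hfg v hv hq
      rw [map_mul, mul_eq_zero] at this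
      rcases this with h | h
      · exact Or.inl ((vanishes_mk_iff hf hv).2 h)
      · exact Or.inr ((vanishes_mk_iff hg hv).2 h)
    rcases hirr _ _ (isAlgSet_vanishes hf) (isAlgSet_vanishes hg) hsub with h | h
    · exact Or.inl (mem_coneIdeal_iff_vanishes.2 h)
    · exact Or.inr (mem_coneIdeal_iff_vanishes.2 h)

theorem isVariety_of_isPrime {N : ℕ} {Z : Set (Pr k N)} (hZ : IsAlgSet Z)
    (hne : Z.Nonempty) (hp : (coneIdeal Z).IsPrime) : IsVariety Z := by
  refine ⟨hZ, hne, fun Z₁ Z₂ h1 h2 hsub => ?_⟩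
  by_contra hc
  push Not at hc
  obtain ⟨hc1, hc2⟩ := hc
  have e1 : ¬ coneIdeal Z₁ ≤ coneIdeal Z := fun h => hc1 (h1.subset_of_coneIdeal_le h)
  have e2 : ¬ coneIdeal Z₂ ≤ coneIdeal Z := fun h => hc2 (h2.subset_of_coneIdeal_le h)
  obtain ⟨f, hf, hf'⟩ := SetLike.not_le_iff_exists.1 e1
  obtain ⟨g, hg, hg'⟩ := SetLike.not_le_iff_exists.1 e2
  have hfg : f * g ∈ coneIdeal Z := by
    intro v hv hz
    rcases hsub hz with h | h
    · rw [map_mul, hf v hv h, zero_mul]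
    · rw [map_mul, hg v hv h, mul_zero]
  rcases hp.mem_or_mem hfg with h | h
  · exact hf' h
  · exact hg' h

theorem IsVariety.exists_X_notMem [Infinite k] {N : ℕ} {Z : Set (Pr k N)} (hZ : IsVariety Z) :
    ∃ i, X i ∉ coneIdeal Z := by
  obtain ⟨p, hp⟩ := hZ.2.1
  obtain ⟨v, hv, rfl⟩ := exists_mk_eq p
  obtain ⟨i, hi⟩ := Function.ne_iff.1 hv
  exact ⟨i, fun h => hi (by simpa using h v hv hp)⟩

theorem coneIdeal_projZero [IsAlgClosed k] {N : ℕ}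
    {J : Ideal (MvPolynomial (Fin (N + 1)) k)} (hJ : CompStable J) (hp : J.IsPrime)
    {i : Fin (N + 1)} (hi : X i ∉ J) : coneIdeal (projZero J) = J := by
  apply le_antisymm
  · intro f hf
    have h : X i * f ∈ MvPolynomial.vanishingIdeal k (MvPolynomial.zeroLocus k J) := by
      rw [MvPolynomial.mem_vanishingIdeal_iff]
      intro v hv
      rw [MvPolynomial.mem_zeroLocus_iff] at hv
      rw [map_mul]
      by_cases h0 : v = 0
      · simp [h0]
      · have : eval v f = 0 := hf v h0 ((mk_mem_projZero hJ h0).2 hv)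
        rw [show aeval v f = eval v f from rfl, this, mul_zero]
    rw [MvPolynomial.vanishingIdeal_zeroLocus_eq_radical, hp.radical] at h
    exact (hp.mem_or_mem h).resolve_left hi
  · intro f hf v hv hz
    exact (mk_mem_projZero hJ hv).1 hz f hf

theorem isVariety_projZero [IsAlgClosed k] {N : ℕ}
    {J : Ideal (MvPolynomial (Fin (N + 1)) k)} (hJ : CompStable J) (hp : J.IsPrime)
    {i : Fin (N + 1)} (hi : X i ∉ J) : IsVariety (projZero J) := by
  refine isVariety_of_isPrime (projZero_isAlgSet hJ) ?_ ?_
  · by_contra hne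
    rw [Set.not_nonempty_iff_eq_empty] at hne
    have h := coneIdeal_projZero hJ hp hi
    rw [hne] at h
    apply hi
    rw [← h]
    intro v hv hz
    exact absurd hz (Set.notMem_empty _)
  · rwa [coneIdeal_projZero hJ hp hi]

/-- A polynomial outside the ideal of `Z` is nonzero somewhere on the cone. -/
theorem exists_eval_ne_zero {N : ℕ} {Z : Set (Pr k N)} {f : MvPolynomial (Fin (N + 1)) k}
    (hf : f ∉ coneIdeal Z) :
    ∃ (v : Fin (N + 1) → k) (hv : v ≠ 0), Projectivization.mk k v hv ∈ Z ∧ eval v f ≠ 0 := by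
  rw [mem_coneIdeal] at hf
  push Not at hf
  exact hf

end Cones

section Trdeg
variable {k : Type} [Field k]

theorem isAlgebraic_of_generators {A : Type} [CommRing A] [IsDomain A] [Algebra k A] {σ : Type}
    (R : Subalgebra k A) (g : σ → A) (hg : Algebra.adjoin k (range g) = ⊤)
    (hx : ∀ i, IsAlgebraic R (g i)) : Algebra.IsAlgebraic R A := by
  have h : (Algebra.adjoin R (range g)) = ⊤ := by
    rw [eq_top_iff]
    intro a _
    have ha : a ∈ Algebra.adjoin k (range g) := hg ▸ Algebra.mem_top
    induction ha using Algebra.adjoin_induction with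
    | mem x hx => exact Algebra.subset_adjoin hx
    | algebraMap r =>
      rw [IsScalarTower.algebraMap_apply k R A]
      exact Subalgebra.algebraMap_mem _ _
    | add x y _ _ h1 h2 => exact add_mem (h1 trivial) (h2 trivial)
    | mul x y _ _ h1 h2 => exact mul_mem (h1 trivial) (h2 trivial)
  have h2 : (Algebra.adjoin R (range g)).IsAlgebraic := by
    rw [Algebra.isAlgebraic_adjoin_iff]
    rintro _ ⟨i, rfl⟩
    exact hx i
  rw [h] at h2
  exact ⟨fun a => h2 a trivial⟩

theorem exists_transcendenceBasis_of_trdeg {A : Type} [CommRing A] [IsDomain A] [Algebra k A]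
    {m : ℕ} (h : Algebra.trdeg k A = m) : ∃ b : Fin m → A, IsTranscendenceBasis k b := by
  obtain ⟨s, hs⟩ := exists_isTranscendenceBasis k A
  have hc := hs.cardinalMk_eq_trdeg
  rw [h] at hc
  have e : Nonempty (Fin m ≃ s) := by
    rw [← Cardinal.eq, hc]; simp
  obtain ⟨e⟩ := e
  exact ⟨_, (isTranscendenceBasis_equiv e).2 hs⟩

theorem trdeg_quotient_lt {A : Type} [CommRing A] [IsDomain A] [Algebra k A] [Algebra.FiniteType k A]
    (P : Ideal A) [P.IsPrime] (hP : P ≠ ⊥) : Algebra.trdeg k (A ⧸ P) < Algebra.trdeg k A := by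
  have hle : Algebra.trdeg k (A ⧸ P) ≤ Algebra.trdeg k A :=
    trdeg_le_of_surjective (Ideal.Quotient.mkₐ k P) (Ideal.Quotient.mkₐ_surjective k P)
  have hfin : Algebra.trdeg k A < Cardinal.aleph0 := trdeg_lt_aleph0_of_finiteType
  obtain ⟨m, hm⟩ := Cardinal.lt_aleph0.1 (hle.trans_lt hfin)
  refine lt_of_le_of_ne hle fun heq => ?_
  obtain ⟨b, hb⟩ := exists_transcendenceBasis_of_trdeg hm
  choose c hc using fun i => Ideal.Quotient.mkₐ_surjective k P (b i)
  have hc' : (Ideal.Quotient.mkₐ k P) ∘ c = b := funext hc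
  have hci : AlgebraicIndependent k c :=
    AlgebraicIndependent.of_comp (Ideal.Quotient.mkₐ k P) (by rw [hc']; exact hb.1)
  have hcb : IsTranscendenceBasis k c :=
    hci.isTranscendenceBasis_of_trdeg_le hfin (by rw [← heq, hm]; simp)
  obtain ⟨p, hp, hp0⟩ := P.ne_bot_iff.1 hP
  have halg := hcb.isAlgebraic
  obtain ⟨r, hr, hpr⟩ := (halg.isAlgebraic p).exists_nonzero_dvd (mem_nonZeroDivisors_of_ne_zero hp0)
  have hrP : (r : A) ∈ P := P.mem_of_dvd hpr hp
  obtain ⟨q, hq⟩ : ∃ q : MvPolynomial (Fin m) k, aeval c q = (r : A) := by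
    have h : (r : A) ∈ (aeval c : MvPolynomial (Fin m) k →ₐ[k] A).range := by
      rw [← Algebra.adjoin_range_eq_range_aeval]
      exact r.2
    exact h
  have h0 : aeval b q = 0 := by
    rw [← hc', show aeval (⇑(Ideal.Quotient.mkₐ k P) ∘ c) q = (Ideal.Quotient.mkₐ k P) (aeval c q) from
      (MvPolynomial.comp_aeval_apply c (Ideal.Quotient.mkₐ k P) q).symm, hq]
    exact Ideal.Quotient.eq_zero_iff_mem.2 hrP
  have hq0 : q = 0 := hb.1.eq_zero_of_aeval_eq_zero q h0
  apply hr
  ext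
  rw [← hq, hq0]; simp

/-- A finitely generated domain has a chain of primes as long as its transcendence degree. -/
theorem exists_ltSeries_of_trdeg {B : Type} [CommRing B] [IsDomain B] [Algebra k B]
    [Algebra.FiniteType k B] {m : ℕ} (h : Algebra.trdeg k B = m) :
    ∃ l : LTSeries (PrimeSpectrum B), l.length = m := by
  obtain ⟨s, g, hg, hgi⟩ := exists_integral_inj_algHom_of_fg k B
  let _ : Algebra (MvPolynomial (Fin s) k) B := g.toRingHom.toAlgebra
  have hmap : ∀ x, algebraMap (MvPolynomial (Fin s) k) B x = g x := fun _ => rfl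
  have : IsScalarTower k (MvPolynomial (Fin s) k) B :=
    IsScalarTower.of_algebraMap_eq fun x => by rw [hmap]; simp
  have : Algebra.IsIntegral (MvPolynomial (Fin s) k) B := ⟨hgi⟩
  have : FaithfulSMul (MvPolynomial (Fin s) k) B :=
    (faithfulSMul_iff_algebraMap_injective _ _).2 hg
  have hb : IsTranscendenceBasis k (fun i : Fin s => g (X i)) :=
    (IsTranscendenceBasis.mvPolynomial (Fin s) k).algebraMap_comp (A := B)
  have hs : s = m := by
    have := hb.cardinalMk_eq_trdeg
    rw [h] at this
    simpa using this
  subst hs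
  have hd : ringKrullDim (MvPolynomial (Fin s) k) = s := by
    rw [MvPolynomial.ringKrullDim_of_isNoetherianRing]; simp
  obtain ⟨l, hl⟩ := Order.le_krullDim_iff.1 (show (s : WithBot ℕ∞) ≤ Order.krullDim _ from hd.ge)
  have : l.head.asIdeal.IsPrime := l.head.2
  obtain ⟨Q, -, hQ, hQl⟩ := Ideal.exists_ideal_over_prime_of_isIntegral (S := B) l.head.asIdeal ⊥
    (by
      intro x hx
      have : x = 0 := hg (by rw [map_zero]; exact hx)
      rw [this]; exact zero_mem _)
  have : Q.LiesOver l.head.asIdeal := ⟨hQl.symm⟩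
  obtain ⟨L, hL, -⟩ := Ideal.exists_ltSeries_of_hasGoingUp l Q
  exact ⟨L, hL.trans hl⟩

end Trdeg

section Dimension
variable {k : Type} [Field k]

/-- The homogeneous coordinate ring. -/
abbrev coordRing {N : ℕ} (Z : Set (Pr k N)) : Type := MvPolynomial (Fin (N + 1)) k ⧸ coneIdeal Z

/-- The coordinate functions in the homogeneous coordinate ring. -/
noncomputable abbrev coord {N : ℕ} (Z : Set (Pr k N)) (i : Fin (N + 1)) : coordRing Z :=
  Ideal.Quotient.mk (coneIdeal Z) (X i)

theorem adjoin_coord {N : ℕ} (Z : Set (Pr k N)) : Algebra.adjoin k (range (coord Z)) = ⊤ := by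
  have : (Ideal.Quotient.mkₐ k (coneIdeal Z)).range = ⊤ :=
    AlgHom.range_eq_top _ |>.2 (Ideal.Quotient.mkₐ_surjective k _)
  rw [← this, ← Algebra.map_top, ← MvPolynomial.adjoin_range_X, AlgHom.map_adjoin, ← range_comp]
  rfl

theorem IsVariety.isDomain [Infinite k] {N : ℕ} {Z : Set (Pr k N)} (hZ : IsVariety Z) :
    IsDomain (coordRing Z) :=
  have := hZ.isPrime
  Ideal.Quotient.isDomain _

/-- The transcendence degree of the homogeneous coordinate ring. -/
noncomputable def coneDim {N : ℕ} (Z : Set (Pr k N)) : ℕ :=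
  Cardinal.toNat (Algebra.trdeg k (coordRing Z))

theorem trdeg_coordRing {N : ℕ} (Z : Set (Pr k N)) :
    Algebra.trdeg k (coordRing Z) = coneDim Z := by
  rw [coneDim, Cardinal.cast_toNat_of_lt_aleph0 trdeg_lt_aleph0_of_finiteType]

theorem coneDim_lt [Infinite k] {N : ℕ} {W Z : Set (Pr k N)} (hW : IsVariety W) (hZ : IsVariety Z)
    (h : W ⊂ Z) : coneDim W < coneDim Z := by
  have hle := coneIdeal_anti h.subset
  have := hW.isPrime
  have := hZ.isDomain
  let f : coordRing Z →ₐ[k] coordRing W := Ideal.Quotient.factorₐ k hle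
  have hf : Function.Surjective f := Ideal.Quotient.factor_surjective hle
  have := hW.isDomain
  have hkp : (RingHom.ker f).IsPrime := RingHom.ker_isPrime f
  have hk : RingHom.ker f ≠ ⊥ := by
    intro hb
    apply h.not_subset
    refine hW.1.subset_of_coneIdeal_le fun x hx => ?_
    have : Ideal.Quotient.mk (coneIdeal Z) x ∈ RingHom.ker f := by
      rw [RingHom.mem_ker]
      exact Ideal.Quotient.eq_zero_iff_mem.2 hx
    rw [hb] at this
    exact Ideal.Quotient.eq_zero_iff_mem.1 this
  have h1 := trdeg_quotient_lt (k := k) (RingHom.ker f) hk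
  have h2 : Algebra.trdeg k (coordRing Z ⧸ RingHom.ker f) = Algebra.trdeg k (coordRing W) :=
    (Ideal.quotientKerAlgEquivOfSurjective hf).trdeg_eq
  rw [h2, trdeg_coordRing, trdeg_coordRing] at h1
  exact_mod_cast h1

theorem transcendental_coord [Infinite k] {N : ℕ} {Z : Set (Pr k N)} (hZ : IsVariety Z)
    {i : Fin (N + 1)} (hi : X i ∉ coneIdeal Z) : Transcendental k (coord Z i) := by
  rw [transcendental_iff]
  intro p hp
  have hmem : Polynomial.aeval (X i : MvPolynomial (Fin (N + 1)) k) p ∈ coneIdeal Z := by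
    rw [← Ideal.Quotient.eq_zero_iff_mem]
    have := Polynomial.aeval_algHom_apply (Ideal.Quotient.mkₐ k (coneIdeal Z))
      (X i : MvPolynomial (Fin (N + 1)) k) p
    exact this.symm.trans hp
  ext d
  have hd := compStable_coneIdeal Z _ hmem d
  have hcomp : homogeneousComponent d (Polynomial.aeval (X i : MvPolynomial (Fin (N + 1)) k) p)
      = C (p.coeff d) * X i ^ d := by
    rw [Polynomial.aeval_eq_sum_range, map_sum]
    have : ∀ e, homogeneousComponent d (p.coeff e • (X i : MvPolynomial (Fin (N + 1)) k) ^ e)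
        = if e = d then C (p.coeff d) * X i ^ d else 0 := by
      intro e
      rw [map_smul, homogeneousComponent_of_mem (m := d) (n := e) (isHomogeneous_X_pow i e)]
      split_ifs with h1 h2 h2
      · subst h1; rw [smul_eq_C_mul]
      · exact absurd h1.symm h2
      · exact absurd h2.symm h1
      · simp
    rw [Finset.sum_congr rfl fun e _ => this e, Finset.sum_ite_eq']
    split_ifs with h
    · rfl
    · rw [Polynomial.coeff_eq_zero_of_natDegree_lt (by simpa using h)]; simp
  rw [hcomp] at hd
  have hp := hZ.isPrime
  rcases hp.mem_or_mem hd with h | h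
  · by_contra hne
    rw [Polynomial.coeff_zero] at hne
    apply hp.ne_top
    rw [Ideal.eq_top_iff_one]
    have := (coneIdeal Z).mul_mem_left (C (p.coeff d)⁻¹) h
    rwa [← C_mul, inv_mul_cancel₀ hne, C_1] at this
  · exact absurd (hp.mem_of_pow_mem _ h) hi

theorem coneDim_pos [Infinite k] {N : ℕ} {Z : Set (Pr k N)} (hZ : IsVariety Z) :
    0 < coneDim Z := by
  obtain ⟨i, hi⟩ := hZ.exists_X_notMem
  have ht := transcendental_coord hZ hi
  have := hZ.isDomain
  have : Algebra.Transcendental k (coordRing Z) := ⟨_, ht⟩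
  have := trdeg_pos k (coordRing Z)
  rw [trdeg_coordRing] at this
  exact_mod_cast this

theorem krullDim_le_of_coneDim [Infinite k] {N : ℕ} {Z : Set (Pr k N)} {n : ℕ}
    (hZ : IsVariety Z) (h : coneDim Z = n + 1) :
    Order.krullDim {W : Set (Pr k N) // IsVariety W ∧ W ⊆ Z} ≤ (n : ℕ∞) := by
  have hb : ∀ W : {W : Set (Pr k N) // IsVariety W ∧ W ⊆ Z}, coneDim W.1 ≤ n + 1 := by
    rintro ⟨W, hW, hWZ⟩
    rcases hWZ.eq_or_ssubset with rfl | hlt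
    · exact h.le
    · exact h ▸ (coneDim_lt hW hZ hlt).le
  let f : {W : Set (Pr k N) // IsVariety W ∧ W ⊆ Z} → Fin (n + 1) := fun W =>
    ⟨coneDim W.1 - 1, by have := hb W; omega⟩
  have hf : StrictMono f := by
    rintro ⟨W, hW, hWZ⟩ ⟨V, hV, hVZ⟩ hlt
    have h1 : coneDim W < coneDim V := coneDim_lt hW hV hlt
    have h2 := coneDim_pos hW
    simp only [f, Fin.mk_lt_mk]
    omega
  refine iSup_le fun p => ?_
  have := (p.map f hf).length_lt_card
  simp only [LTSeries.map_length, Fintype.card_fin] at this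
  exact_mod_cast Nat.lt_succ_iff.1 this

end Dimension

section DimensionLower
variable {k : Type} [Field k]

theorem aeval_mul_of_isHomogeneous {σ R : Type} [CommRing R] [Algebra k R]
    {f : MvPolynomial σ k} {d : ℕ} (hf : f.IsHomogeneous d) (c : R) (v : σ → R) :
    aeval (fun i => c * v i) f = c ^ d * aeval v f := by
  rw [aeval_def, aeval_def, eval₂_eq, eval₂_eq, Finset.mul_sum]
  refine Finset.sum_congr rfl fun m hm => ?_
  have hdeg : ∑ i ∈ m.support, m i = d := by
    have := hf (mem_support_iff.mp hm)
    simpa [Finsupp.weight_apply, Finsupp.sum] using this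
  simp only [mul_pow, Finset.prod_mul_distrib]
  rw [Finset.prod_pow_eq_pow_sum, hdeg]
  ring

/-- Homogenisation with respect to a variable. -/
theorem exists_homogenization {σ : Type} (i : σ) (f : MvPolynomial σ k) :
    ∃ (g : MvPolynomial σ k) (d : ℕ), g.IsHomogeneous d ∧ (X i - 1) ∣ (g - f) := by
  refine ⟨∑ d ∈ Finset.range (f.totalDegree + 1),
    homogeneousComponent d f * X i ^ (f.totalDegree - d), f.totalDegree, ?_, ?_⟩
  · refine IsHomogeneous.sum _ _ _ fun d hd => ?_
    have h := (homogeneousComponent_isHomogeneous d f).mul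
      (isHomogeneous_X_pow (R := k) i (f.totalDegree - d))
    rwa [Nat.add_sub_cancel' (by simpa [Nat.lt_succ_iff] using hd)] at h
  · conv_rhs => rw [← sum_homogeneousComponent f]
    have h0 : (∑ d ∈ Finset.range (f.totalDegree + 1), homogeneousComponent d f).totalDegree
      = f.totalDegree := by rw [sum_homogeneousComponent]
    rw [sum_homogeneousComponent]
    nth_rewrite 4 [← sum_homogeneousComponent f]
    rw [← Finset.sum_sub_distrib]
    refine Finset.dvd_sum fun d _ => ?_
    have : homogeneousComponent d f * X i ^ (f.totalDegree - d) - homogeneousComponent d f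
      = homogeneousComponent d f * (X i ^ (f.totalDegree - d) - 1) := by ring
    rw [this]
    exact (sub_one_dvd_pow_sub_one _ _).mul_left _

attribute [local instance] MvPolynomial.gradedAlgebra

theorem compStable_homogeneousCore {σ : Type} (Q : Ideal (MvPolynomial σ k)) :
    CompStable (Q.homogeneousCore (homogeneousSubmodule σ k)).toIdeal := by
  intro f hf d
  have := (Q.homogeneousCore (homogeneousSubmodule σ k)).isHomogeneous d hf
  rwa [← decomposition.decompose'_apply]

theorem CompStable.le_homogeneousCore {σ : Type} {I Q : Ideal (MvPolynomial σ k)}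
    (hI : CompStable I) (h : I ≤ Q) : I ≤ (Q.homogeneousCore (homogeneousSubmodule σ k)).toIdeal := by
  intro f hf
  rw [← sum_homogeneousComponent f]
  refine Ideal.sum_mem _ fun d _ => ?_
  exact Ideal.mem_homogeneousCore_of_homogeneous_of_mem
    ⟨d, (mem_homogeneousSubmodule _ _).2 (homogeneousComponent_isHomogeneous d f)⟩ (h (hI f hf d))

theorem coneDim_le_krullDim [IsAlgClosed k] {N : ℕ} {Z : Set (Pr k N)} {n : ℕ}
    (hZ : IsVariety Z) (h : coneDim Z = n + 1) :
    (n : ℕ∞) ≤ Order.krullDim {W : Set (Pr k N) // IsVariety W ∧ W ⊆ Z} := by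
  obtain ⟨i, hi⟩ := hZ.exists_X_notMem
  have := hZ.isDomain
  let K := FractionRing (coordRing Z)
  let ξ : Fin (N + 1) → K := fun j => algebraMap (coordRing Z) K (coord Z j)
  have hξi : ξ i ≠ 0 := by
    intro h0
    have : coord Z i = 0 := IsFractionRing.injective (coordRing Z) K (by rw [map_zero]; exact h0)
    exact hi (Ideal.Quotient.eq_zero_iff_mem.1 this)
  let θ : MvPolynomial (Fin (N + 1)) k →ₐ[k] K := aeval fun j => (ξ i)⁻¹ * ξ j
  have hξ : ∀ f, aeval ξ f = algebraMap (coordRing Z) K (Ideal.Quotient.mk _ f) := by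
    intro f
    have : (aeval ξ : MvPolynomial (Fin (N + 1)) k →ₐ[k] K) =
      (IsScalarTower.toAlgHom k (coordRing Z) K).comp (Ideal.Quotient.mkₐ k (coneIdeal Z)) := by
      ext j; simp [ξ]
    rw [this]; rfl
  let Q0 : Ideal (MvPolynomial (Fin (N + 1)) k) := RingHom.ker θ
  have hQ0 : Q0.IsPrime := RingHom.ker_isPrime θ
  have hIQ : coneIdeal Z ≤ Q0 := by
    intro f hf
    rw [← sum_homogeneousComponent f]
    refine Ideal.sum_mem _ fun d _ => ?_
    rw [RingHom.mem_ker]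
    change aeval (fun j => (ξ i)⁻¹ * ξ j) (homogeneousComponent d f) = 0
    rw [aeval_mul_of_isHomogeneous (homogeneousComponent_isHomogeneous d f), hξ,
      Ideal.Quotient.eq_zero_iff_mem.2 (compStable_coneIdeal Z f hf d), map_zero, mul_zero]
  have hX1 : (X i - 1 : MvPolynomial (Fin (N + 1)) k) ∈ Q0 := by
    rw [RingHom.mem_ker]
    simp [θ, inv_mul_cancel₀ hξi]
  let B := MvPolynomial (Fin (N + 1)) k ⧸ Q0
  have : IsDomain B := Ideal.Quotient.isDomain Q0
  obtain ⟨m, hm⟩ := Cardinal.lt_aleph0.1 (trdeg_lt_aleph0_of_finiteType (R := k) (S := B))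
  have hnm : n ≤ m := by
    let ψ : Polynomial B →ₐ[k] K := Polynomial.eval₂AlgHom (Ideal.kerLiftAlg θ) (ξ i)
      (fun _ => Commute.all _ _)
    have hrange : (IsScalarTower.toAlgHom k (coordRing Z) K).range ≤ ψ.range := by
      rw [← Algebra.map_top, ← adjoin_coord, AlgHom.map_adjoin, Algebra.adjoin_le_iff]
      rintro _ ⟨_, ⟨j, rfl⟩, rfl⟩
      refine ⟨Polynomial.C (Ideal.Quotient.mk Q0 (X j)) * Polynomial.X, ?_⟩
      have h1 : Ideal.kerLiftAlg θ (Ideal.Quotient.mk Q0 (X j)) = (ξ i)⁻¹ * ξ j := by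
        rw [Ideal.kerLiftAlg_mk]; simp [θ]
      change Polynomial.eval₂ _ _ _ = _
      simp only [Polynomial.eval₂_mul, Polynomial.eval₂_C, Polynomial.eval₂_X]
      change Ideal.kerLiftAlg θ (Ideal.Quotient.mk Q0 (X j)) * ξ i = ξ j
      rw [h1, mul_right_comm, inv_mul_cancel₀ hξi, one_mul]
    let g : coordRing Z →ₐ[k] ψ.range := (IsScalarTower.toAlgHom k (coordRing Z) K).codRestrict _
      (fun x => hrange ⟨x, rfl⟩)
    have hg : Function.Injective g := by
      intro a b hab
      exact IsFractionRing.injective (coordRing Z) K (congrArg Subtype.val hab)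
    have h1 : Algebra.trdeg k (coordRing Z) ≤ Algebra.trdeg k ψ.range :=
      trdeg_le_of_injective g hg
    have h2 : Algebra.trdeg k ψ.range ≤ Algebra.trdeg k (Polynomial B) :=
      trdeg_le_of_surjective ψ.rangeRestrict ψ.rangeRestrict_surjective
    have h3 : Algebra.trdeg k (Polynomial B) = m + 1 := by
      rw [← _root_.trdeg_add_eq k B (A := Polynomial B), hm, Polynomial.trdeg_of_isDomain]
    have h4 := h1.trans (h2.trans h3.le)
    rw [trdeg_coordRing, h] at h4
    have h5 : n + 1 ≤ m + 1 := by exact_mod_cast h4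
    omega
  obtain ⟨l, hl⟩ := exists_ltSeries_of_trdeg hm
  let P : PrimeSpectrum B → Ideal (MvPolynomial (Fin (N + 1)) k) := fun q =>
    ((q.asIdeal.comap (Ideal.Quotient.mk Q0)).homogeneousCore
      (homogeneousSubmodule (Fin (N + 1)) k)).toIdeal
  have hQq : ∀ q : PrimeSpectrum B, Q0 ≤ q.asIdeal.comap (Ideal.Quotient.mk Q0) := by
    intro q x hx
    rw [Ideal.mem_comap, Ideal.Quotient.eq_zero_iff_mem.2 hx]
    exact zero_mem _
  have hPp : ∀ q, (P q).IsPrime := fun q => by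
    have : (q.asIdeal.comap (Ideal.Quotient.mk Q0)).IsPrime := Ideal.IsPrime.comap _
    exact Ideal.IsPrime.homogeneousCore this
  have hPs : ∀ q, CompStable (P q) := fun q => compStable_homogeneousCore _
  have hPle : ∀ q, P q ≤ q.asIdeal.comap (Ideal.Quotient.mk Q0) := fun q =>
    Ideal.toIdeal_homogeneousCore_le _ _
  have hPX : ∀ q, X i ∉ P q := by
    intro q hx
    have h1 := hPle q hx
    have h2 := hQq q hX1
    have hp : (q.asIdeal.comap (Ideal.Quotient.mk Q0)).IsPrime := Ideal.IsPrime.comap _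
    apply hp.ne_top
    rw [Ideal.eq_top_iff_one]
    have := sub_mem h1 h2
    rwa [sub_sub_cancel] at this
  let Φ : PrimeSpectrum B → {W : Set (Pr k N) // IsVariety W ∧ W ⊆ Z}ᵒᵈ := fun q =>
    OrderDual.toDual ⟨projZero (P q), isVariety_projZero (hPs q) (hPp q) (hPX q),
      hZ.1.subset_of_coneIdeal_le (by
        rw [coneIdeal_projZero (hPs q) (hPp q) (hPX q)]
        exact (compStable_coneIdeal Z).le_homogeneousCore (hIQ.trans (hQq q)))⟩
  have hΦ : StrictMono Φ := by
    intro q r hqr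
    have hle : q.asIdeal ≤ r.asIdeal := hqr.le
    have hmono : P q ≤ P r :=
      Ideal.homogeneousCore_mono _ (Ideal.comap_mono hle)
    have hne : ¬ P r ≤ P q := by
      intro hrq
      apply hqr.not_ge
      change r.asIdeal ≤ q.asIdeal
      intro b hb
      obtain ⟨f, rfl⟩ := Ideal.Quotient.mk_surjective b
      obtain ⟨g, d, hg, hgf⟩ := exists_homogenization i f
      have hd : g - f ∈ Q0 := Q0.mem_of_dvd hgf hX1
      have hgr : g ∈ P r := by
        refine Ideal.mem_homogeneousCore_of_homogeneous_of_mem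
          ⟨d, (mem_homogeneousSubmodule _ _).2 hg⟩ ?_
        have := add_mem (hQq r hd) (show f ∈ r.asIdeal.comap (Ideal.Quotient.mk Q0) from hb)
        rwa [sub_add_cancel] at this
      have hgq := hPle q (hrq hgr)
      have := sub_mem hgq (hQq q hd)
      rw [sub_sub_cancel] at this
      exact this
    refine lt_of_le_not_ge ?_ ?_
    · change projZero (P r) ⊆ projZero (P q)
      intro p hp f hf
      exact hp f (hmono hf)
    · intro hc
      have hc : projZero (P q) ⊆ projZero (P r) := hc
      have := coneIdeal_anti hc
      rw [coneIdeal_projZero (hPs q) (hPp q) (hPX q),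
        coneIdeal_projZero (hPs r) (hPp r) (hPX r)] at this
      exact hne this
  have h1 := Order.krullDim_le_of_strictMono Φ hΦ
  rw [Order.krullDim_orderDual] at h1
  refine le_trans ?_ h1
  refine le_trans ?_ (Order.LTSeries.length_le_krullDim l)
  rw [hl]
  exact_mod_cast hnm

theorem hasDim_of_coneDim [IsAlgClosed k] {N : ℕ} {Z : Set (Pr k N)} {n : ℕ}
    (hZ : IsVariety Z) (h : coneDim Z = n + 1) : HasDim Z n :=
  le_antisymm (krullDim_le_of_coneDim hZ h) (coneDim_le_krullDim hZ h)

theorem coneDim_of_hasDim [IsAlgClosed k] {N : ℕ} {Z : Set (Pr k N)} {n : ℕ}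
    (hZ : IsVariety Z) (h : HasDim Z n) : coneDim Z = n + 1 := by
  have hp := coneDim_pos hZ
  obtain ⟨m, hm⟩ : ∃ m, coneDim Z = m + 1 := ⟨coneDim Z - 1, by omega⟩
  have h2 : HasDim Z m := hasDim_of_coneDim hZ hm
  unfold HasDim at h h2
  rw [h] at h2
  have : n = m := by exact_mod_cast h2
  omega

end DimensionLower

section Derivations
variable {k : Type} [Field k]

theorem exists_polynomial_of_isTranscendenceBasis {A : Type} [CommRing A] [Algebra k A]
    {ι : Type} {b : ι → A} (hb : IsTranscendenceBasis k b) (a : A) :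
    ∃ p : Polynomial (MvPolynomial ι k), p ≠ 0 ∧
      p.eval₂ (aeval b : MvPolynomial ι k →ₐ[k] A).toRingHom a = 0 := by
  by_cases hA : Nontrivial A
  · have h := hb.isAlgebraic
    have h2 : Algebra.IsAlgebraic (aeval b : MvPolynomial ι k →ₐ[k] A).range A := by
      rw [← Algebra.adjoin_range_eq_range_aeval]; exact h
    obtain ⟨p, hp, hpx⟩ := h2.isAlgebraic a
    let e := AlgEquiv.ofInjective (aeval b : MvPolynomial ι k →ₐ[k] A) hb.1
    refine ⟨p.map (e.symm : _ →+* MvPolynomial ι k), ?_, ?_⟩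
    · rwa [Ne, Polynomial.map_eq_zero_iff e.symm.injective]
    · have he : ((aeval b : MvPolynomial ι k →ₐ[k] A).toRingHom.comp
          (e.symm : _ →+* MvPolynomial ι k)) =
          algebraMap (aeval b : MvPolynomial ι k →ₐ[k] A).range A :=
        RingHom.ext fun y => congrArg Subtype.val (e.apply_symm_apply y)
      rw [Polynomial.eval₂_map, he]
      exact hpx
  · have := not_nontrivial_iff_subsingleton.1 hA
    exact ⟨1, one_ne_zero, Subsingleton.elim _ _⟩

open scoped TensorProduct in
theorem exists_derivation_of_isTranscendenceBasis [CharZero k] {K : Type} [Field K] [Algebra k K]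
    {ι : Type} (b : ι → K) (hb : IsTranscendenceBasis k b) (c : ι → K) :
    ∃ D : Derivation k K K, ∀ i, D (b i) = c i := by
  let P := MvPolynomial ι k
  let _ : Algebra P K := (aeval b : P →ₐ[k] K).toRingHom.toAlgebra
  have hmap : ∀ x : P, algebraMap P K x = aeval b x := fun _ => rfl
  have : IsScalarTower k P K := IsScalarTower.of_algebraMap_eq fun x => by
    rw [hmap]; simp [P]
  have : FaithfulSMul P K := (faithfulSMul_iff_algebraMap_injective _ _).2 hb.1
  have halg : Algebra.IsAlgebraic P K := by
    refine ⟨fun x => ?_⟩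
    obtain ⟨p, hp, hpx⟩ := exists_polynomial_of_isTranscendenceBasis hb x
    exact ⟨p, hp, hpx⟩
  let F := FractionRing P
  let _ : Algebra F K := FractionRing.liftAlgebra P K
  have : IsScalarTower P F K := inferInstance
  have : Algebra.IsAlgebraic F K := (IsFractionRing.comap_isAlgebraic_iff (A := P) (K := F) (C := K)).1 halg
  have : CharZero F := charZero_of_injective_algebraMap (R := k) (FaithfulSMul.algebraMap_injective _ _)
  have h1 : Algebra.FormallyEtale F K := Algebra.FormallyEtale.of_isSeparable F K
  have h2 : Algebra.FormallyEtale P F := Algebra.FormallyEtale.of_isLocalization (nonZeroDivisors P)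
  have h3 : Algebra.FormallyEtale P K := Algebra.FormallyEtale.comp P F K
  let D0 : Derivation k P K := mkDerivation k c
  let e := KaehlerDifferential.tensorKaehlerEquivOfFormallyEtale k P K
  let l : K ⊗[P] Ω[P⁄k] →ₗ[K] K := LinearMap.liftBaseChange K D0.liftKaehlerDifferential
  refine ⟨KaehlerDifferential.linearMapEquivDerivation k K (l.comp e.symm.toLinearMap), fun i => ?_⟩
  have hbi : b i = algebraMap P K (X i) := by rw [hmap]; simp
  rw [hbi]
  change l (e.symm (KaehlerDifferential.D k K _)) = c i
  rw [KaehlerDifferential.tensorKaehlerEquivOfFormallyEtale_symm_D_algebraMap]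
  simp only [l, LinearMap.liftBaseChange_tmul, one_smul, Derivation.liftKaehlerDifferential_comp_D]
  exact mkDerivation_X k c i

/-- A minimal algebraic relation has nonvanishing derivative. -/
theorem exists_separating_polynomial [CharZero k] {A : Type} [CommRing A] [IsDomain A] [Algebra k A]
    {ι : Type} {b : ι → A} (hb : IsTranscendenceBasis k b) (a : A) :
    ∃ p : Polynomial (MvPolynomial ι k), p.eval₂ (aeval b : MvPolynomial ι k →ₐ[k] A).toRingHom a = 0 ∧
      p.derivative.eval₂ (aeval b : MvPolynomial ι k →ₐ[k] A).toRingHom a ≠ 0 := by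
  classical
  have hex : ∃ n, ∃ p : Polynomial (MvPolynomial ι k), p ≠ 0 ∧ p.natDegree = n ∧
      p.eval₂ (aeval b : MvPolynomial ι k →ₐ[k] A).toRingHom a = 0 := by
    obtain ⟨p, hp, hpx⟩ := exists_polynomial_of_isTranscendenceBasis hb a
    exact ⟨_, p, hp, rfl, hpx⟩
  obtain ⟨p, hp0, hpn, hp⟩ := Nat.find_spec hex
  refine ⟨p, hp, fun h => ?_⟩
  have hdeg : p.natDegree ≠ 0 := by
    intro h0
    rw [Polynomial.eq_C_of_natDegree_eq_zero h0, Polynomial.eval₂_C] at hp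
    have := hb.1.eq_zero_of_aeval_eq_zero _ hp
    apply hp0
    rw [Polynomial.eq_C_of_natDegree_eq_zero h0, this, map_zero]
  have hd0 : p.derivative ≠ 0 := by
    intro h0
    exact hdeg (Polynomial.derivative_eq_zero.1 h0)
  have hlt := Polynomial.natDegree_derivative_lt hdeg
  rw [hpn] at hlt
  exact Nat.find_min hex hlt ⟨_, hd0, rfl, h⟩

theorem derivation_aeval_eq_zero {S R : Type} [CommRing S] [Algebra k S] [CommRing R]
    (e : S →+* R) (D : Derivation k S S) {ι : Type} {B : ι → S} (hB : ∀ i, e (D (B i)) = 0)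
    (f : MvPolynomial ι k) : e (D (aeval B f)) = 0 := by
  induction f using MvPolynomial.induction_on with
  | C a => simp [← MvPolynomial.algebraMap_eq]
  | add p q hp hq => simp [hp, hq]
  | mul_X p i hp => simp [hp, hB]

theorem derivation_eval₂ {S R : Type} [CommRing S] [Algebra k S] [CommRing R]
    (e : S →+* R) (D : Derivation k S S) {ι : Type} {B : ι → S} (hB : ∀ i, e (D (B i)) = 0) (x : S)
    (p : Polynomial (MvPolynomial ι k)) :
    e (D (p.eval₂ (aeval B : MvPolynomial ι k →ₐ[k] S).toRingHom x)) =
      e (p.derivative.eval₂ (aeval B : MvPolynomial ι k →ₐ[k] S).toRingHom x) * e (D x) := by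
  induction p using Polynomial.induction_on' with
  | add p q hp hq => simp only [Polynomial.eval₂_add, map_add, hp, hq, add_mul]
  | monomial n a =>
    have h := derivation_aeval_eq_zero e D hB a
    simp only [Polynomial.eval₂_monomial, Polynomial.derivative_monomial]
    change e (D (aeval B a * x ^ n)) = _
    rw [Derivation.leibniz, Derivation.leibniz_pow]
    simp only [smul_eq_mul, map_add, map_mul, h, mul_zero, add_zero, map_nsmul]
    simp
    ring

theorem derivation_eq_zero_of_isTranscendenceBasis [CharZero k] {A : Type} [CommRing A] [IsDomain A]
    [Algebra k A] {ι : Type} {b : ι → A} (hb : IsTranscendenceBasis k b) (D : Derivation k A A)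
    (h : ∀ i, D (b i) = 0) : D = 0 := by
  ext a
  obtain ⟨p, hp, hp'⟩ := exists_separating_polynomial hb a
  have := derivation_eval₂ (RingHom.id A) D (B := b) h a p
  rw [hp] at this
  simp only [map_zero, RingHom.id_apply] at this
  exact (mul_eq_zero.1 this.symm).resolve_left hp'

theorem exists_derivation_clear [CharZero k] {A : Type} [CommRing A] [IsDomain A]
    [Algebra k A] {m : ℕ} (g : Fin m → A) (hg : Algebra.adjoin k (range g) = ⊤)
    (K : Type) [Field K] [Algebra A K] [IsFractionRing A K] [Algebra k K] [IsScalarTower k A K]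
    (D : Derivation k K K) : ∃ d : A, d ≠ 0 ∧ ∃ δ : Derivation k A A, ∀ a,
      algebraMap A K (δ a) = algebraMap A K d * D (algebraMap A K a) := by
  obtain ⟨⟨d, hd⟩, hd2⟩ := IsLocalization.exist_integer_multiples_of_finite (nonZeroDivisors A)
    (fun j => D (algebraMap A K (g j)))
  have hd0 : d ≠ 0 := nonZeroDivisors.ne_zero hd
  have hinj := IsFractionRing.injective A K
  have hall : ∀ a : A, ∃ a' : A, algebraMap A K a' = algebraMap A K d * D (algebraMap A K a) := by
    intro a
    have ha : a ∈ Algebra.adjoin k (range g) := hg ▸ Algebra.mem_top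
    induction ha using Algebra.adjoin_induction with
    | mem x hx =>
      obtain ⟨j, rfl⟩ := hx
      obtain ⟨a', h⟩ := hd2 j
      exact ⟨a', by rw [h, Algebra.smul_def]⟩
    | algebraMap r =>
      refine ⟨0, ?_⟩
      rw [← IsScalarTower.algebraMap_apply k A K]; simp
    | add x y _ _ h1 h2 =>
      obtain ⟨x', hx⟩ := h1
      obtain ⟨y', hy⟩ := h2
      exact ⟨x' + y', by simp only [map_add, hx, hy]; ring⟩
    | mul x y _ _ h1 h2 =>
      obtain ⟨x', hx⟩ := h1
      obtain ⟨y', hy⟩ := h2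
      refine ⟨x * y' + y * x', ?_⟩
      simp only [map_add, map_mul, hx, hy, Derivation.leibniz, smul_eq_mul]; ring
  choose f hf using hall
  refine ⟨d, hd0, Derivation.mk' ⟨⟨f, ?_⟩, ?_⟩ ?_, hf⟩
  · intro x y; apply hinj; simp only [map_add, hf]; ring
  · intro r x; apply hinj
    simp only [hf, RingHom.id_apply, Algebra.smul_def, map_mul, ← IsScalarTower.algebraMap_apply k A K,
      Derivation.leibniz, Derivation.map_algebraMap]; simp; ring
  · intro x y; apply hinj
    simp only [smul_eq_mul, map_add, map_mul, LinearMap.coe_mk, AddHom.coe_mk, hf, Derivation.leibniz]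
    ring

/-- A frame of derivations dual (up to a common denominator) to a transcendence basis. -/
theorem exists_frame [CharZero k] {A : Type} [CommRing A] [IsDomain A]
    [Algebra k A] {m n : ℕ} (g : Fin m → A) (hg : Algebra.adjoin k (range g) = ⊤)
    (b : Fin n → A) (hb : IsTranscendenceBasis k b) :
    ∃ d : A, d ≠ 0 ∧ ∃ δ : Fin n → Derivation k A A, ∀ i j, δ i (b j) = if i = j then d else 0 := by
  let K := FractionRing A
  have hinj := IsFractionRing.injective A K
  have hbK : IsTranscendenceBasis k (fun i => algebraMap A K (b i)) := by
    have : Algebra.IsAlgebraic A K :=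
      (IsFractionRing.comap_isAlgebraic_iff (A := A) (K := K) (C := K)).2 inferInstance
    exact hb.algebraMap_comp
  choose D hD using fun i : Fin n => exists_derivation_of_isTranscendenceBasis _ hbK
    (fun j => if i = j then (1 : K) else 0)
  choose d hd δ hδ using fun i => exists_derivation_clear g hg K (D i)
  refine ⟨∏ i, d i, Finset.prod_ne_zero_iff.2 fun i _ => hd i,
    fun i => (∏ l ∈ Finset.univ.erase i, d l) • δ i, fun i j => ?_⟩
  apply hinj
  rw [Derivation.smul_apply, smul_eq_mul, map_mul, hδ, hD]
  split_ifs with h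
  · rw [mul_one, ← map_mul, mul_comm, Finset.mul_prod_erase _ _ (Finset.mem_univ i)]
  · simp

theorem derivation_sum_apply {A : Type} [CommRing A] [Algebra k A] {ι : Type} (s : Finset ι)
    (δ : ι → Derivation k A A) (a : A) : (∑ i ∈ s, δ i) a = ∑ i ∈ s, δ i a := by
  classical
  induction s using Finset.induction_on with
  | empty => simp
  | insert i s hi h => rw [Finset.sum_insert hi, Finset.sum_insert hi, Derivation.add_apply, h]

theorem frame_span [CharZero k] {A : Type} [CommRing A] [IsDomain A]
    [Algebra k A] {n : ℕ} {b : Fin n → A} (hb : IsTranscendenceBasis k b) {d : A}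
    {δ : Fin n → Derivation k A A} (hδ : ∀ i j, δ i (b j) = if i = j then d else 0)
    (D : Derivation k A A) (a : A) : d * D a = ∑ i, D (b i) * δ i a := by
  have h : d • D - ∑ i, D (b i) • δ i = 0 := by
    apply derivation_eq_zero_of_isTranscendenceBasis hb
    intro j
    rw [Derivation.sub_apply, derivation_sum_apply]
    simp only [hδ, Derivation.smul_apply, smul_eq_mul, mul_ite, mul_zero, Finset.sum_ite_eq',
      Finset.mem_univ, if_true]
    ring
  have h2 := congrArg (fun E : Derivation k A A => E a) h
  simp only [Derivation.sub_apply, derivation_sum_apply, Derivation.smul_apply, smul_eq_mul,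
    Derivation.zero_apply] at h2
  exact sub_eq_zero.1 h2

/-- An element of the fraction field killed by the frame is a constant. -/
theorem exists_const_of_frame [CharZero k] [IsAlgClosed k] {A : Type} [CommRing A] [IsDomain A]
    [Algebra k A] {m n : ℕ} (g : Fin m → A) (hg : Algebra.adjoin k (range g) = ⊤)
    {b : Fin n → A} (hb : IsTranscendenceBasis k b) {d : A} (hd : d ≠ 0)
    {δ : Fin n → Derivation k A A} (hδ : ∀ i j, δ i (b j) = if i = j then d else 0)
    {x y : A} (hy : y ≠ 0) (hxy : ∀ i, δ i x * y = x * δ i y) : ∃ c : k, x = c • y := by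
  let K := FractionRing A
  have hinj := IsFractionRing.injective A K
  have hyK : algebraMap A K y ≠ 0 := by
    intro h; exact hy (hinj (by rw [h, map_zero]))
  set z : K := algebraMap A K x / algebraMap A K y with hz
  by_cases halg : IsAlgebraic k z
  · obtain ⟨c, hc⟩ := (IsAlgClosed.algebraMap_bijective_of_isIntegral
      (k := k) (K := (integralClosure k K))).2 ⟨z, halg.isIntegral⟩
    refine ⟨c, hinj ?_⟩
    have hc' : algebraMap k K c = z := congrArg Subtype.val hc
    rw [Algebra.smul_def, map_mul, ← IsScalarTower.algebraMap_apply, hc', hz, div_mul_cancel₀ _ hyK]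
  · exfalso
    have hs : AlgebraicIndepOn k id ({z} : Set K) := by
      rw [AlgebraicIndepOn]
      exact (algebraicIndependent_unique_type_iff (R := k) (x := fun i : ({z} : Set K) => id i.1)).2 halg
    obtain ⟨t, hst, ht⟩ := exists_isTranscendenceBasis_superset hs
    obtain ⟨D, hD⟩ := exists_derivation_of_isTranscendenceBasis _ ht (fun _ => 1)
    have hDz : D z = 1 := hD ⟨z, hst rfl⟩
    obtain ⟨e, he, D', hD'⟩ := exists_derivation_clear g hg K D
    have h1 : d * (D' x * y) = d * (x * D' y) := by
      have hx := frame_span hb hδ D' x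
      have hy := frame_span hb hδ D' y
      rw [← mul_assoc, hx, mul_left_comm, hy, Finset.sum_mul, Finset.mul_sum]
      refine Finset.sum_congr rfl fun i _ => ?_
      rw [mul_assoc, hxy]; ring
    have h2 := mul_left_cancel₀ hd h1
    have h3 : algebraMap A K (D' x * y) = algebraMap A K (x * D' y) := by rw [h2]
    rw [map_mul, map_mul, hD', hD'] at h3
    have heK : algebraMap A K e ≠ 0 := by
      intro h; exact he (hinj (by rw [h, map_zero]))
    have hx : algebraMap A K x = z * algebraMap A K y := by rw [hz, div_mul_cancel₀ _ hyK]
    rw [hx, Derivation.leibniz, hDz] at h3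
    simp only [smul_eq_mul, mul_one] at h3
    have : algebraMap A K e * (algebraMap A K y * algebraMap A K y) = 0 := by linear_combination h3
    exact mul_ne_zero heK (mul_ne_zero hyK hyK) this

end Derivations

section DualVectors

theorem exists_dual_vectors {A : Type} [CommRing A] [IsDomain A] {ι : Type} [Fintype ι] [DecidableEq ι]
    {r : ℕ} (u : Fin r → ι → A) (h : LinearIndependent A u) :
    ∃ e : A, e ≠ 0 ∧ ∃ V : ι → Fin r → A, ∀ a b, ∑ j, u a j * V j b = if a = b then e else 0 := by
  let K := FractionRing A
  have hinj := IsFractionRing.injective A K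
  let f : (ι → A) →ₗ[A] (ι → K) := LinearMap.compLeft (Algebra.linearMap A K) ι
  have hf : LinearMap.ker f = ⊥ := by
    rw [LinearMap.ker_eq_bot]
    intro x y hxy
    funext j
    exact hinj (congrFun hxy j)
  have h1 : LinearIndependent A (f ∘ u) := h.map' f hf
  rw [LinearIndependent.iff_fractionRing (R := A) (K := K)] at h1
  obtain ⟨g, hg⟩ := LinearMap.exists_leftInverse_of_injective (Fintype.linearCombination K (f ∘ u))
    (LinearMap.ker_eq_bot.2 (linearIndependent_iff_injective_fintypeLinearCombination.1 h1))
  obtain ⟨⟨e, he⟩, hV⟩ := IsLocalization.exist_integer_multiples_of_finite (nonZeroDivisors A)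
    (fun p : ι × Fin r => g (Pi.single p.1 1) p.2)
  choose V hV using hV
  refine ⟨e, nonZeroDivisors.ne_zero he, fun j b => V (j, b), fun a b => hinj ?_⟩
  rw [map_sum]
  simp only [map_mul, hV]
  have h2 : g (f (u a)) b = if a = b then 1 else 0 := by
    have := congrArg (fun T => T (Pi.single a 1) b) hg
    simp only [LinearMap.comp_apply, Fintype.linearCombination_apply_single, one_smul,
      LinearMap.id_apply, Pi.single_apply, Function.comp_apply] at this
    rw [this]
    simp [eq_comm]
  have h3 : f (u a) = ∑ j, algebraMap A K (u a j) • Pi.single j (1 : K) := by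
    funext j
    simp [Finset.sum_apply, Pi.single_apply, f, Algebra.smul_def]
  rw [h3, map_sum, Finset.sum_apply] at h2
  simp only [map_smul, Pi.smul_apply, smul_eq_mul] at h2
  simp only [Algebra.smul_def]
  rw [show (if a = b then e else 0) = e * (if a = b then 1 else 0) by split_ifs <;> simp, map_mul,
    show algebraMap A K (if a = b then 1 else 0) = (if a = b then 1 else 0) by split_ifs <;> simp,
    ← h2, Finset.mul_sum]
  exact Finset.sum_congr rfl fun j _ => by ring

theorem linearIndependent_of_dual_vectors {k A : Type} [Field k] [CommRing A] [Algebra k A]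
    {ι : Type} [Fintype ι] {r : ℕ} {u : Fin r → ι → A} {V : ι → Fin r → A} {e : A}
    (hV : ∀ a b, ∑ j, u a j * V j b = if a = b then e else 0) (ev : A →ₐ[k] k) (he : ev e ≠ 0) :
    LinearIndependent k (fun a j => ev (u a j)) := by
  rw [Fintype.linearIndependent_iff]
  intro c hc b
  have h1 : ∑ j, (∑ a, c a * ev (u a j)) * ev (V j b) = 0 := by
    refine Finset.sum_eq_zero fun j _ => ?_
    have := congrFun hc j
    simp only [Finset.sum_apply, Pi.smul_apply, smul_eq_mul, Pi.zero_apply] at this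
    rw [this, zero_mul]
  have h2 : ∀ a, ∑ j, ev (u a j) * ev (V j b) = if a = b then ev e else 0 := by
    intro a
    have := congrArg ev (hV a b)
    rw [map_sum] at this
    simp only [map_mul] at this
    rw [this]; split_ifs <;> simp
  simp only [Finset.sum_mul] at h1
  rw [Finset.sum_comm] at h1
  simp only [mul_assoc, ← Finset.mul_sum, h2, mul_ite, mul_zero, Finset.sum_ite_eq', Finset.mem_univ,
    if_true] at h1
  exact (mul_eq_zero.1 h1).resolve_right he

theorem eq_sum_of_mem_span_of_dual_vectors {k A : Type} [Field k] [CommRing A] [Algebra k A]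
    {ι : Type} [Fintype ι] {r : ℕ} {u : Fin r → ι → A} {V : ι → Fin r → A} {e : A}
    (hV : ∀ a b, ∑ j, u a j * V j b = if a = b then e else 0) (ev : A →ₐ[k] k) {w : ι → A}
    (hw : (fun j => ev (w j)) ∈ Submodule.span k (range fun a j => ev (u a j))) (j : ι) :
    ev (e * w j) = ev (∑ a, (∑ l, w l * V l a) * u a j) := by
  rw [Submodule.mem_span_range_iff_exists_fun] at hw
  obtain ⟨c, hc⟩ := hw
  have h0 : ∀ l, ev (w l) = ∑ a, c a * ev (u a l) := by
    intro l
    have := congrFun hc l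
    simp only [Finset.sum_apply, Pi.smul_apply, smul_eq_mul] at this
    exact this.symm
  have h2 : ∀ a b, ∑ j, ev (u a j) * ev (V j b) = if a = b then ev e else 0 := by
    intro a b
    have := congrArg ev (hV a b)
    rw [map_sum] at this
    simp only [map_mul] at this
    rw [this]; split_ifs <;> simp
  have h3 : ∀ b, ∑ l, ev (w l) * ev (V l b) = c b * ev e := by
    intro b
    simp only [h0, Finset.sum_mul]
    rw [Finset.sum_comm]
    simp only [mul_assoc, ← Finset.mul_sum, h2, mul_ite, mul_zero, Finset.sum_ite_eq',
      Finset.mem_univ, if_true]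
  simp only [map_mul, map_sum, h3]
  rw [h0, Finset.mul_sum]
  exact Finset.sum_congr rfl fun a _ => by ring

end DualVectors

section Taylor
variable {k A : Type} [Field k] [CommRing A] [Algebra k A]

/-- The formal integral curve of a derivation through a point. -/
noncomputable def taylor [CharZero k] (δ : Derivation k A A) (ev : A →ₐ[k] k) :
    A →ₐ[k] PowerSeries k := by
  let T : A → PowerSeries k := fun a => PowerSeries.mk fun n => (n.factorial : k)⁻¹ * ev (δ^[n] a)
  have hadd : ∀ a b, T (a + b) = T a + T b := by
    intro a b
    ext n
    simp only [T, PowerSeries.coeff_mk, map_add]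
    rw [iterate_map_add, map_add, mul_add]
  have hder : ∀ a n, PowerSeries.coeff (n + 1) (T a) * (n + 1) = PowerSeries.coeff n (T (δ a)) := by
    intro a n
    have h1 : ((n : k) + 1) ≠ 0 := by exact_mod_cast n.succ_ne_zero
    have h2 : (n.factorial : k) ≠ 0 := by exact_mod_cast n.factorial_ne_zero
    simp only [T, PowerSeries.coeff_mk, Nat.factorial_succ, Nat.cast_mul, Function.iterate_succ_apply]
    push_cast
    field_simp
  have hder' : ∀ a, PowerSeries.derivative k (T a) = T (δ a) := by
    intro a; ext n; rw [PowerSeries.coeff_derivative, hder]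
  have hmul : ∀ n a b, PowerSeries.coeff n (T (a * b)) = PowerSeries.coeff n (T a * T b) := by
    intro n
    induction n with
    | zero => intro a b; simp [T, PowerSeries.coeff_mul]
    | succ n ih =>
      intro a b
      have h1 : ((n : k) + 1) ≠ 0 := by exact_mod_cast n.succ_ne_zero
      apply mul_right_cancel₀ h1
      rw [hder, Derivation.leibniz, hadd, map_add, smul_eq_mul, smul_eq_mul, ih, ih,
        ← PowerSeries.coeff_derivative, Derivation.leibniz, hder', hder', map_add, smul_eq_mul,
        smul_eq_mul]
  have hconst : ∀ r : k, T (algebraMap k A r) = algebraMap k _ r := by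
    intro r
    have h0 : T 0 = 0 := by
      ext n; simp only [T, PowerSeries.coeff_mk]; rw [iterate_map_zero]; simp
    ext n
    cases n with
    | zero => simp [T]
    | succ n =>
      have h1 : ((n : k) + 1) ≠ 0 := by exact_mod_cast n.succ_ne_zero
      apply mul_right_cancel₀ h1
      rw [hder, Derivation.map_algebraMap, h0]
      simp
  exact
    { toFun := T
      map_one' := by rw [← map_one (algebraMap k A), hconst, map_one]
      map_mul' := fun a b => by ext n; exact hmul n a b
      map_zero' := by rw [← map_zero (algebraMap k A), hconst, map_zero]
      map_add' := hadd
      commutes' := hconst }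

theorem coeff_taylor [CharZero k] (δ : Derivation k A A) (ev : A →ₐ[k] k) (a : A) (n : ℕ) :
    PowerSeries.coeff n (taylor δ ev a) = (n.factorial : k)⁻¹ * ev (δ^[n] a) :=
  PowerSeries.coeff_mk (R := k) n (fun n => (n.factorial : k)⁻¹ * ev (δ^[n] a))

end Taylor

section Tangent
variable {k : Type} [Field k] {M : ℕ}

theorem diffAt_apply (f : MvPolynomial (Fin (M + 1)) k) (v w : Fin (M + 1) → k) :
    diffAt f v w = ∑ j, eval v (pderiv j f) * w j := by
  simp [diffAt, LinearMap.sum_apply]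

/-- The derivation along a constant vector field. -/
noncomputable def constDerivation (w : Fin (M + 1) → k) :
    Derivation k (MvPolynomial (Fin (M + 1)) k) (MvPolynomial (Fin (M + 1)) k) :=
  mkDerivation k fun j => C (w j)

theorem diffAt_eq_constDerivation (f : MvPolynomial (Fin (M + 1)) k) (v w : Fin (M + 1) → k) :
    diffAt f v w = eval v (constDerivation w f) := by
  have : constDerivation w = ∑ j, (C (w j) : MvPolynomial (Fin (M + 1)) k) • (pderiv j :
      Derivation k (MvPolynomial (Fin (M + 1)) k) (MvPolynomial (Fin (M + 1)) k)) := by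
    ext i : 1
    rw [derivation_sum_apply]
    simp [constDerivation, pderiv_X, Pi.single_apply]
  rw [this, derivation_sum_apply, map_sum, diffAt_apply]
  refine Finset.sum_congr rfl fun j _ => ?_
  simp [mul_comm]

theorem diffAt_smul_of_isHomogeneous {f : MvPolynomial (Fin (M + 1)) k} {d : ℕ}
    (hf : f.IsHomogeneous d) (c : k) (v w : Fin (M + 1) → k) :
    diffAt f (c • v) w = c ^ (d - 1) * diffAt f v w := by
  rw [diffAt_apply, diffAt_apply, Finset.mul_sum]
  refine Finset.sum_congr rfl fun j _ => ?_
  rw [eval_smul_of_isHomogeneous hf.pderiv]; ring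

theorem diffAt_sum {ι : Type} (s : Finset ι) (f : ι → MvPolynomial (Fin (M + 1)) k)
    (v w : Fin (M + 1) → k) : diffAt (∑ i ∈ s, f i) v w = ∑ i ∈ s, diffAt (f i) v w := by
  simp only [diffAt_eq_constDerivation, map_sum]

theorem mem_embTangent_mk [Infinite k] {Z : Set (Pr k M)} {v : Fin (M + 1) → k} (hv : v ≠ 0)
    {w : Fin (M + 1) → k} :
    w ∈ embTangent Z (Projectivization.mk k v hv) ↔ ∀ f ∈ coneIdeal Z, diffAt f v w = 0 := by
  obtain ⟨a, ha⟩ := Projectivization.exists_smul_eq_mk_rep k v hv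
  have ha' : (Projectivization.mk k v hv).rep = (a : k) • v := ha.symm
  unfold embTangent
  simp only [Submodule.mem_iInf, LinearMap.mem_ker, ha']
  constructor
  · intro h f hf
    rw [← sum_homogeneousComponent f, diffAt_sum]
    refine Finset.sum_eq_zero fun d _ => ?_
    have hm : homogeneousComponent d f ∈ coneIdeal Z := compStable_coneIdeal Z f hf d
    have hh := homogeneousComponent_isHomogeneous d f
    have := h (homogeneousComponent d f) ⟨⟨d, hh⟩, mem_coneIdeal_iff_vanishes.1 hm⟩
    rw [diffAt_smul_of_isHomogeneous hh] at this
    exact (mul_eq_zero.1 this).resolve_left (pow_ne_zero _ a.ne_zero)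
  · rintro h f ⟨⟨d, hd⟩, hf⟩
    rw [diffAt_smul_of_isHomogeneous hd, h f (mem_coneIdeal_iff_vanishes.2 hf), mul_zero]

/-- Evaluation of the coordinate ring at a vector of the affine cone. -/
noncomputable def coneEval {Z : Set (Pr k M)} (v : Fin (M + 1) → k)
    (hv : ∀ f ∈ coneIdeal Z, eval v f = 0) : coordRing Z →ₐ[k] k :=
  Ideal.Quotient.liftₐ (coneIdeal Z) (aeval v) fun f hf => by
    rw [← coe_aeval_eq_eval] at hv; exact hv f hf

theorem coneEval_mk {Z : Set (Pr k M)} (v : Fin (M + 1) → k)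
    (hv : ∀ f ∈ coneIdeal Z, eval v f = 0) (f : MvPolynomial (Fin (M + 1)) k) :
    coneEval v hv (Ideal.Quotient.mk _ f) = eval v f := by
  rw [← coe_aeval_eq_eval]; rfl

theorem derivation_mk {Z : Set (Pr k M)} (δ : Derivation k (coordRing Z) (coordRing Z))
    (f : MvPolynomial (Fin (M + 1)) k) :
    δ (Ideal.Quotient.mk _ f) = ∑ j, Ideal.Quotient.mk _ (pderiv j f) * δ (coord Z j) := by
  induction f using MvPolynomial.induction_on with
  | C a =>
    have : Ideal.Quotient.mk (coneIdeal Z) (C a) = algebraMap k (coordRing Z) a := rfl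
    rw [this]; simp
  | add p q hp hq => simp only [map_add, hp, hq, add_mul, Finset.sum_add_distrib]
  | mul_X p i hp =>
    rw [map_mul, Derivation.leibniz, hp]
    simp only [Derivation.leibniz, pderiv_X, smul_eq_mul, map_add, map_mul, add_mul,
      Finset.sum_add_distrib, Pi.single_apply]
    rw [Finset.mul_sum]
    congr 1
    · simp [apply_ite, Finset.sum_ite_eq]
    · exact Finset.sum_congr rfl fun j _ => by ring

theorem coneEval_derivation {Z : Set (Pr k M)} (δ : Derivation k (coordRing Z) (coordRing Z))
    (v : Fin (M + 1) → k) (hv : ∀ f ∈ coneIdeal Z, eval v f = 0) (f : MvPolynomial (Fin (M + 1)) k) :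
    coneEval v hv (δ (Ideal.Quotient.mk _ f)) = diffAt f v fun j => coneEval v hv (δ (coord Z j)) := by
  rw [derivation_mk, map_sum, diffAt_apply]
  simp only [map_mul, coneEval_mk]

/-- At a general point of the cone the tangent space is spanned by a frame of derivations. -/
theorem exists_tangent_span [CharZero k] {Z : Set (Pr k M)} [IsDomain (coordRing Z)] {n : ℕ}
    {b : Fin n → coordRing Z} (hb : IsTranscendenceBasis k b) {d : coordRing Z}
    {δ : Fin n → Derivation k (coordRing Z) (coordRing Z)}
    (hδ : ∀ i j, δ i (b j) = if i = j then d else 0) :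
    ∃ h : coordRing Z, h ≠ 0 ∧ ∀ (v : Fin (M + 1) → k) (hv : ∀ f ∈ coneIdeal Z, eval v f = 0),
      coneEval v hv d ≠ 0 → coneEval v hv h ≠ 0 → ∀ w : Fin (M + 1) → k,
      (∀ f ∈ coneIdeal Z, diffAt f v w = 0) →
      w ∈ Submodule.span k (range fun i j => coneEval v hv (δ i (coord Z j))) := by
  choose B hB using fun i => Ideal.Quotient.mk_surjective (I := coneIdeal Z) (b i)
  choose p hp hp' using fun j => exists_separating_polynomial hb (coord Z j)
  have hcomp : ((aeval b : MvPolynomial (Fin n) k →ₐ[k] coordRing Z).toRingHom) =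
      (Ideal.Quotient.mk (coneIdeal Z)).comp
        (aeval B : MvPolynomial (Fin n) k →ₐ[k] MvPolynomial (Fin (M + 1)) k).toRingHom := by
    have : (aeval b : MvPolynomial (Fin n) k →ₐ[k] coordRing Z) = (Ideal.Quotient.mkₐ k (coneIdeal Z)).comp
        (aeval B) := by
      ext i
      simp [hB]
    rw [this]; rfl
  have hpq : ∀ (q : Polynomial (MvPolynomial (Fin n) k)) j,
      q.eval₂ (aeval b : MvPolynomial (Fin n) k →ₐ[k] coordRing Z).toRingHom (coord Z j) =
      Ideal.Quotient.mk (coneIdeal Z) (q.eval₂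
        (aeval B : MvPolynomial (Fin n) k →ₐ[k] MvPolynomial (Fin (M + 1)) k).toRingHom (X j)) := by
    intro q j
    rw [hcomp, Polynomial.hom_eval₂]
  refine ⟨∏ j, (p j).derivative.eval₂ (aeval b : MvPolynomial (Fin n) k →ₐ[k] coordRing Z).toRingHom
    (coord Z j), Finset.prod_ne_zero_iff.2 fun j _ => hp' j, ?_⟩
  intro v hv hd hh w hw
  have hh' : ∀ j, eval v ((p j).derivative.eval₂
      (aeval B : MvPolynomial (Fin n) k →ₐ[k] MvPolynomial (Fin (M + 1)) k).toRingHom (X j)) ≠ 0 := by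
    intro j
    rw [map_prod, Finset.prod_ne_zero_iff] at hh
    have := hh j (Finset.mem_univ j)
    rwa [hpq, coneEval_mk] at this
  have hzero : ∀ w : Fin (M + 1) → k, (∀ f ∈ coneIdeal Z, diffAt f v w = 0) →
      (∀ i, diffAt (B i) v w = 0) → w = 0 := by
    intro w hw hBw
    funext j
    have h1 := derivation_eval₂ (eval v) (constDerivation w)
      (B := B) (fun i => by rw [← diffAt_eq_constDerivation]; exact hBw i) (X j) (p j)
    have h2 : (p j).eval₂ (aeval B : MvPolynomial (Fin n) k →ₐ[k] MvPolynomial (Fin (M + 1)) k).toRingHom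
        (X j) ∈ coneIdeal Z := by
      rw [← Ideal.Quotient.eq_zero_iff_mem, ← hpq, hp]
    rw [← diffAt_eq_constDerivation, hw _ h2] at h1
    have h3 := (mul_eq_zero.1 h1.symm).resolve_left (hh' j)
    simpa [constDerivation] using h3
  let t : Fin n → Fin (M + 1) → k := fun i j => coneEval v hv (δ i (coord Z j))
  have ht : ∀ i, ∀ f ∈ coneIdeal Z, diffAt f v (t i) = 0 := by
    intro i f hf
    have := coneEval_derivation (δ i) v hv f
    rw [Ideal.Quotient.eq_zero_iff_mem.2 hf] at this
    simp only [map_zero] at this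
    exact this.symm
  have htB : ∀ i l, diffAt (B l) v (t i) = if i = l then coneEval v hv d else 0 := by
    intro i l
    have := coneEval_derivation (δ i) v hv (B l)
    rw [hB, hδ] at this
    rw [← this]; split_ifs <;> simp
  have hmain := hzero (coneEval v hv d • w - ∑ i, diffAt (B i) v w • t i)
    (by
      intro f hf
      rw [map_sub, map_smul, hw f hf, map_sum]
      simp [ht _ f hf])
    (by
      intro l
      rw [map_sub, map_smul, map_sum]
      simp [htB, mul_comm])
  have hw' : w = (coneEval v hv d)⁻¹ • ∑ i, diffAt (B i) v w • t i := by
    rw [← sub_eq_zero.1 hmain, smul_smul, inv_mul_cancel₀ hd, one_smul]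
  rw [hw']
  exact Submodule.smul_mem _ _ (Submodule.sum_mem _ fun i _ =>
    Submodule.smul_mem _ _ (Submodule.subset_span ⟨i, rfl⟩))

end Tangent

section Descent

/-- If the second derivatives of functions `G t` along a frame lie in the span of their first
derivatives, with coefficients independent of `t`, then more than `n` such functions satisfy a
constant linear relation. -/
theorem exists_const_relation {k : Type} [Field k] [CharZero k] [IsAlgClosed k] {A : Type}
    [CommRing A] [IsDomain A] [Algebra k A] {m n : ℕ} (g : Fin m → A)
    (hg : Algebra.adjoin k (range g) = ⊤) {b : Fin n → A} (hb : IsTranscendenceBasis k b) {d : A}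
    (hd : d ≠ 0) {δ : Fin n → Derivation k A A}
    (hδ : ∀ i j, δ i (b j) = if i = j then d else 0)
    {ι : Type} [Fintype ι] (hι : n < Fintype.card ι) (G : ι → A)
    (h2 : ∀ i j, ∃ e : A, e ≠ 0 ∧ ∃ c : Fin n → A, ∀ t,
      e * δ i (δ j (G t)) = ∑ a, c a * δ a (G t)) :
    ∃ c : ι → k, c ≠ 0 ∧ ∃ c₀ : k, ∑ t, c t • G t = algebraMap k A c₀ := by
  classical
  let P : (ι → A) → Prop := fun μ => ∀ i, ∑ t, μ t * δ i (G t) = 0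
  have hex : ∃ μ : ι → A, P μ ∧ μ ≠ 0 := by
    have hli : ¬ LinearIndependent A (fun (t : ι) (i : Fin n) => δ i (G t)) := by
      intro h
      have := h.fintype_card_le_finrank
      rw [Module.finrank_fin_fun] at this
      omega
    rw [Fintype.not_linearIndependent_iff] at hli
    obtain ⟨μ, h, t, ht⟩ := hli
    refine ⟨μ, fun i => ?_, fun h0 => ht (by rw [h0]; rfl)⟩
    have := congrFun h i
    simpa [Finset.sum_apply] using this
  obtain ⟨μ, ⟨hμ, hμ0⟩, hmin⟩ := exists_minimalFor_of_wellFoundedLT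
    (fun μ : ι → A => P μ ∧ μ ≠ 0)
    (fun μ => (Finset.univ.filter fun t => μ t ≠ 0).card) hex
  obtain ⟨s, hs⟩ := Function.ne_iff.1 hμ0
  have hs : μ s ≠ 0 := hs
  have hconst : ∀ t, ∃ c : k, μ t = c • μ s := by
    intro t
    refine exists_const_of_frame g hg hb hd hδ hs fun j => ?_
    let ν : ι → A := fun t => μ s * δ j (μ t) - δ j (μ s) * μ t
    have hνP : P ν := by
      intro i
      have h3 : ∑ t, δ j (μ t) * δ i (G t) = 0 := by
        obtain ⟨e, he, c, hc⟩ := h2 j i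
        have h4 := congrArg (δ j) (hμ i)
        rw [map_sum, map_zero] at h4
        simp only [Derivation.leibniz, smul_eq_mul, Finset.sum_add_distrib] at h4
        have h5 : e * ∑ t, μ t * δ j (δ i (G t)) = 0 := by
          rw [Finset.mul_sum]
          calc ∑ t, e * (μ t * δ j (δ i (G t))) = ∑ t, ∑ a, c a * (μ t * δ a (G t)) := by
                refine Finset.sum_congr rfl fun t _ => ?_
                rw [mul_left_comm, hc, Finset.mul_sum]
                exact Finset.sum_congr rfl fun a _ => by ring
            _ = 0 := by
                rw [Finset.sum_comm]
                refine Finset.sum_eq_zero fun a _ => ?_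
                rw [← Finset.mul_sum, hμ a, mul_zero]
        rw [(mul_eq_zero.1 h5).resolve_left he, zero_add] at h4
        rw [← h4]
        exact Finset.sum_congr rfl fun t _ => by ring
      calc ∑ t, ν t * δ i (G t) = μ s * ∑ t, δ j (μ t) * δ i (G t)
            - δ j (μ s) * ∑ t, μ t * δ i (G t) := by
              rw [Finset.mul_sum, Finset.mul_sum, ← Finset.sum_sub_distrib]
              exact Finset.sum_congr rfl fun t _ => by simp only [ν]; ring
        _ = 0 := by rw [h3, hμ i]; ring
    have hν0 : ν = 0 := by
      by_contra hne
      have hsub : (Finset.univ.filter fun t => ν t ≠ 0) ⊂ Finset.univ.filter fun t => μ t ≠ 0 := by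
        rw [Finset.ssubset_iff_of_subset]
        · refine ⟨s, by simpa using hs, ?_⟩
          simp [ν, mul_comm]
        · intro t ht
          simp only [Finset.mem_filter, Finset.mem_univ, true_and] at ht ⊢
          intro h0
          exact ht (by simp [ν, h0])
      have hlt := Finset.card_lt_card hsub
      have := hmin ⟨hνP, hne⟩ hlt.le
      exact absurd hlt (not_lt.2 this)
    have := congrFun hν0 t
    simp only [ν, Pi.zero_apply, sub_eq_zero] at this
    rw [mul_comm, this, mul_comm]
  choose c hc using hconst
  refine ⟨c, fun h => ?_, ?_⟩
  · have := hc s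
    rw [h] at this
    simp at this
    exact hs this
  · have h0 : ∀ i, δ i (∑ t, c t • G t) = 0 := by
      intro i
      rw [map_sum]
      simp only [Derivation.map_smul]
      have h6 : μ s * ∑ t, c t • δ i (G t) = 0 := by
        rw [Finset.mul_sum, ← hμ i]
        refine Finset.sum_congr rfl fun t _ => ?_
        rw [hc t, mul_smul_comm, smul_mul_assoc]
      exact (mul_eq_zero.1 h6).resolve_left hs
    obtain ⟨c₀, h⟩ := exists_const_of_frame g hg hb hd hδ (x := ∑ t, c t • G t) (y := 1) one_ne_zero
      (fun i => by rw [h0 i]; simp)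
    exact ⟨c₀, by rw [h, Algebra.algebraMap_eq_smul_one]⟩

end Descent

section Reps
variable {k : Type} [Field k] {M N : ℕ}

/-- A tuple of forms of degree `d` representing `φ` wherever the forms do not vanish. -/
def IsRep (X : Set (Pr k M)) (φ : Pr k M → Pr k N) (d : ℕ)
    (F : Fin (N + 1) → MvPolynomial (Fin (M + 1)) k) : Prop :=
  (∀ i, (F i).IsHomogeneous d) ∧ ∀ (v : Fin (M + 1) → k) (hv : v ≠ 0),
    Projectivization.mk k v hv ∈ X → ∀ hFv : (fun i => eval v (F i)) ≠ 0,
      φ (Projectivization.mk k v hv) = Projectivization.mk k _ hFv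

variable {X : Set (Pr k M)} {φ : Pr k M → Pr k N}

theorem eval_smul_vec {d : ℕ} {F : Fin (N + 1) → MvPolynomial (Fin (M + 1)) k}
    (hF : ∀ i, (F i).IsHomogeneous d) (c : k) (v : Fin (M + 1) → k) :
    (fun i => eval (c • v) (F i)) = c ^ d • fun i => eval v (F i) := by
  funext i
  simp [eval_smul_of_isHomogeneous (hF i)]

theorem IsRep.localRep {d : ℕ} {F : Fin (N + 1) → MvPolynomial (Fin (M + 1)) k}
    (h : IsRep X φ d F) {v : Fin (M + 1) → k} (hv : v ≠ 0)
    (hFv : (fun i => eval v (F i)) ≠ 0) : LocalRep X φ (Projectivization.mk k v hv) F := by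
  refine ⟨⟨d, h.1⟩, ?_, ?_⟩
  · obtain ⟨a, ha⟩ := Projectivization.exists_smul_eq_mk_rep k v hv
    have ha' : (Projectivization.mk k v hv).rep = (a : k) • v := ha.symm
    rw [ha', eval_smul_vec h.1]
    exact smul_ne_zero (pow_ne_zero _ a.ne_zero) hFv
  · rintro q hq w hw rfl hFw
    exact h.2 w hw hq hFw

theorem exists_isRep (hφ : IsMorphismOn X φ) {v : Fin (M + 1) → k} (hv : v ≠ 0)
    (hvX : Projectivization.mk k v hv ∈ X) :
    ∃ d F, IsRep X φ (d + 1) F ∧ (fun i => eval v (F i)) ≠ 0 := by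
  obtain ⟨F, ⟨d, hd⟩, hF0, hF⟩ := hφ _ hvX
  obtain ⟨a, ha⟩ := Projectivization.exists_smul_eq_mk_rep k v hv
  have ha' : (Projectivization.mk k v hv).rep = (a : k) • v := ha.symm
  rw [ha', eval_smul_vec hd] at hF0
  obtain ⟨i, hi⟩ := Function.ne_iff.1 hv
  have hev : ∀ w : Fin (M + 1) → k, (fun j => eval w (MvPolynomial.X i * F j)) =
      w i • fun j => eval w (F j) := by
    intro w; funext j; simp
  refine ⟨d, fun j => MvPolynomial.X i * F j, ⟨fun j => ?_, ?_⟩, ?_⟩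
  · rw [add_comm d 1]
    exact (isHomogeneous_X k i).mul (hd j)
  · intro w hw hwX hne
    rw [hev] at hne
    have h1 : (fun j => eval w (F j)) ≠ 0 := fun h => hne (by rw [h, smul_zero])
    have h2 : w i ≠ 0 := fun h => hne (by rw [h, zero_smul])
    rw [hF _ hwX w hw rfl h1, Projectivization.mk_eq_mk_iff']
    refine ⟨(w i)⁻¹, ?_⟩
    rw [hev, smul_smul, inv_mul_cancel₀ h2, one_smul]
  · rw [hev]
    exact smul_ne_zero hi fun h => hF0 (by rw [h, smul_zero])

/-- Two representations are proportional at every point of the cone. -/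
theorem IsRep.proportional {d e : ℕ} {F G : Fin (N + 1) → MvPolynomial (Fin (M + 1)) k}
    (hF : IsRep X φ d F) (hG : IsRep X φ e G) (i j : Fin (N + 1)) :
    Ideal.Quotient.mk (coneIdeal X) (F i) * Ideal.Quotient.mk _ (G j) =
      Ideal.Quotient.mk (coneIdeal X) (F j) * Ideal.Quotient.mk _ (G i) := by
  rw [← map_mul, ← map_mul, Ideal.Quotient.eq, mem_coneIdeal]
  intro v hv hvX
  rw [map_sub, map_mul, map_mul]
  by_cases h1 : (fun i => eval v (F i)) = 0
  · have h2 := congrFun h1 i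
    have h3 := congrFun h1 j
    simp only [Pi.zero_apply] at h2 h3
    rw [h2, h3]; ring
  by_cases h1' : (fun i => eval v (G i)) = 0
  · have h2 := congrFun h1' i
    have h3 := congrFun h1' j
    simp only [Pi.zero_apply] at h2 h3
    rw [h2, h3]; ring
  have h := (hF.2 v hv hvX h1).symm.trans (hG.2 v hv hvX h1')
  rw [Projectivization.mk_eq_mk_iff'] at h
  obtain ⟨a, ha⟩ := h
  have h2 := congrFun ha i
  have h3 := congrFun ha j
  simp only [Pi.smul_apply, smul_eq_mul] at h2 h3
  rw [← h2, ← h3]; ring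

/-- Homogeneous elements of positive degree are not nonzero constants. -/
theorem eq_zero_of_const [Infinite k] {d : ℕ} {f : MvPolynomial (Fin (M + 1)) k}
    (hf : f.IsHomogeneous (d + 1)) {c : k}
    (h : Ideal.Quotient.mk (coneIdeal X) f = algebraMap k (coordRing X) c) :
    Ideal.Quotient.mk (coneIdeal X) f = 0 := by
  have h1 : Ideal.Quotient.mk (coneIdeal X) f = Ideal.Quotient.mk (coneIdeal X) (C c) := h
  rw [Ideal.Quotient.eq] at h1
  have h2 := compStable_coneIdeal X _ h1 (d + 1)
  rw [map_sub, homogeneousComponent_of_mem hf, homogeneousComponent_of_mem (isHomogeneous_C _ c)]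
    at h2
  simpa [Ideal.Quotient.eq_zero_iff_mem] using h2

end Reps

section Jacobian

theorem derivation_aeval {k A ι : Type} [Field k] [CommRing A] [Algebra k A] [Fintype ι]
    (D : Derivation k A A) (y : ι → A) (p : MvPolynomial ι k) :
    D (aeval y p) = ∑ a, aeval y (pderiv a p) * D (y a) := by
  classical
  induction p using MvPolynomial.induction_on with
  | C a => simp
  | add p q hp hq => simp only [map_add, hp, hq, add_mul, Finset.sum_add_distrib]
  | mul_X p i hp =>
    simp only [map_mul, aeval_X, Derivation.leibniz, smul_eq_mul, hp, map_add, pderiv_X,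
      add_mul, Finset.sum_add_distrib, Finset.mul_sum]
    congr 1
    · simp [Pi.single_apply]
    · exact Finset.sum_congr rfl fun a _ => by ring

theorem totalDegree_pderiv_le {k ι : Type} [Field k] (p : MvPolynomial ι k) (a : ι) :
    (pderiv a p).totalDegree ≤ p.totalDegree - 1 := by
  refine Finset.sup_le fun m hm => ?_
  rw [MvPolynomial.mem_support_iff, coeff_pderiv] at hm
  have h1 : coeff (m + Finsupp.single a 1) p ≠ 0 := left_ne_zero_of_mul hm
  have h2 := le_totalDegree (MvPolynomial.mem_support_iff.2 h1)
  rw [Finsupp.sum_add_index' (fun _ => rfl) (fun _ _ _ => rfl), Finsupp.sum_single_index rfl] at h2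
  omega

theorem eq_C_of_pderiv_eq_zero {k ι : Type} [Field k] [CharZero k] {p : MvPolynomial ι k}
    (h : ∀ a, pderiv a p = 0) : p = C (coeff 0 p) := by
  classical
  ext m
  rw [coeff_C]
  split_ifs with h0
  · rw [h0]
  · obtain ⟨a, ha⟩ := Finsupp.ne_iff.1 (Ne.symm h0)
    have h1 := congrArg (coeff (m - Finsupp.single a 1)) (h a)
    have hle : Finsupp.single a 1 ≤ m := by
      rw [Finsupp.single_le_iff]
      exact Nat.one_le_iff_ne_zero.2 ha
    rw [coeff_pderiv, tsub_add_cancel_of_le hle, coeff_zero] at h1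
    refine (mul_eq_zero.1 h1).resolve_right ?_
    exact Nat.cast_add_one_ne_zero _

theorem algebraicIndependent_of_jacobian {k A : Type} [Field k] [CharZero k] [CommRing A]
    [IsDomain A] [Algebra k A] {n : ℕ} (δ : Fin n → Derivation k A A) (y : Fin n → A)
    (h : LinearIndependent A fun i a => δ i (y a)) : AlgebraicIndependent k y := by
  have hdet : (Matrix.of fun i a => δ i (y a)).det ≠ 0 := by
    intro h0
    obtain ⟨v, hv, hv0⟩ := Matrix.exists_vecMul_eq_zero_iff.2 h0
    refine hv ?_
    rw [Fintype.linearIndependent_iff] at h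
    refine funext (h v ?_)
    rw [← hv0]
    funext a
    simp [Matrix.vecMul, dotProduct, Finset.sum_apply]
  rw [algebraicIndependent_iff]
  have key : ∀ n, ∀ p : MvPolynomial (Fin _) k, p.totalDegree ≤ n → aeval y p = 0 → p = 0 := by
    intro n
    induction n with
    | zero =>
      intro p hp h0
      rw [Nat.le_zero, totalDegree_eq_zero_iff_eq_C] at hp
      rw [hp, aeval_C, map_eq_zero_iff _ (algebraMap k A).injective] at h0
      rw [hp, h0, C_0]
    | succ n ih =>
      intro p hp h0
      have h1 : ∀ a, pderiv a p = 0 := by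
        have h2 : (fun a => aeval y (pderiv a p)) = 0 := by
          refine Matrix.eq_zero_of_mulVec_eq_zero hdet ?_
          funext i
          simp only [Matrix.mulVec, dotProduct, Matrix.of_apply, Pi.zero_apply]
          have h3 := derivation_aeval (δ i) y p
          rw [h0, map_zero] at h3
          rw [h3]
          exact Finset.sum_congr rfl fun a _ => mul_comm _ _
        intro a
        refine ih _ ?_ (congrFun h2 a)
        have := totalDegree_pderiv_le p a
        omega
      have h4 := eq_C_of_pderiv_eq_zero h1
      rw [h4, aeval_C, map_eq_zero_iff _ (algebraMap k A).injective] at h0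
      rw [h4, h0, C_0]
  exact fun p hp => key _ p le_rfl hp

theorem homogeneousComponent_mul_of_isHomogeneous {k σ : Type} [Field k] {h : MvPolynomial σ k}
    {d : ℕ} (hh : h.IsHomogeneous d) (r : MvPolynomial σ k) (e : ℕ) :
    homogeneousComponent e (r * h) = if d ≤ e then homogeneousComponent (e - d) r * h else 0 := by
  conv_lhs => rw [← sum_homogeneousComponent r, Finset.sum_mul, map_sum]
  have h1 : ∀ j, homogeneousComponent e (homogeneousComponent j r * h) =
      if j + d = e then homogeneousComponent j r * h else 0 := fun j => by
    rw [homogeneousComponent_of_mem ((homogeneousComponent_isHomogeneous j r).mul hh)]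
    simp only [eq_comm]
  simp only [h1]
  split_ifs with hde
  · have h2 : ∀ j, (j + d = e) ↔ j = e - d := fun j => by omega
    simp only [h2, Finset.sum_ite_eq', Finset.mem_range]
    split_ifs with h3
    · rfl
    · rw [homogeneousComponent_eq_zero _ _ (by omega), zero_mul]
  · exact Finset.sum_eq_zero fun j _ => if_neg (by omega)

end Jacobian

section Surjectivity
variable {k : Type} [Field k] {M N : ℕ}

/-- Constant linear combinations of the entries of a tuple of forms. -/
noncomputable def linComb (c : Fin (N + 1) → k) (F : Fin (N + 1) → MvPolynomial (Fin (M + 1)) k) :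
    MvPolynomial (Fin (M + 1)) k := ∑ j, C (c j) * F j

theorem linComb_isHomogeneous (c : Fin (N + 1) → k) {d : ℕ}
    {F : Fin (N + 1) → MvPolynomial (Fin (M + 1)) k} (hF : ∀ i, (F i).IsHomogeneous d) :
    (linComb c F).IsHomogeneous d :=
  IsHomogeneous.sum _ _ _ fun j _ => by
    have := (isHomogeneous_C (Fin (M + 1)) (c j)).mul (hF j)
    rwa [zero_add] at this

variable {X : Set (Pr k M)} {φ : Pr k M → Pr k N}

theorem IsRep.proportional_linComb {d e : ℕ} {F G : Fin (N + 1) → MvPolynomial (Fin (M + 1)) k}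
    (hF : IsRep X φ d F) (hG : IsRep X φ e G) (a b : Fin (N + 1) → k) :
    Ideal.Quotient.mk (coneIdeal X) (linComb a F) * Ideal.Quotient.mk _ (linComb b G) =
      Ideal.Quotient.mk (coneIdeal X) (linComb b F) * Ideal.Quotient.mk _ (linComb a G) := by
  simp only [linComb, map_sum, map_mul, Finset.sum_mul_sum]
  rw [Finset.sum_comm]
  refine Finset.sum_congr rfl fun j _ => Finset.sum_congr rfl fun i _ => ?_
  linear_combination (Ideal.Quotient.mk (coneIdeal X) (C (a i))) *
    (Ideal.Quotient.mk (coneIdeal X) (C (b j))) * hF.proportional hG i j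

/-- If three linear combinations of the entries of a representation are algebraically independent,
then every direction is attained by those linear combinations at some point of `X`. -/
theorem exists_point_of_algebraicIndependent [IsAlgClosed k] (hX : IsVariety X)
    (hφ : IsMorphismOn X φ) {d n : ℕ} {F : Fin (N + 1) → MvPolynomial (Fin (M + 1)) k}
    (hF : IsRep X φ d F) (Λ : Fin n → Fin (N + 1) → k)
    (halg : AlgebraicIndependent k fun a => Ideal.Quotient.mk (coneIdeal X) (linComb (Λ a) F))
    (u : Fin n → k) {a₀ : Fin n} (hu : u a₀ ≠ 0) :
    ∃ (v : Fin (M + 1) → k) (hv : v ≠ 0), Projectivization.mk k v hv ∈ X ∧ ∃ e G,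
      IsRep X φ e G ∧ (fun i => eval v (G i)) ≠ 0 ∧
      ∀ b, u a₀ * eval v (linComb (Λ b) G) = u b * eval v (linComb (Λ a₀) G) := by
  classical
  by_contra hcon
  push Not at hcon
  have hdom := hX.isDomain
  let lam : Fin n → (Fin (N + 1) → MvPolynomial (Fin (M + 1)) k) → MvPolynomial (Fin (M + 1)) k :=
    fun b G => C (u a₀) * linComb (Λ b) G - C (u b) * linComb (Λ a₀) G
  have hlamhom : ∀ b {e G}, IsRep X φ e G → (lam b G).IsHomogeneous e := by
    intro b e G hG
    refine IsHomogeneous.sub ?_ ?_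
    · have := (isHomogeneous_C (Fin (M + 1)) (u a₀)).mul (linComb_isHomogeneous (Λ b) hG.1)
      rwa [zero_add] at this
    · have := (isHomogeneous_C (Fin (M + 1)) (u b)).mul (linComb_isHomogeneous (Λ a₀) hG.1)
      rwa [zero_add] at this
  let T : Set (MvPolynomial (Fin (M + 1)) k) := {f | ∃ e G b, IsRep X φ e G ∧ f = lam b G}
  let J : Ideal (MvPolynomial (Fin (M + 1)) k) := coneIdeal X ⊔ Ideal.span T
  let mk := Ideal.Quotient.mk (coneIdeal X)
  let Q : ℕ → MvPolynomial (Fin (M + 1)) k → Prop := fun e f =>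
    ∃ c : Fin n → MvPolynomial (Fin (M + 1)) k, (∀ b, (c b).IsHomogeneous e) ∧
      mk (linComb (Λ a₀) F) * mk f = ∑ b, mk (lam b F) * mk (c b)
  have hQ0 : ∀ e, ∀ f ∈ coneIdeal X, Q e f := by
    intro e f hf
    refine ⟨0, fun b => isHomogeneous_zero _ _ _, ?_⟩
    have : mk f = 0 := Ideal.Quotient.eq_zero_iff_mem.2 hf
    rw [this]; simp
  have hQadd : ∀ e f g, Q e f → Q e g → Q e (f + g) := by
    rintro e f g ⟨c, hc, h⟩ ⟨c', hc', h'⟩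
    refine ⟨c + c', fun b => (hc b).add (hc' b), ?_⟩
    rw [map_add, mul_add, h, h', ← Finset.sum_add_distrib]
    exact Finset.sum_congr rfl fun b _ => by rw [Pi.add_apply, map_add, mul_add]
  have hQT : ∀ f ∈ Ideal.span T, ∀ r e, Q e (homogeneousComponent e (r * f)) := by
    intro f hf
    induction hf using Submodule.span_induction with
    | mem f hf =>
      obtain ⟨g, G, b, hG, rfl⟩ := hf
      intro r e
      rw [homogeneousComponent_mul_of_isHomogeneous (hlamhom b hG)]
      split_ifs with hge
      · refine ⟨Pi.single b (homogeneousComponent (e - g) r * linComb (Λ a₀) G),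
          fun b' => ?_, ?_⟩
        · by_cases hb : b' = b
          · rw [hb, Pi.single_eq_same]
            have := (homogeneousComponent_isHomogeneous (e - g) r).mul
              (linComb_isHomogeneous (Λ a₀) hG.1)
            rwa [Nat.sub_add_cancel hge] at this
          · rw [Pi.single_eq_of_ne hb]
            exact isHomogeneous_zero _ _ _
        · rw [Finset.sum_eq_single b
            (fun b' _ h => by rw [Pi.single_eq_of_ne h, map_zero, mul_zero])
            (fun h => absurd (Finset.mem_univ b) h), Pi.single_eq_same]
          simp only [lam, map_mul, map_sub]
          linear_combination (mk (C (u a₀)) * mk (homogeneousComponent (e - g) r)) *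
            hF.proportional_linComb hG (Λ a₀) (Λ b)
      · exact hQ0 _ _ (zero_mem _)
    | zero => intro r e; rw [mul_zero, map_zero]; exact hQ0 _ _ (zero_mem _)
    | add f g _ _ hf hg => intro r e; rw [mul_add, map_add]; exact hQadd _ _ _ (hf r e) (hg r e)
    | smul s f _ hf => intro r e; rw [smul_eq_mul, ← mul_assoc]; exact hf _ e
  have hQJ : ∀ f ∈ J, ∀ e, f.IsHomogeneous e → Q e f := by
    intro f hf e he
    obtain ⟨i, hi, s, hs, rfl⟩ := Submodule.mem_sup.1 hf
    have h1 : homogeneousComponent e (i + s) = i + s := by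
      rw [homogeneousComponent_of_mem he, if_pos rfl]
    rw [← h1, map_add]
    refine hQadd _ _ _ (hQ0 _ _ (compStable_coneIdeal X _ hi e)) ?_
    have := hQT s hs 1 e
    rwa [one_mul] at this
  have hrad : ∀ i, (MvPolynomial.X i : MvPolynomial (Fin (M + 1)) k) ∈ J.radical := by
    intro i
    rw [← MvPolynomial.vanishingIdeal_zeroLocus_eq_radical (K := k),
      MvPolynomial.mem_vanishingIdeal_iff]
    intro v hv
    rw [MvPolynomial.mem_zeroLocus_iff] at hv
    have hv : ∀ f ∈ J, eval v f = 0 := hv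
    rw [aeval_X]
    by_contra hvi
    have hv0 : v ≠ 0 := fun h => hvi (by rw [h]; rfl)
    have hvX := (hX.1.mem_iff hv0).2 fun f hf => hv f (Ideal.mem_sup_left hf)
    obtain ⟨e, G, hG, hGv⟩ := exists_isRep hφ hv0 hvX
    obtain ⟨b, hb⟩ := hcon v hv0 hvX _ G hG hGv
    have h2 := hv (lam b G) (Ideal.mem_sup_right (Ideal.subset_span ⟨_, G, b, hG, rfl⟩))
    simp only [lam, map_sub, map_mul, eval_C, sub_eq_zero] at h2
    exact hb h2
  obtain ⟨e, he⟩ := J.exists_radical_pow_le_of_fg J.radical.fg_of_isNoetherianRing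
  have hJe : ∀ f : MvPolynomial (Fin (M + 1)) k, f.IsHomogeneous e → f ∈ J := by
    intro f hf
    refine he (Ideal.pow_right_mono (I := idealOfVars (Fin (M + 1)) k) ?_ e ?_)
    · rw [idealOfVars, Ideal.span_le]
      rintro _ ⟨i, rfl⟩
      exact hrad i
    · rw [mem_pow_idealOfVars_iff']
      intro x hx
      by_contra hne
      have h1 : Finsupp.weight (fun _ => 1) x = e := hf hne
      rw [← Finsupp.degree_eq_weight_one] at h1
      omega
  obtain ⟨r, m, hm⟩ := Submodule.fg_iff_exists_fin_generating_family.1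
    ((homogeneousSubmodule_fg (σ := Fin (M + 1)) (R := k) e).map
      (Ideal.Quotient.mkₐ k (coneIdeal X)).toLinearMap)
  have hms : ∀ s, ∃ f : MvPolynomial (Fin (M + 1)) k, f.IsHomogeneous e ∧ mk f = m s := by
    intro s
    have h1 : m s ∈ Submodule.span k (range m) := Submodule.subset_span ⟨s, rfl⟩
    rw [hm, Submodule.mem_map] at h1
    obtain ⟨f, hf, hfm⟩ := h1
    exact ⟨f, (mem_homogeneousSubmodule _ _).1 hf, hfm⟩
  choose f hf hfm using hms
  choose c hc hceq using fun s => hQJ (f s) (hJe _ (hf s)) e (hf s)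
  have hP : ∀ s b, ∃ P : Fin r → k, ∑ t, P t • m t = mk (c s b) := by
    intro s b
    rw [← Submodule.mem_span_range_iff_exists_fun, hm]
    exact ⟨c s b, (mem_homogeneousSubmodule _ _).2 (hc s b), rfl⟩
  choose P hP using hP
  let y : Fin n → coordRing X := fun a => mk (linComb (Λ a) F)
  let Mat : Matrix (Fin r) (Fin r) (MvPolynomial (Fin n) k) := Matrix.of fun s t =>
    (if s = t then MvPolynomial.X a₀ else 0) -
      ∑ b, (C (u a₀) * MvPolynomial.X b - C (u b) * MvPolynomial.X a₀) * C (P s b t)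
  have hdet : Mat.det = 0 := by
    rw [algebraicIndependent_iff] at halg
    refine halg _ ?_
    change aeval y Mat.det = 0
    rw [AlgHom.map_det]
    by_contra hne
    have hm0 : m = 0 := by
      refine Matrix.eq_zero_of_mulVec_eq_zero hne ?_
      funext s
      simp only [Matrix.mulVec, dotProduct, AlgHom.mapMatrix_apply, Matrix.map_apply, Mat,
        Matrix.of_apply, map_sub, map_sum, map_mul, aeval_C, aeval_X, Pi.zero_apply]
      rw [Finset.sum_congr rfl fun t _ => sub_mul _ _ _, Finset.sum_sub_distrib, sub_eq_zero]
      have h1 : ∑ t, (aeval y) (if s = t then (MvPolynomial.X a₀ : MvPolynomial (Fin n) k) else 0) *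
          m t = y a₀ * m s := by
        rw [Finset.sum_eq_single s]
        · simp
        · intro t _ ht
          rw [if_neg (Ne.symm ht)]; simp
        · simp
      rw [h1, ← hfm s]
      change mk (linComb (Λ a₀) F) * mk (f s) = _
      rw [hceq s, Finset.sum_congr rfl fun t _ => Finset.sum_mul _ _ _, Finset.sum_comm]
      refine Finset.sum_congr rfl fun b _ => ?_
      rw [← hP s b, Finset.mul_sum]
      refine Finset.sum_congr rfl fun t _ => ?_
      have h4 : P s b t • m t = algebraMap k (coordRing X) (P s b t) * m t :=
        Algebra.smul_def (A := coordRing X) (P s b t) (m t)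
      rw [h4, mul_assoc]
      simp only [lam, map_sub, map_mul]
      rfl
    obtain ⟨i, hi⟩ := hX.exists_X_notMem
    have h1 : mk (MvPolynomial.X i ^ e) ∈ Submodule.span k (range m) := by
      rw [hm]
      refine ⟨MvPolynomial.X i ^ e, (mem_homogeneousSubmodule _ _).2 ?_, rfl⟩
      have := (isHomogeneous_X k i).pow e
      rwa [one_mul] at this
    rw [hm0] at h1
    have h2 : mk (MvPolynomial.X i ^ e) = 0 := by
      have h3 : Submodule.span k (range (0 : Fin r → coordRing X)) = ⊥ := by
        rw [Submodule.span_eq_bot]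
        rintro _ ⟨s, rfl⟩
        rfl
      rw [h3] at h1
      exact h1
    exact hi (hX.isPrime.mem_of_pow_mem _ (Ideal.Quotient.eq_zero_iff_mem.1 h2))
  have h2 := congrArg (eval u) hdet
  rw [RingHom.map_det, map_zero] at h2
  have h3 : (eval u).mapMatrix Mat = u a₀ • (1 : Matrix (Fin r) (Fin r) k) := by
    ext s t
    simp only [Mat, RingHom.mapMatrix_apply, Matrix.map_apply, Matrix.of_apply, map_sub, map_sum,
      map_mul, eval_C, eval_X, Matrix.smul_apply, Matrix.one_apply, smul_eq_mul]
    rw [Finset.sum_eq_zero fun b _ => by ring]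
    split_ifs <;> simp
  rw [h3, Matrix.det_smul, Matrix.det_one, mul_one] at h2
  exact pow_ne_zero _ hu h2

theorem is2Plane_of_finrank_span_le [IsAlgClosed k] [CharZero k] (hX : IsVariety X)
    (hφ : IsMorphismOn X φ) {d : ℕ} {F : Fin (N + 1) → MvPolynomial (Fin (M + 1)) k}
    (hF : IsRep X φ d F) (δ : Fin 3 → Derivation k (coordRing X) (coordRing X))
    (hδ : LinearIndependent (coordRing X)
      fun i j => δ i (Ideal.Quotient.mk (coneIdeal X) (F j)))
    (hrank : finrank k (Submodule.span k
      (range fun j => Ideal.Quotient.mk (coneIdeal X) (F j))) ≤ 3) : Is2Plane (φ '' X) := by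
  classical
  have hdom := hX.isDomain
  let f : Fin (N + 1) → coordRing X := fun j => Ideal.Quotient.mk (coneIdeal X) (F j)
  have hfd : FiniteDimensional k (Submodule.span k (range f)) :=
    FiniteDimensional.span_of_finite k (finite_range f)
  obtain ⟨r, hr⟩ : ∃ r, finrank k (Submodule.span k (range f)) = r := ⟨_, rfl⟩
  let bas := Module.finBasisOfFinrankEq k (Submodule.span k (range f)) hr
  let g : Fin r → coordRing X := fun a => (bas a : coordRing X)
  have hB : ∀ j, ∃ B : Fin r → k, f j = ∑ a, B a • g a := by
    intro j
    refine ⟨bas.repr ⟨f j, Submodule.subset_span ⟨j, rfl⟩⟩, ?_⟩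
    have := congrArg (Submodule.subtype _)
      (bas.sum_repr ⟨f j, Submodule.subset_span ⟨j, rfl⟩⟩)
    rw [map_sum] at this
    simpa using this.symm
  choose B hB using hB
  have hΛ : ∀ a, ∃ c : Fin (N + 1) → k, ∑ j, c j • f j = g a := by
    intro a
    rw [← Submodule.mem_span_range_iff_exists_fun]
    exact (bas a).2
  choose Λ hΛ using hΛ
  have hg : LinearIndependent k g := by
    have := bas.linearIndependent.map' (Submodule.subtype _) (Submodule.ker_subtype _)
    exact this
  have hΛB : ∀ a b, ∑ j, Λ a j * B j b = if a = b then 1 else 0 := by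
    intro a b
    rw [Fintype.linearIndependent_iff] at hg
    have h := hg (fun b => (∑ j, Λ a j * B j b) - if a = b then 1 else 0) (by
      simp only [sub_smul, Finset.sum_sub_distrib, ite_smul, one_smul, zero_smul,
        Finset.sum_ite_eq, Finset.mem_univ, if_true]
      rw [sub_eq_zero]
      conv_rhs => rw [← hΛ a]
      simp only [hB, Finset.smul_sum, Finset.sum_smul, smul_smul]
      rw [Finset.sum_comm]) b
    exact sub_eq_zero.1 h
  have hδg : LinearIndependent (coordRing X) fun i a => δ i (g a) := by
    rw [Fintype.linearIndependent_iff] at hδ ⊢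
    intro c hc
    refine hδ c ?_
    funext j
    have h1 : ∀ a, ∑ i, c i * δ i (g a) = 0 := fun a => by
      have := congrFun hc a
      simpa [Finset.sum_apply] using this
    simp only [Finset.sum_apply, Pi.smul_apply, smul_eq_mul, Pi.zero_apply]
    change ∑ i, c i * δ i (f j) = 0
    simp only [hB, map_sum, Derivation.map_smul, Finset.mul_sum]
    rw [Finset.sum_comm]
    refine Finset.sum_eq_zero fun a _ => ?_
    simp only [mul_smul_comm]
    rw [← Finset.smul_sum, h1, smul_zero]
  have hr3 : r = 3 := by
    refine le_antisymm (hr ▸ hrank) ?_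
    have := hδg.fintype_card_le_finrank
    rwa [Module.finrank_fin_fun, Fintype.card_fin] at this
  subst hr3
  have hglin : ∀ a, g a = Ideal.Quotient.mk (coneIdeal X) (linComb (Λ a) F) := by
    intro a
    rw [← hΛ a, linComb, map_sum]
    refine Finset.sum_congr rfl fun j _ => ?_
    rw [map_mul]
    exact Algebra.smul_def (A := coordRing X) _ _
  have halg : AlgebraicIndependent k
      fun a => Ideal.Quotient.mk (coneIdeal X) (linComb (Λ a) F) := by
    have := algebraicIndependent_of_jacobian δ g hδg
    rwa [show g = _ from funext hglin] at this
  have hne : ∃ i, f i ≠ 0 := by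
    by_contra hcon
    push Not at hcon
    rw [Fintype.linearIndependent_iff] at hδ
    refine one_ne_zero (hδ (fun _ => 1) ?_ 0)
    funext j
    have : Ideal.Quotient.mk (coneIdeal X) (F j) = 0 := hcon j
    simp [this]
  have hrep : ∀ {e G}, IsRep X φ e G → ∀ (v : Fin (M + 1) → k) (hv : v ≠ 0),
      Projectivization.mk k v hv ∈ X → ∀ j, eval v (G j) =
        ∑ a, B j a * eval v (linComb (Λ a) G) := by
    intro e G hG v hv hvX j
    obtain ⟨i, hi⟩ := hne
    have h1 : G j - ∑ a, C (B j a) * linComb (Λ a) G ∈ coneIdeal X := by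
      rw [← Ideal.Quotient.eq, map_sum]
      refine mul_left_cancel₀ hi ?_
      have h3 : f i * Ideal.Quotient.mk (coneIdeal X) (G j) =
          f j * Ideal.Quotient.mk (coneIdeal X) (G i) := hF.proportional hG i j
      have h4 : ∀ a, f i * Ideal.Quotient.mk (coneIdeal X) (linComb (Λ a) G) =
          g a * Ideal.Quotient.mk (coneIdeal X) (G i) := by
        intro a
        rw [hglin]
        simp only [linComb, map_sum, map_mul, Finset.mul_sum, Finset.sum_mul]
        refine Finset.sum_congr rfl fun l _ => ?_
        linear_combination (Ideal.Quotient.mk (coneIdeal X) (C (Λ a l))) * hF.proportional hG i l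
      rw [h3, hB j, Finset.mul_sum, Finset.sum_mul]
      refine Finset.sum_congr rfl fun a _ => ?_
      rw [map_mul, mul_left_comm, h4, ← mul_assoc]
      congr 1
      exact Algebra.smul_def (A := coordRing X) _ _
    have h2 := h1 v hv hvX
    rw [map_sub, map_sum, sub_eq_zero] at h2
    rw [h2]
    simp
  let W : Submodule k (Fin (N + 1) → k) := LinearMap.range (Matrix.mulVecLin (Matrix.of B))
  have hBapp : ∀ (u : Fin 3 → k) j, Matrix.mulVecLin (Matrix.of B) u j = ∑ a, B j a * u a :=
    fun u j => rfl
  have hleft : ∀ (u : Fin 3 → k) a, ∑ j, Λ a j * Matrix.mulVecLin (Matrix.of B) u j = u a := by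
    intro u a
    simp only [hBapp, Finset.mul_sum, ← mul_assoc]
    rw [Finset.sum_comm]
    simp only [← Finset.sum_mul, hΛB]
    simp
  refine ⟨W, ?_, ?_⟩
  · have hinj : Function.Injective (Matrix.mulVecLin (Matrix.of B)) := by
      intro u u' h
      funext a
      rw [← hleft u, h, hleft]
    rw [LinearMap.finrank_range_of_inj hinj, Module.finrank_fin_fun]
  · ext p
    rw [Set.mem_ofPred_eq]
    constructor
    · rintro ⟨x, hx, rfl⟩
      obtain ⟨v, hv, rfl⟩ := exists_mk_eq x
      obtain ⟨e, G, hG, hGv⟩ := exists_isRep hφ hv hx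
      rw [hG.2 v hv hx hGv, Projectivization.submodule_mk, Submodule.span_singleton_le_iff_mem]
      refine ⟨fun a => eval v (linComb (Λ a) G), ?_⟩
      funext j
      rw [hBapp, hrep hG v hv hx j]
    · intro hp
      obtain ⟨w, hw, rfl⟩ := exists_mk_eq p
      rw [Projectivization.submodule_mk, Submodule.span_singleton_le_iff_mem] at hp
      obtain ⟨u, rfl⟩ := hp
      have hu : u ≠ 0 := fun h => hw (by rw [h, map_zero])
      obtain ⟨a₀, ha₀⟩ := Function.ne_iff.1 hu
      obtain ⟨v, hv, hvX, e, G, hG, hGv, h⟩ :=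
        exists_point_of_algebraicIndependent hX hφ hF Λ halg u ha₀
      have h5 : u a₀ • (fun i => eval v (G i)) =
          eval v (linComb (Λ a₀) G) • Matrix.mulVecLin (Matrix.of B) u := by
        funext j
        simp only [Pi.smul_apply, smul_eq_mul, hBapp, hrep hG v hv hvX j, Finset.mul_sum]
        refine Finset.sum_congr rfl fun a _ => ?_
        linear_combination B j a * h a
      have hy : eval v (linComb (Λ a₀) G) ≠ 0 := by
        intro h0
        rw [h0, zero_smul] at h5
        exact smul_ne_zero ha₀ hGv h5
      refine ⟨_, hvX, ?_⟩
      rw [hG.2 v hv hvX hGv, Projectivization.mk_eq_mk_iff']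
      refine ⟨(u a₀)⁻¹ * eval v (linComb (Λ a₀) G), ?_⟩
      rw [mul_smul, ← h5, smul_smul, inv_mul_cancel₀ ha₀, one_smul]

end Surjectivity

section GenericRank
variable {k : Type} [Field k] {M N : ℕ} {X : Set (Pr k M)} {φ : Pr k M → Pr k N}

/-- A nonzero element of the coordinate ring is nonzero at some vector of the cone. -/
theorem exists_coneEval_ne_zero {a : coordRing X} (ha : a ≠ 0) :
    ∃ (v : Fin (M + 1) → k) (hv : v ≠ 0) (_ : Projectivization.mk k v hv ∈ X)
      (hvI : ∀ f ∈ coneIdeal X, eval v f = 0), coneEval v hvI a ≠ 0 := by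
  obtain ⟨f, rfl⟩ := Ideal.Quotient.mk_surjective (I := coneIdeal X) a
  obtain ⟨v, hv, hvX, hf⟩ := exists_eval_ne_zero fun h => ha (Ideal.Quotient.eq_zero_iff_mem.2 h)
  refine ⟨v, hv, hvX, fun g hg => mem_coneIdeal.1 hg v hv hvX, ?_⟩
  rwa [coneEval_mk]

theorem finrank_span_le_of_second_order [CharZero k] [IsAlgClosed k] [IsDomain (coordRing X)]
    {n : ℕ} {b : Fin n → coordRing X} (hb : IsTranscendenceBasis k b) {d : coordRing X}
    (hd : d ≠ 0) {δ : Fin n → Derivation k (coordRing X) (coordRing X)}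
    (hδ : ∀ i j, δ i (b j) = if i = j then d else 0) {m : ℕ}
    {F : Fin (N + 1) → MvPolynomial (Fin (M + 1)) k} (hF : ∀ t, (F t).IsHomogeneous (m + 1))
    (h2 : ∀ i j, ∃ e : coordRing X, e ≠ 0 ∧ ∃ c : Fin n → coordRing X, ∀ t,
      e * δ i (δ j (Ideal.Quotient.mk _ (F t))) = ∑ a, c a * δ a (Ideal.Quotient.mk _ (F t))) :
    finrank k (Submodule.span k (range fun j => Ideal.Quotient.mk (coneIdeal X) (F j))) ≤ n := by
  classical
  by_contra hlt
  push Not at hlt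
  obtain ⟨κ, a, hinj, hspan, hli⟩ := exists_linearIndependent' k
    (fun j => Ideal.Quotient.mk (coneIdeal X) (F j))
  have hfin : Finite κ := Finite.of_injective a hinj
  have hfint := Fintype.ofFinite κ
  rw [← hspan, finrank_span_eq_card hli] at hlt
  let e := Fintype.equivFin κ
  obtain ⟨c, hc, c₀, h⟩ := exists_const_relation (coord X) (adjoin_coord X) hb hd hδ
    (ι := Fin (Fintype.card κ)) (by rwa [Fintype.card_fin])
    (fun t => Ideal.Quotient.mk (coneIdeal X) (F (a (e.symm t))))
    (fun i j => by
      obtain ⟨e', he, c, hc⟩ := h2 i j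
      exact ⟨e', he, c, fun t => hc _⟩)
  have hsum : ∑ t, c t • Ideal.Quotient.mk (coneIdeal X) (F (a (e.symm t))) =
      Ideal.Quotient.mk (coneIdeal X) (∑ t, C (c t) * F (a (e.symm t))) := by
    rw [map_sum]
    refine Finset.sum_congr rfl fun t _ => ?_
    rw [map_mul]
    exact Algebra.smul_def (A := coordRing X) _ _
  have hhom : (∑ t, C (c t) * F (a (e.symm t))).IsHomogeneous (m + 1) := by
    refine IsHomogeneous.sum _ _ _ fun t _ => ?_
    have := (isHomogeneous_C (Fin (M + 1)) (c t)).mul (hF (a (e.symm t)))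
    rwa [zero_add] at this
  have h0 := eq_zero_of_const hhom (hsum.symm.trans h)
  rw [← hsum] at h0
  have hli' := hli.comp e.symm e.symm.injective
  rw [Fintype.linearIndependent_iff] at hli'
  exact hc (funext (hli' c h0))

/-- Polynomial relations on a fibre of `F` persist along integral curves of a derivation that
annihilates `F`. -/
theorem taylor_eq_zero_of_fibre [CharZero k] [IsAlgClosed k]
    (D : Derivation k (coordRing X) (coordRing X)) {F : Fin (N + 1) → MvPolynomial (Fin (M + 1)) k}
    (hD : ∀ j, D (Ideal.Quotient.mk _ (F j)) = 0) {v : Fin (M + 1) → k}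
    (hv : ∀ f ∈ coneIdeal X, eval v f = 0) {p : MvPolynomial (Fin (M + 1)) k}
    (hp : ∀ w, (∀ f ∈ coneIdeal X, eval w f = 0) → (∀ j, eval w (F j) = eval v (F j)) →
      eval w p = 0) :
    taylor D (coneEval v hv) (Ideal.Quotient.mk _ p) = 0 := by
  have hF : ∀ j, taylor D (coneEval v hv) (Ideal.Quotient.mk _ (F j)) =
      algebraMap k _ (eval v (F j)) := by
    intro j
    ext n
    rw [coeff_taylor]
    cases n with
    | zero => simp [coneEval_mk]
    | succ n =>
      rw [Function.iterate_succ_apply, hD, iterate_map_zero]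
      simp
  let J : Ideal (MvPolynomial (Fin (M + 1)) k) :=
    coneIdeal X ⊔ Ideal.span (range fun j => F j - C (eval v (F j)))
  have hrad : p ∈ J.radical := by
    rw [← MvPolynomial.vanishingIdeal_zeroLocus_eq_radical (K := k),
      MvPolynomial.mem_vanishingIdeal_iff]
    intro w hw
    rw [MvPolynomial.mem_zeroLocus_iff] at hw
    have hw : ∀ f ∈ J, eval w f = 0 := hw
    refine hp w (fun f hf => hw f (Ideal.mem_sup_left hf)) fun j => ?_
    have := hw _ (Ideal.mem_sup_right (Ideal.subset_span ⟨j, rfl⟩))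
    simpa [sub_eq_zero] using this
  obtain ⟨n, hn⟩ := hrad
  have hker : J ≤ RingHom.ker ((taylor D (coneEval v hv)).toRingHom.comp
      (Ideal.Quotient.mk (coneIdeal X))) := by
    refine sup_le (fun f hf => ?_) (Ideal.span_le.2 ?_)
    · rw [RingHom.mem_ker, RingHom.comp_apply, Ideal.Quotient.eq_zero_iff_mem.2 hf, map_zero]
    · rintro _ ⟨j, rfl⟩
      rw [SetLike.mem_coe, RingHom.mem_ker, RingHom.comp_apply, map_sub, map_sub, sub_eq_zero]
      refine (hF j).trans ?_
      exact ((taylor D (coneEval v hv)).commutes _).symm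
  have h0 := hker hn
  rw [RingHom.mem_ker, map_pow] at h0
  exact eq_zero_of_pow_eq_zero h0

/-- A generically injective map is generically unramified. -/
theorem IsRep.linearIndependent_derivation [CharZero k] [IsAlgClosed k] (hX : IsVariety X)
    (hbir : GenericallyInjectiveOn X φ) {n : ℕ} {b : Fin n → coordRing X} {d : coordRing X}
    (hd : d ≠ 0) {δ : Fin n → Derivation k (coordRing X) (coordRing X)}
    (hδ : ∀ i j, δ i (b j) = if i = j then d else 0) {e : ℕ}
    {F : Fin (N + 1) → MvPolynomial (Fin (M + 1)) k} (hF : IsRep X φ (e + 1) F) {j₀ : Fin (N + 1)}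
    (hF0 : Ideal.Quotient.mk (coneIdeal X) (F j₀) ≠ 0) :
    LinearIndependent (coordRing X) fun i j => δ i (Ideal.Quotient.mk (coneIdeal X) (F j)) := by
  classical
  have hdom := hX.isDomain
  obtain ⟨Z, hZ, hXZ, hinj⟩ := hbir
  rw [Fintype.linearIndependent_iff]
  intro c hc
  by_contra hne
  push Not at hne
  obtain ⟨i, hi⟩ := hne
  let D : Derivation k (coordRing X) (coordRing X) := ∑ i, c i • δ i
  have hDa : ∀ a, D a = ∑ i, c i * δ i a := by
    intro a
    simp [D, derivation_sum_apply]
  have hDF : ∀ j, D (Ideal.Quotient.mk _ (F j)) = 0 := by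
    intro j
    have := congrFun hc j
    simpa [hDa, Finset.sum_apply] using this
  have hDb : D (b i) ≠ 0 := by
    rw [hDa]
    simpa [hδ] using ⟨hi, hd⟩
  have hDX : ∃ m, D (coord X m) ≠ 0 := by
    by_contra hcon
    push Not at hcon
    obtain ⟨f, hf⟩ := Ideal.Quotient.mk_surjective (I := coneIdeal X) (b i)
    rw [← hf, derivation_mk] at hDb
    exact hDb (Finset.sum_eq_zero fun j _ => by rw [hcon, mul_zero])
  obtain ⟨m, hm⟩ := hDX
  obtain ⟨h, hhZ, hhX⟩ : ∃ h ∈ coneIdeal Z, h ∉ coneIdeal X := by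
    by_contra hcon
    push Not at hcon
    exact hXZ (hZ.subset_of_coneIdeal_le hcon)
  have hh0 : Ideal.Quotient.mk (coneIdeal X) h ≠ 0 :=
    fun h0 => hhX (Ideal.Quotient.eq_zero_iff_mem.1 h0)
  obtain ⟨v, hv, hvX, hvI, hne⟩ := exists_coneEval_ne_zero
    (mul_ne_zero (mul_ne_zero hh0 hm) hF0)
  rw [map_mul, map_mul, coneEval_mk, coneEval_mk] at hne
  have hvh : eval v h ≠ 0 := left_ne_zero_of_mul (left_ne_zero_of_mul hne)
  have hvD := right_ne_zero_of_mul (left_ne_zero_of_mul hne)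
  have hvF : eval v (F j₀) ≠ 0 := right_ne_zero_of_mul hne
  have hnotZ : ∀ w (hw : w ≠ 0), eval w h ≠ 0 → Projectivization.mk k w hw ∉ Z :=
    fun w hw hwh hwZ => hwh (mem_coneIdeal.1 hhZ w hw hwZ)
  have key := taylor_eq_zero_of_fibre D hDF hvI
    (p := h * (MvPolynomial.X m ^ (e + 1) - C (v m ^ (e + 1)))) (by
      intro w hwI hwF
      rw [map_mul]
      by_cases hwh : eval w h = 0
      · rw [hwh, zero_mul]
      have hw0 : w ≠ 0 := by
        rintro rfl
        refine hvF ?_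
        rw [← hwF, ← zero_smul k (0 : Fin (M + 1) → k), eval_smul_of_isHomogeneous (hF.1 j₀),
          zero_pow (Nat.succ_ne_zero e), zero_mul]
      have hwX := (hX.1.mem_iff hw0).2 hwI
      have hvF' : (fun j => eval v (F j)) ≠ 0 := fun h => hvF (congrFun h j₀)
      have hwF' : (fun j => eval w (F j)) ≠ 0 := fun h => hvF (by rw [← hwF]; exact congrFun h j₀)
      have heq : φ (Projectivization.mk k w hw0) = φ (Projectivization.mk k v hv) := by
        rw [hF.2 w hw0 hwX hwF', hF.2 v hv hvX hvF']
        congr 1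
        exact funext hwF
      have h1 := hinj ⟨hwX, hnotZ w hw0 hwh⟩ ⟨hvX, hnotZ v hv hvh⟩ heq
      rw [Projectivization.mk_eq_mk_iff'] at h1
      obtain ⟨a, rfl⟩ := h1
      have h2 := hwF j₀
      rw [eval_smul_of_isHomogeneous (hF.1 j₀)] at h2
      have h3 : a ^ (e + 1) = 1 := mul_right_cancel₀ hvF (h2.trans (one_mul _).symm)
      simp [mul_pow, h3])
  rw [map_mul, map_mul] at key
  have hTh : taylor D (coneEval v hvI) (Ideal.Quotient.mk _ h) ≠ 0 := by
    intro h0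
    have := congrArg (PowerSeries.coeff 0) h0
    rw [coeff_taylor] at this
    simp [coneEval_mk] at this
    exact hvh this
  have hT := (mul_eq_zero.1 key).resolve_left hTh
  have hc1 : Ideal.Quotient.mk (coneIdeal X) (C (v m ^ (e + 1))) =
    algebraMap k (coordRing X) (v m ^ (e + 1)) := rfl
  rw [map_sub, map_sub, map_pow, map_pow, hc1, AlgHom.commutes, sub_eq_zero] at hT
  have hcoeff : PowerSeries.coeff 1 (taylor D (coneEval v hvI) (coord X m)) ≠ 0 := by
    rw [coeff_taylor]
    simpa using hvD
  have hT' := congrArg (PowerSeries.derivative k) hT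
  rw [PowerSeries.derivative_pow, Derivation.map_algebraMap] at hT'
  have hT0 : taylor D (coneEval v hvI) (coord X m) ≠ 0 := fun h => hcoeff (by rw [h, map_zero])
  have hT1 : PowerSeries.derivative k (taylor D (coneEval v hvI) (coord X m)) ≠ 0 := by
    intro h
    have := congrArg (PowerSeries.coeff 0) h
    rw [PowerSeries.coeff_derivative] at this
    simp at this
    exact hcoeff this
  refine mul_ne_zero (mul_ne_zero ?_ (pow_ne_zero _ hT0)) hT1 hT'
  rw [← map_natCast (PowerSeries.C (R := k))]
  intro h
  have h1 := congrArg (PowerSeries.coeff 0) h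
  simp only [PowerSeries.coeff_zero_C, map_zero] at h1
  exact Nat.cast_ne_zero.2 e.succ_ne_zero h1

end GenericRank

section Fibres

/-- A matrix with independent rows has a nonzero maximal minor. -/
theorem exists_linearIndependent_columns {A : Type} [CommRing A] [IsDomain A] {n r : ℕ}
    (u : Fin n → Fin r → A) (h : LinearIndependent A u) :
    ∃ c : Fin n → Fin r, LinearIndependent A fun i a => u i (c a) := by
  classical
  obtain ⟨e, he, V, hV⟩ := exists_dual_vectors u h
  have hdet : (Matrix.of fun b i => ∑ j, u i j * V j b : Matrix (Fin n) (Fin n) A).det ≠ 0 := by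
    have : (Matrix.of fun b i => ∑ j, u i j * V j b : Matrix (Fin n) (Fin n) A) =
        Matrix.diagonal fun _ => e := by
      ext b i
      simp only [Matrix.of_apply, hV, Matrix.diagonal_apply, eq_comm]
    rw [this, Matrix.det_diagonal]
    exact Finset.prod_ne_zero_iff.2 fun _ _ => he
  have hrow : (Matrix.of fun b i => ∑ j, u i j * V j b : Matrix (Fin n) (Fin n) A) =
      fun b => ∑ j, V j b • fun i => u i j := by
    funext b i
    simp [Finset.sum_apply, mul_comm]
  have hexp : (Matrix.of fun b i => ∑ j, u i j * V j b : Matrix (Fin n) (Fin n) A).det =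
      ∑ c : Fin n → Fin r, (∏ b, V (c b) b) * (Matrix.of fun a i => u i (c a)).det := by
    rw [hrow]
    refine ((Matrix.detRowAlternating (R := A) (n := Fin n)).toMultilinearMap.map_sum
      (fun b j => V j b • fun i => u i j)).trans ?_
    refine Finset.sum_congr rfl fun c _ => ?_
    exact (Matrix.detRowAlternating (R := A) (n := Fin n)).toMultilinearMap.map_smul_univ
      (fun b => V (c b) b) fun b i => u i (c b)
  rw [hexp] at hdet
  obtain ⟨c, -, hc⟩ := Finset.exists_ne_zero_of_sum_ne_zero hdet
  refine ⟨c, ?_⟩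
  have hc' := right_ne_zero_of_mul hc
  rw [Fintype.linearIndependent_iff]
  intro s hs i
  refine congrFun (Matrix.eq_zero_of_mulVec_eq_zero hc' (v := s) ?_) i
  funext a
  have := congrFun hs a
  simpa [Matrix.mulVec, dotProduct, Finset.sum_apply, mul_comm] using this

variable {k : Type} [Field k] {M N : ℕ} {X : Set (Pr k M)} {φ : Pr k M → Pr k N}

theorem IsMorphismOn.mono {Z : Set (Pr k M)} (hφ : IsMorphismOn X φ) (hZ : Z ⊆ X) :
    IsMorphismOn Z φ := by
  intro p hp
  obtain ⟨F, h1, h2, h3⟩ := hφ p (hZ hp)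
  exact ⟨F, h1, h2, fun q hq => h3 q (hZ hq)⟩

theorem isHomogeneous_aeval {n m d : ℕ} {G : MvPolynomial (Fin n) k} (hG : G.IsHomogeneous d)
    {y : Fin n → MvPolynomial (Fin (M + 1)) k} (hy : ∀ a, (y a).IsHomogeneous m) :
    (aeval y G).IsHomogeneous (m * d) := by
  exact hG.aeval y hy

theorem eval_aeval {n : ℕ} (G : MvPolynomial (Fin n) k)
    (y : Fin n → MvPolynomial (Fin (M + 1)) k) (v : Fin (M + 1) → k) :
    eval v (aeval y G) = eval (fun a => eval v (y a)) G := by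
  induction G using MvPolynomial.induction_on with
  | C a => simp
  | add p q hp hq => simp only [map_add, hp, hq]
  | mul_X p i hp => simp only [map_mul, hp, aeval_X, eval_X]

/-- Any `n` coordinates of the image of a variety whose cone has dimension less than `n` satisfy
a homogeneous equation. -/
theorem exists_form_of_coneDim_lt [IsAlgClosed k] {Z : Set (Pr k M)} (hZ : IsVariety Z)
    (hφ : IsMorphismOn Z φ) {n : ℕ} (hn : coneDim Z < n) (r : Fin n → Fin (N + 1)) :
    ∃ G : MvPolynomial (Fin n) k, G ≠ 0 ∧ (∃ d, G.IsHomogeneous d) ∧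
      ∀ w (hw : w ≠ 0), Projectivization.mk k w hw ∈ φ '' Z → eval (fun a => w (r a)) G = 0 := by
  classical
  have hdom := hZ.isDomain
  obtain ⟨p, hp⟩ := hZ.2.1
  obtain ⟨v, hv, rfl⟩ := exists_mk_eq p
  obtain ⟨m, F, hF, hFv⟩ := exists_isRep hφ hv hp
  obtain ⟨j₀, hj₀⟩ := Function.ne_iff.1 hFv
  have hj : Ideal.Quotient.mk (coneIdeal Z) (F j₀) ≠ 0 := by
    rw [Ne, Ideal.Quotient.eq_zero_iff_mem]
    exact fun h => hj₀ (mem_coneIdeal.1 h v hv hp)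
  have hdep : ¬ AlgebraicIndependent k fun a => Ideal.Quotient.mk (coneIdeal Z) (F (r a)) := by
    intro h
    have := h.cardinalMk_le_trdeg
    rw [trdeg_coordRing, Cardinal.mk_fin] at this
    have := Nat.cast_le.1 this
    omega
  rw [algebraicIndependent_iff] at hdep
  push Not at hdep
  obtain ⟨g, hg, hg0⟩ := hdep
  have hmk : ∀ (y : Fin n → MvPolynomial (Fin (M + 1)) k) (q : MvPolynomial (Fin n) k),
      aeval (fun a => Ideal.Quotient.mk (coneIdeal Z) (y a)) q =
      Ideal.Quotient.mk (coneIdeal Z) (aeval y q) := by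
    intro y q
    exact (comp_aeval_apply (φ := Ideal.Quotient.mkₐ k (coneIdeal Z)) y q).symm
  obtain ⟨d, hd⟩ : ∃ d, homogeneousComponent d g ≠ 0 := by
    by_contra hcon
    push Not at hcon
    apply hg0
    rw [← sum_homogeneousComponent g]
    exact Finset.sum_eq_zero fun d _ => hcon d
  have hGhom := homogeneousComponent_isHomogeneous d g
  have hG0 : aeval (fun a => F (r a)) (homogeneousComponent d g) ∈ coneIdeal Z := by
    rw [hmk, Ideal.Quotient.eq_zero_iff_mem] at hg
    have h1 := compStable_coneIdeal Z _ hg ((m + 1) * d)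
    have h2 : homogeneousComponent ((m + 1) * d) (aeval (fun a => F (r a)) g) =
        aeval (fun a => F (r a)) (homogeneousComponent d g) := by
      conv_lhs => rw [← sum_homogeneousComponent g]
      rw [map_sum, map_sum]
      have h3 : ∀ i, homogeneousComponent ((m + 1) * d)
          (aeval (fun a => F (r a)) (homogeneousComponent i g)) =
          if i = d then aeval (fun a => F (r a)) (homogeneousComponent d g) else 0 := by
        intro i
        rw [homogeneousComponent_of_mem (isHomogeneous_aeval
          (homogeneousComponent_isHomogeneous i g) fun a => hF.1 (r a))]
        by_cases hid : i = d
        · rw [hid, if_pos rfl, if_pos rfl]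
        · rw [if_neg hid, if_neg]
          intro h
          exact hid (Nat.eq_of_mul_eq_mul_left (Nat.succ_pos m) h).symm
      simp only [h3, Finset.sum_ite_eq', Finset.mem_range]
      split_ifs with hlt
      · rfl
      · rw [homogeneousComponent_eq_zero d g (by omega), map_zero]
    rwa [h2] at h1
  refine ⟨homogeneousComponent d g, hd, ⟨d, hGhom⟩, ?_⟩
  rintro w hw ⟨z, hz, hzw⟩
  obtain ⟨u, hu, rfl⟩ := exists_mk_eq z
  obtain ⟨m', F', hF', hFu⟩ := exists_isRep hφ hu hz
  rw [hF'.2 u hu hz hFu, Projectivization.mk_eq_mk_iff'] at hzw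
  obtain ⟨s, hs⟩ := hzw
  have hs0 : s ≠ 0 := by rintro rfl; rw [zero_smul] at hs; exact hFu hs.symm
  have h4 : aeval (fun a => F' (r a)) (homogeneousComponent d g) ∈ coneIdeal Z := by
    rw [← Ideal.Quotient.eq_zero_iff_mem, ← hmk]
    have h5 := aeval_mul_of_isHomogeneous hGhom (Ideal.Quotient.mk (coneIdeal Z) (F j₀))
      fun a => Ideal.Quotient.mk (coneIdeal Z) (F' (r a))
    have h8 := aeval_mul_of_isHomogeneous hGhom (Ideal.Quotient.mk (coneIdeal Z) (F' j₀))
      fun a => Ideal.Quotient.mk (coneIdeal Z) (F (r a))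
    have h9 : (fun a => Ideal.Quotient.mk (coneIdeal Z) (F j₀) *
        Ideal.Quotient.mk (coneIdeal Z) (F' (r a))) = fun a =>
        Ideal.Quotient.mk (coneIdeal Z) (F' j₀) * Ideal.Quotient.mk (coneIdeal Z) (F (r a)) := by
      funext a
      rw [hF.proportional hF' j₀ (r a), mul_comm]
    rw [h9, h8, hmk, Ideal.Quotient.eq_zero_iff_mem.2 hG0, mul_zero] at h5
    exact (mul_eq_zero.1 h5.symm).resolve_left (pow_ne_zero _ hj)
  have h6 := mem_coneIdeal.1 h4 u hu hz
  rw [eval_aeval] at h6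
  have h7 : (fun a => eval u (F' (r a))) = s • fun a => w (r a) := by
    funext a
    exact (congrFun hs (r a)).symm
  rw [h7, eval_smul_of_isHomogeneous hGhom] at h6
  exact (mul_eq_zero.1 h6).resolve_left (pow_ne_zero _ hs0)

theorem exists_form_of_ssubset [IsAlgClosed k] (hX : IsVariety X) (hφ : IsMorphismOn X φ) {n : ℕ}
    (hn : coneDim X = n) (r : Fin n → Fin (N + 1)) {Z : Set (Pr k M)} (hZ : IsAlgSet Z)
    (hZX : Z ⊂ X) :
    ∃ G : MvPolynomial (Fin n) k, G ≠ 0 ∧ (∃ d, G.IsHomogeneous d) ∧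
      ∀ w (hw : w ≠ 0), Projectivization.mk k w hw ∈ φ '' Z → eval (fun a => w (r a)) G = 0 := by
  have key : ∀ I : Ideal (MvPolynomial (Fin (M + 1)) k), ∀ Z : Set (Pr k M), coneIdeal Z = I →
      IsAlgSet Z → Z ⊂ X → ∃ G : MvPolynomial (Fin n) k, G ≠ 0 ∧ (∃ d, G.IsHomogeneous d) ∧
      ∀ w (hw : w ≠ 0), Projectivization.mk k w hw ∈ φ '' Z →
        eval (fun a => w (r a)) G = 0 := by
    intro I
    induction I using WellFoundedGT.induction with
    | ind I ih =>
      rintro Z rfl hZ hZX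
      by_cases hvar : IsVariety Z
      · exact exists_form_of_coneDim_lt hvar (hφ.mono hZX.subset)
          (by rw [← hn]; exact coneDim_lt hvar hX hZX) r
      rcases Z.eq_empty_or_nonempty with rfl | hne
      · refine ⟨1, one_ne_zero, ⟨0, isHomogeneous_one _ _⟩, ?_⟩
        rintro w hw ⟨z, hz, -⟩
        exact absurd hz (Set.notMem_empty z)
      have hred : ¬ ∀ Z₁ Z₂ : Set (Pr k M), IsAlgSet Z₁ → IsAlgSet Z₂ → Z ⊆ Z₁ ∪ Z₂ →
          Z ⊆ Z₁ ∨ Z ⊆ Z₂ := fun h => hvar ⟨hZ, hne, h⟩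
      push Not at hred
      obtain ⟨Z₁, Z₂, h1, h2, hsub, hn1, hn2⟩ := hred
      have hlt : ∀ Z', IsAlgSet Z' → ¬ Z ⊆ Z' → coneIdeal Z < coneIdeal (Z ∩ Z') := by
        intro Z' h hn
        refine lt_of_le_of_ne (coneIdeal_anti inter_subset_left) fun heq => hn ?_
        exact ((hZ.inter h).subset_of_coneIdeal_le heq.ge).trans inter_subset_right
      obtain ⟨G₁, hG1, ⟨d₁, hd1⟩, hv1⟩ := ih _ (hlt Z₁ h1 hn1) _ rfl (hZ.inter h1)
        (inter_subset_left.trans_ssubset hZX)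
      obtain ⟨G₂, hG2, ⟨d₂, hd2⟩, hv2⟩ := ih _ (hlt Z₂ h2 hn2) _ rfl (hZ.inter h2)
        (inter_subset_left.trans_ssubset hZX)
      refine ⟨G₁ * G₂, mul_ne_zero hG1 hG2, ⟨_, hd1.mul hd2⟩, ?_⟩
      rintro w hw ⟨z, hz, hzw⟩
      rw [map_mul]
      rcases hsub hz with hz' | hz'
      · rw [hv1 w hw ⟨z, ⟨hz, hz'⟩, hzw⟩, zero_mul]
      · rw [hv2 w hw ⟨z, ⟨hz, hz'⟩, hzw⟩, mul_zero]
  exact key _ Z rfl hZ hZX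

/-- The fibre of a generically injective map through a general point is a single point. -/
theorem exists_isolated_fibre [CharZero k] [IsAlgClosed k] (hX : IsVariety X)
    (hφ : IsMorphismOn X φ) (hbir : GenericallyInjectiveOn X φ) {n : ℕ} (hn : coneDim X = n)
    {m : ℕ} {F : Fin (N + 1) → MvPolynomial (Fin (M + 1)) k} (hF : IsRep X φ m F) {j₀ : Fin (N + 1)}
    (hF0 : Ideal.Quotient.mk (coneIdeal X) (F j₀) ≠ 0)
    (δ : Fin n → Derivation k (coordRing X) (coordRing X))
    (hδ : LinearIndependent (coordRing X) fun i j => δ i (Ideal.Quotient.mk (coneIdeal X) (F j))) :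
    ∃ h : MvPolynomial (Fin (M + 1)) k, h ∉ coneIdeal X ∧ ∀ v (hv : v ≠ 0),
      Projectivization.mk k v hv ∈ X → eval v h ≠ 0 → ∀ q ∈ X,
      φ q = φ (Projectivization.mk k v hv) → q = Projectivization.mk k v hv := by
  have hprime := hX.isPrime
  have hdom := hX.isDomain
  obtain ⟨Z, hZ, hXZ, hinj⟩ := hbir
  obtain ⟨c, hc⟩ := exists_linearIndependent_columns _ hδ
  have halg := algebraicIndependent_of_jacobian δ
    (fun a => Ideal.Quotient.mk (coneIdeal X) (F (c a))) hc
  obtain ⟨G, hG0, ⟨d, hGd⟩, hG⟩ := exists_form_of_ssubset hX hφ hn c (hX.1.inter hZ)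
    ⟨inter_subset_left, fun h => hXZ (h.trans inter_subset_right)⟩
  obtain ⟨h, hhZ, hhX⟩ : ∃ h ∈ coneIdeal Z, h ∉ coneIdeal X := by
    by_contra hcon
    push Not at hcon
    exact hXZ (hZ.subset_of_coneIdeal_le hcon)
  have hGX : aeval (fun a => F (c a)) G ∉ coneIdeal X := by
    rw [← Ideal.Quotient.eq_zero_iff_mem]
    intro h0
    refine hG0 ((algebraicIndependent_iff.1 halg) G ?_)
    exact (comp_aeval_apply (φ := Ideal.Quotient.mkₐ k (coneIdeal X)) (fun a => F (c a)) G).symm.trans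
      h0
  rw [Ne, Ideal.Quotient.eq_zero_iff_mem] at hF0
  refine ⟨h * aeval (fun a => F (c a)) G * F j₀, ?_, ?_⟩
  · intro hmem
    rcases hprime.mem_or_mem hmem with h1 | h1
    · exact (hprime.mem_or_mem h1).elim hhX hGX
    · exact hF0 h1
  intro v hv hvX hne q hq heq
  rw [map_mul, map_mul] at hne
  have hvh := left_ne_zero_of_mul (left_ne_zero_of_mul hne)
  have hvG := right_ne_zero_of_mul (left_ne_zero_of_mul hne)
  have hvF : (fun j => eval v (F j)) ≠ 0 := fun h0 => right_ne_zero_of_mul hne (congrFun h0 j₀)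
  refine hinj ⟨hq, fun hqZ => hvG ?_⟩ ⟨hvX, fun hvZ => hvh (mem_coneIdeal.1 hhZ v hv hvZ)⟩ heq
  rw [eval_aeval]
  refine hG (fun j => eval v (F j)) hvF ?_
  rw [← hF.2 v hv hvX hvF, ← heq]
  exact ⟨q, ⟨hq, hqZ⟩, rfl⟩

end Fibres

section BlowupIdeal
variable {k : Type} [Field k] {M M' : ℕ}

/-- The linear projection along `v` onto the hyperplane where the coordinate `i₀` vanishes. -/
noncomputable def projAlong (v : Fin (M + 1) → k) (i₀ : Fin (M + 1)) :
    (Fin (M + 1) → k) →ₗ[k] (Fin (M + 1) → k) :=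
  LinearMap.id - (LinearMap.proj i₀ : (Fin (M + 1) → k) →ₗ[k] k).smulRight ((v i₀)⁻¹ • v)

theorem projAlong_apply (v : Fin (M + 1) → k) (i₀ : Fin (M + 1)) (w : Fin (M + 1) → k)
    (j : Fin (M + 1)) : projAlong v i₀ w j = w j - v j * (v i₀)⁻¹ * w i₀ := by
  simp [projAlong]
  ring

theorem projAlong_self {v : Fin (M + 1) → k} {i₀ : Fin (M + 1)} (h : v i₀ ≠ 0) :
    projAlong v i₀ v = 0 := by
  funext j
  rw [projAlong_apply, mul_assoc, inv_mul_cancel₀ h]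
  simp

theorem projAlong_apply_self {v : Fin (M + 1) → k} {i₀ : Fin (M + 1)} (h : v i₀ ≠ 0)
    (w : Fin (M + 1) → k) : projAlong v i₀ w i₀ = 0 := by
  rw [projAlong_apply, mul_inv_cancel₀ h]
  simp

theorem projAlong_of_apply_eq_zero {v : Fin (M + 1) → k} {i₀ : Fin (M + 1)}
    {w : Fin (M + 1) → k} (hw : w i₀ = 0) : projAlong v i₀ w = w := by
  funext j
  rw [projAlong_apply, hw, mul_zero, sub_zero]

theorem eq_smul_add_projAlong (v : Fin (M + 1) → k) (i₀ : Fin (M + 1)) (w : Fin (M + 1) → k) :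
    w = (w i₀ * (v i₀)⁻¹) • v + projAlong v i₀ w := by
  funext j
  rw [Pi.add_apply, Pi.smul_apply, projAlong_apply, smul_eq_mul]
  ring

/-- The linear forms giving the entries of `projAlong`. -/
noncomputable def projForm (v : Fin (M + 1) → k) (i₀ j : Fin (M + 1)) :
    MvPolynomial (Fin (M + 1)) k :=
  MvPolynomial.X j - C (v j * (v i₀)⁻¹) * MvPolynomial.X i₀

theorem eval_projForm (v : Fin (M + 1) → k) (i₀ j : Fin (M + 1)) (w : Fin (M + 1) → k) :
    eval w (projForm v i₀ j) = projAlong v i₀ w j := by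
  simp [projForm, projAlong_apply]

theorem projForm_isHomogeneous (v : Fin (M + 1) → k) (i₀ j : Fin (M + 1)) :
    (projForm v i₀ j).IsHomogeneous 1 := by
  refine (isHomogeneous_X k j).sub ?_
  have := (isHomogeneous_C (Fin (M + 1)) (v j * (v i₀)⁻¹)).mul (isHomogeneous_X k i₀)
  rwa [zero_add] at this

theorem projForm_self {v : Fin (M + 1) → k} {i₀ : Fin (M + 1)} (h : v i₀ ≠ 0) :
    projForm v i₀ i₀ = 0 := by
  rw [projForm, mul_inv_cancel₀ h]
  simp

/-- A form vanishing at `v` is a combination of the forms `projForm`. -/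
theorem exists_eq_sum_projForm {v : Fin (M + 1) → k} {i₀ : Fin (M + 1)} {d : ℕ}
    {f : MvPolynomial (Fin (M + 1)) k} (hf : f.IsHomogeneous (d + 1)) (hfv : eval v f = 0) :
    ∃ g : Fin (M + 1) → MvPolynomial (Fin (M + 1)) k, (∀ j, (g j).IsHomogeneous d) ∧
      f = ∑ j, g j * projForm v i₀ j := by
  have hmem : f ∈ Ideal.span (range (projForm v i₀)) := by
    set J := Ideal.span (range (projForm v i₀)) with hJ
    rw [← Ideal.Quotient.eq_zero_iff_mem]
    have hX : ∀ j, Ideal.Quotient.mk J (MvPolynomial.X j) =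
        Ideal.Quotient.mk J (MvPolynomial.X i₀) *
          algebraMap k (MvPolynomial (Fin (M + 1)) k ⧸ J) (v j * (v i₀)⁻¹) := by
      intro j
      have : algebraMap k (MvPolynomial (Fin (M + 1)) k ⧸ J) (v j * (v i₀)⁻¹) =
        Ideal.Quotient.mk J (C (v j * (v i₀)⁻¹)) := rfl
      rw [this, ← map_mul, Ideal.Quotient.eq, mul_comm]
      exact Ideal.subset_span ⟨j, rfl⟩
    have h1 : Ideal.Quotient.mk J f = aeval (fun j => Ideal.Quotient.mk J (MvPolynomial.X j)) f := by
      have := comp_aeval_apply (φ := Ideal.Quotient.mkₐ k J) (MvPolynomial.X : Fin (M + 1) → _) f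
      rw [aeval_X_left_apply] at this
      exact this
    rw [h1, funext hX, aeval_mul_of_isHomogeneous hf]
    have h2 := comp_aeval_apply (φ := Algebra.ofId k (MvPolynomial (Fin (M + 1)) k ⧸ J))
      (fun j => v j * (v i₀)⁻¹) f
    have h3 : (fun j => v j * (v i₀)⁻¹) = (v i₀)⁻¹ • v := by
      funext j; simp [mul_comm]
    have h4 : aeval (fun j => v j * (v i₀)⁻¹) f = 0 := by
      rw [h3]
      exact (eval_smul_of_isHomogeneous hf _ _).trans (by rw [hfv, mul_zero])
    rw [h4, map_zero] at h2
    exact (congrArg _ h2.symm).trans (mul_zero _)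
  rw [Ideal.mem_span_range_iff_exists_fun] at hmem
  obtain ⟨g, hg⟩ := hmem
  refine ⟨fun j => homogeneousComponent d (g j), fun j => homogeneousComponent_isHomogeneous _ _, ?_⟩
  have h1 := congrArg (homogeneousComponent (d + 1)) hg
  rw [homogeneousComponent_of_mem hf, if_pos rfl, map_sum] at h1
  rw [← h1]
  refine Finset.sum_congr rfl fun j _ => ?_
  rw [homogeneousComponent_mul_of_isHomogeneous (projForm_isHomogeneous v i₀ j),
    if_pos (by omega), Nat.add_sub_cancel]

variable (e : Fin (M' + 1) ≃ Fin (M + 1) × Fin (M + 1))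

/-- The tensor product of two vectors. -/
def tens {R : Type} [Mul R] (p ℓ : Fin (M + 1) → R) : Fin (M' + 1) → R :=
  fun t => p (e t).1 * ℓ (e t).2

theorem tens_apply {R : Type} [Mul R] (p ℓ : Fin (M + 1) → R) (i j : Fin (M + 1)) :
    tens e p ℓ (e.symm (i, j)) = p i * ℓ j := by
  simp [tens]

theorem tens_ext {R : Type} {z w : Fin (M' + 1) → R}
    (h : ∀ i j, z (e.symm (i, j)) = w (e.symm (i, j))) : z = w := by
  funext t
  have := h (e t).1 (e t).2
  simpa using this

/-- The substitution `Z i j = X i * projForm j`. -/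
noncomputable def segreHom (v : Fin (M + 1) → k) (i₀ : Fin (M + 1)) :
    MvPolynomial (Fin (M' + 1)) k →ₐ[k] MvPolynomial (Fin (M + 1)) k :=
  aeval (tens e MvPolynomial.X (projForm v i₀))

theorem segreHom_X (v : Fin (M + 1) → k) (i₀ i j : Fin (M + 1)) :
    segreHom e v i₀ (MvPolynomial.X (e.symm (i, j))) = MvPolynomial.X i * projForm v i₀ j := by
  rw [segreHom, aeval_X, tens_apply]

theorem segreHom_isHomogeneous (v : Fin (M + 1) → k) (i₀ : Fin (M + 1)) {d : ℕ}
    {f : MvPolynomial (Fin (M' + 1)) k} (hf : f.IsHomogeneous d) :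
    (segreHom e v i₀ f).IsHomogeneous (2 * d) := by
  exact isHomogeneous_aeval hf fun t => (isHomogeneous_X k _).mul (projForm_isHomogeneous v i₀ _)

theorem compStable_comap_segreHom {I : Ideal (MvPolynomial (Fin (M + 1)) k)} (hI : CompStable I)
    (v : Fin (M + 1) → k) (i₀ : Fin (M + 1)) : CompStable (I.comap (segreHom e v i₀)) := by
  intro f hf d
  rw [Ideal.mem_comap] at hf ⊢
  have h1 := hI _ hf (2 * d)
  conv at h1 => rw [← sum_homogeneousComponent f]
  rw [map_sum, map_sum] at h1
  have h3 : ∀ i, homogeneousComponent (2 * d) (segreHom e v i₀ (homogeneousComponent i f)) =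
      if i = d then segreHom e v i₀ (homogeneousComponent d f) else 0 := by
    intro i
    rw [homogeneousComponent_of_mem
      (segreHom_isHomogeneous e v i₀ (homogeneousComponent_isHomogeneous i f))]
    by_cases hid : i = d
    · rw [hid, if_pos rfl, if_pos rfl]
    · rw [if_neg hid, if_neg (by omega)]
  simp only [h3, Finset.sum_ite_eq', Finset.mem_range] at h1
  split_ifs at h1 with hlt
  · exact h1
  · rw [homogeneousComponent_eq_zero d f (by omega), map_zero]
    exact zero_mem _

/-- Points of the blow-up with values in an arbitrary algebra. -/
theorem aeval_tens_eq_zero {R : Type} [CommRing R] [IsDomain R] [Algebra k R]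
    {I : Ideal (MvPolynomial (Fin (M + 1)) k)} (hI : CompStable I)
    {v : Fin (M + 1) → k} {i₀ : Fin (M + 1)} {P ρ : Fin (M + 1) → R} {x : R} (hx : x ≠ 0)
    (hP : ∀ f ∈ I, aeval P f = 0) (hρ : ∀ j, x * ρ j = aeval P (projForm v i₀ j))
    {f : MvPolynomial (Fin (M' + 1)) k} (hf : f ∈ I.comap (segreHom e v i₀)) :
    aeval (tens e P ρ) f = 0 := by
  rw [← sum_homogeneousComponent f, map_sum]
  refine Finset.sum_eq_zero fun d _ => ?_
  have h1 := hP _ (compStable_comap_segreHom e hI v i₀ f hf d)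
  rw [segreHom, comp_aeval_apply] at h1
  have h2 := aeval_mul_of_isHomogeneous (homogeneousComponent_isHomogeneous d f) x (tens e P ρ)
  have h3 : (fun t => x * tens e P ρ t) =
      fun t => aeval P (tens e MvPolynomial.X (projForm v i₀) t) := by
    funext t
    simp only [tens, map_mul, aeval_X, ← hρ]
    ring
  rw [h3, h1] at h2
  exact (mul_eq_zero.1 h2.symm).resolve_left (pow_ne_zero _ hx)

/-- A polynomial evaluated on a column of the matrix of variables. -/
noncomputable def colPoly (m : Fin (M + 1)) (h : MvPolynomial (Fin (M + 1)) k) :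
    MvPolynomial (Fin (M' + 1)) k :=
  aeval (fun i => MvPolynomial.X (e.symm (i, m))) h

theorem aeval_colPoly {R : Type} [CommRing R] [Algebra k R] (m : Fin (M + 1))
    (h : MvPolynomial (Fin (M + 1)) k) (Z : Fin (M' + 1) → R) :
    aeval Z (colPoly e m h) = aeval (fun i => Z (e.symm (i, m))) h := by
  rw [colPoly, comp_aeval_apply]
  simp only [aeval_X]

theorem aeval_tens_colPoly {R : Type} [CommRing R] [Algebra k R] (m : Fin (M + 1)) {d : ℕ}
    {h : MvPolynomial (Fin (M + 1)) k} (hh : h.IsHomogeneous d) (P ρ : Fin (M + 1) → R) :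
    aeval (tens e P ρ) (colPoly e m h) = ρ m ^ d * aeval P h := by
  rw [aeval_colPoly, ← aeval_mul_of_isHomogeneous hh]
  simp only [tens_apply, mul_comm]

theorem colPoly_isHomogeneous (m : Fin (M + 1)) {d : ℕ}
    {h : MvPolynomial (Fin (M + 1)) k} (hh : h.IsHomogeneous d) :
    (colPoly e m h).IsHomogeneous d := by
  have : (colPoly e m h).IsHomogeneous (1 * d) :=
    hh.aeval (fun i => MvPolynomial.X (e.symm (i, m))) fun i => isHomogeneous_X k _
  rwa [one_mul] at this

/-- The lift to the blow-up of the quotient of a combination of the forms `projForm` by the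
equation of the exceptional curve. -/
noncomputable def strictTransform (i₀ m : Fin (M + 1))
    (h : Fin (M + 1) → MvPolynomial (Fin (M + 1)) k) : MvPolynomial (Fin (M' + 1)) k :=
  ∑ j, colPoly e m (h j) * MvPolynomial.X (e.symm (i₀, j))

theorem aeval_tens_strictTransform {R : Type} [CommRing R] [Algebra k R] (i₀ m : Fin (M + 1))
    {d : ℕ} {h : Fin (M + 1) → MvPolynomial (Fin (M + 1)) k} (hh : ∀ j, (h j).IsHomogeneous d)
    (P ρ : Fin (M + 1) → R) :
    aeval (tens e P ρ) (strictTransform e i₀ m h) =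
      ρ m ^ d * P i₀ * ∑ j, aeval P (h j) * ρ j := by
  rw [strictTransform, map_sum, Finset.mul_sum]
  refine Finset.sum_congr rfl fun j _ => ?_
  rw [map_mul, aeval_tens_colPoly e m (hh j), aeval_X, tens_apply]
  ring

theorem strictTransform_isHomogeneous (i₀ m : Fin (M + 1)) {d : ℕ}
    {h : Fin (M + 1) → MvPolynomial (Fin (M + 1)) k} (hh : ∀ j, (h j).IsHomogeneous d) :
    (strictTransform e i₀ m h).IsHomogeneous (d + 1) := by
  refine IsHomogeneous.sum _ _ _ fun j _ => ?_
  exact (colPoly_isHomogeneous e m (hh j)).mul (isHomogeneous_X k _)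

variable {I : Ideal (MvPolynomial (Fin (M + 1)) k)} {v : Fin (M + 1) → k} {i₀ : Fin (M + 1)}

theorem colPoly_mem {f : MvPolynomial (Fin (M + 1)) k} {d : ℕ} (hfh : f.IsHomogeneous d)
    (hf : f ∈ I) (m : Fin (M + 1)) : colPoly e m f ∈ I.comap (segreHom e v i₀) := by
  rw [Ideal.mem_comap, segreHom, aeval_tens_colPoly e m hfh, aeval_X_left_apply]
  exact I.mul_mem_left _ hf

theorem strictTransform_mem {d : ℕ} {h : Fin (M + 1) → MvPolynomial (Fin (M + 1)) k}
    (hh : ∀ j, (h j).IsHomogeneous d) (hf : ∑ j, h j * projForm v i₀ j ∈ I) (m : Fin (M + 1)) :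
    strictTransform e i₀ m h ∈ I.comap (segreHom e v i₀) := by
  rw [Ideal.mem_comap, segreHom, aeval_tens_strictTransform e i₀ m hh]
  simp only [aeval_X_left_apply]
  exact I.mul_mem_left _ hf

theorem minor_mem (i j i' j' : Fin (M + 1)) :
    (MvPolynomial.X (e.symm (i, j)) * MvPolynomial.X (e.symm (i', j')) -
      MvPolynomial.X (e.symm (i, j')) * MvPolynomial.X (e.symm (i', j)) :
      MvPolynomial (Fin (M' + 1)) k) ∈ I.comap (segreHom e v i₀) := by
  rw [Ideal.mem_comap]
  simp only [map_sub, map_mul, segreHom_X]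
  convert I.zero_mem using 1
  ring

theorem X_mem (hv : v i₀ ≠ 0) (i : Fin (M + 1)) :
    (MvPolynomial.X (e.symm (i, i₀)) : MvPolynomial (Fin (M' + 1)) k) ∈
      I.comap (segreHom e v i₀) := by
  rw [Ideal.mem_comap, segreHom_X, projForm_self hv, mul_zero]
  exact I.zero_mem

theorem symm_mem (i j : Fin (M + 1)) :
    ((MvPolynomial.X (e.symm (i, j)) - C (v i * (v i₀)⁻¹) * MvPolynomial.X (e.symm (i₀, j))) -
      (MvPolynomial.X (e.symm (j, i)) - C (v j * (v i₀)⁻¹) * MvPolynomial.X (e.symm (i₀, i))) :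
      MvPolynomial (Fin (M' + 1)) k) ∈ I.comap (segreHom e v i₀) := by
  rw [Ideal.mem_comap]
  have hC : ∀ a : k, segreHom e v i₀ (C a) = C a := fun a => (segreHom e v i₀).commutes a
  simp only [map_sub, map_mul, segreHom_X, hC]
  convert I.zero_mem using 1
  simp only [projForm, map_mul]
  ring

end BlowupIdeal

section BlowupPoints
variable {k : Type} [Field k] {M M' : ℕ}

theorem constDerivation_projForm (v w : Fin (M + 1) → k) (i₀ j : Fin (M + 1)) :
    constDerivation w (projForm v i₀ j) = C (projAlong v i₀ w j) := by
  have hC : constDerivation w (C (v j * (v i₀)⁻¹) : MvPolynomial (Fin (M + 1)) k) = 0 :=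
    (constDerivation w).map_algebraMap _
  have hX : ∀ i, constDerivation w (MvPolynomial.X i) = C (w i) := fun i => mkDerivation_X _ _ _
  rw [projForm, map_sub, Derivation.leibniz, hC, hX, hX, projAlong_apply, smul_zero, add_zero,
    smul_eq_mul, map_sub, map_mul _ _ (w i₀)]

/-- The differential at `v` of a combination of the forms `projForm`. -/
theorem diffAt_sum_projForm {v : Fin (M + 1) → k} {i₀ : Fin (M + 1)} (hv : v i₀ ≠ 0)
    (g : Fin (M + 1) → MvPolynomial (Fin (M + 1)) k) (w : Fin (M + 1) → k) :
    diffAt (∑ j, g j * projForm v i₀ j) v w = ∑ j, eval v (g j) * projAlong v i₀ w j := by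
  rw [diffAt_sum]
  refine Finset.sum_congr rfl fun j _ => ?_
  rw [diffAt_eq_constDerivation, Derivation.leibniz, constDerivation_projForm, map_add, smul_eq_mul,
    smul_eq_mul, map_mul, map_mul, eval_projForm, projAlong_self hv, eval_C]
  simp

/-- The tangent directions at `v` in the hyperplane where the coordinate `i₀` vanishes. -/
def tanHyp (I : Ideal (MvPolynomial (Fin (M + 1)) k)) (v : Fin (M + 1) → k) (i₀ : Fin (M + 1)) :
    Submodule k (Fin (M + 1) → k) where
  carrier := {w | (∀ f ∈ I, diffAt f v w = 0) ∧ w i₀ = 0}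
  add_mem' := fun {a b} ha hb => ⟨fun f hf => by rw [map_add, ha.1 f hf, hb.1 f hf, add_zero], by
    rw [Pi.add_apply, ha.2, hb.2, add_zero]⟩
  zero_mem' := ⟨fun f _ => map_zero _, rfl⟩
  smul_mem' := fun c a ha => ⟨fun f hf => by rw [map_smul, ha.1 f hf, smul_zero], by
    rw [Pi.smul_apply, ha.2, smul_zero]⟩

theorem diffAt_eq_sum_components (f : MvPolynomial (Fin (M + 1)) k) (v w : Fin (M + 1) → k) :
    diffAt f v w = ∑ d ∈ Finset.range (f.totalDegree + 1),
      diffAt (homogeneousComponent d f) v w := by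
  rw [← diffAt_sum, sum_homogeneousComponent]

/-- Membership in `tanHyp` may be tested on forms of positive degree. -/
theorem mem_tanHyp_of_forms {I : Ideal (MvPolynomial (Fin (M + 1)) k)} (hI : CompStable I)
    {v : Fin (M + 1) → k} {i₀ : Fin (M + 1)} {w : Fin (M + 1) → k} (hw : w i₀ = 0)
    (h : ∀ d, ∀ f ∈ I, f.IsHomogeneous (d + 1) → diffAt f v w = 0) : w ∈ tanHyp I v i₀ := by
  refine ⟨fun f hf => ?_, hw⟩
  rw [diffAt_eq_sum_components]
  refine Finset.sum_eq_zero fun d _ => ?_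
  rcases d with _ | d
  · rw [homogeneousComponent_zero, diffAt_apply]
    simp
  · exact h d _ (hI f hf _) (homogeneousComponent_isHomogeneous _ _)

/-- A form in the ideal of the cone, written through the forms `projForm`. -/
theorem exists_eq_sum_of_mem {I : Ideal (MvPolynomial (Fin (M + 1)) k)}
    {v : Fin (M + 1) → k} (hvI : ∀ f ∈ I, eval v f = 0) (i₀ : Fin (M + 1))
    {d : ℕ} {f : MvPolynomial (Fin (M + 1)) k} (hf : f ∈ I) (hfd : f.IsHomogeneous (d + 1)) :
    ∃ g : Fin (M + 1) → MvPolynomial (Fin (M + 1)) k, (∀ j, (g j).IsHomogeneous d) ∧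
      f = ∑ j, g j * projForm v i₀ j :=
  exists_eq_sum_projForm hfd (hvI f hf)

theorem eval_eq_zero_of_forms {σ : Type} {I : Ideal (MvPolynomial σ k)} (hI : CompStable I)
    {p : σ → k} (h : ∀ d, ∀ f ∈ I, f.IsHomogeneous d → eval p f = 0) :
    ∀ f ∈ I, eval p f = 0 := by
  intro f hf
  rw [eval_eq_sum_homogeneousComponent]
  exact Finset.sum_eq_zero fun d _ => h d _ (hI f hf d) (homogeneousComponent_isHomogeneous _ _)

variable (e : Fin (M' + 1) ≃ Fin (M + 1) × Fin (M + 1))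
  {I : Ideal (MvPolynomial (Fin (M + 1)) k)} {v : Fin (M + 1) → k} {i₀ : Fin (M + 1)}

theorem tens_smul_left (c : k) (p ℓ : Fin (M + 1) → k) :
    tens e (c • p) ℓ = c • tens e p ℓ := by
  funext t; simp [tens, mul_assoc]

theorem tens_smul_right (c : k) (p ℓ : Fin (M + 1) → k) :
    tens e p (c • ℓ) = c • tens e p ℓ := by
  funext t; simp [tens]; ring

theorem tens_add_right (p ℓ ℓ' : Fin (M + 1) → k) :
    tens e p (ℓ + ℓ') = tens e p ℓ + tens e p ℓ' := by
  funext t; simp [tens, mul_add]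

theorem tens_ne_zero {p ℓ : Fin (M + 1) → k} (hp : p ≠ 0) (hℓ : ℓ ≠ 0) : tens e p ℓ ≠ 0 := by
  obtain ⟨i, hi⟩ := Function.ne_iff.1 hp
  obtain ⟨j, hj⟩ := Function.ne_iff.1 hℓ
  intro h
  have := congrFun h (e.symm (i, j))
  rw [tens_apply] at this
  exact mul_ne_zero hi hj this

/-- The points of the blow-up lie over other points of the cone or over `v`. -/
theorem exists_eq_tens (hI : CompStable I) (hv : v i₀ ≠ 0) (hvI : ∀ f ∈ I, eval v f = 0)
    {z : Fin (M' + 1) → k} (hz : z ≠ 0) (h : ∀ f ∈ I.comap (segreHom e v i₀), eval z f = 0) :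
    (∃ (p ρ : Fin (M + 1) → k) (c : k), p ≠ 0 ∧ (∀ f ∈ I, eval p f = 0) ∧ ρ ≠ 0 ∧ c ≠ 0 ∧
      projAlong v i₀ p = c • ρ ∧ z = tens e p ρ) ∨
    ∃ ℓ ∈ tanHyp I v i₀, ℓ ≠ 0 ∧ z = tens e v ℓ := by
  obtain ⟨t, ht⟩ := Function.ne_iff.1 hz
  obtain ⟨⟨a, m⟩, rfl⟩ := e.symm.surjective t
  simp only [Pi.zero_apply] at ht
  set p : Fin (M + 1) → k := fun i => z (e.symm (i, m)) with hp
  set ρ : Fin (M + 1) → k := fun j => z (e.symm (a, j)) * (z (e.symm (a, m)))⁻¹ with hρ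
  have hρm : ρ m = 1 := mul_inv_cancel₀ ht
  have hzt : z = tens e p ρ := by
    refine tens_ext e fun i j => ?_
    rw [tens_apply, hp, hρ]
    have h1 := h _ (minor_mem e (I := I) (v := v) (i₀ := i₀) i j a m)
    simp only [map_sub, map_mul, eval_X] at h1
    field_simp
    linear_combination h1
  have hp0 : p ≠ 0 := fun h0 => ht (congrFun h0 a)
  have hρ0 : ρ ≠ 0 := fun h0 => by
    have := congrFun h0 m
    rw [hρm] at this
    exact one_ne_zero this
  have hρi : ρ i₀ = 0 := by
    have h1 := h _ (X_mem e (I := I) hv a)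
    rw [eval_X] at h1
    simp only [hρ, h1, zero_mul]
  have hpI : ∀ f ∈ I, eval p f = 0 := by
    refine eval_eq_zero_of_forms hI fun d f hf hfd => ?_
    have h1 := h _ (colPoly_mem e (v := v) (i₀ := i₀) hfd hf m)
    rw [hzt] at h1
    have h2 := aeval_tens_colPoly e m hfd p ρ
    rw [hρm, one_pow, one_mul] at h2
    exact h2.symm.trans h1
  have hpar : ∀ i, projAlong v i₀ p i = projAlong v i₀ p m * ρ i := by
    intro i
    have h1 := h _ (symm_mem e (I := I) (v := v) (i₀ := i₀) i m)
    rw [hzt] at h1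
    simp only [map_sub, map_mul, eval_X, eval_C, tens_apply, hρm] at h1
    rw [projAlong_apply, projAlong_apply]
    linear_combination h1
  by_cases hc : projAlong v i₀ p m = 0
  · right
    have hpv : p = (p i₀ * (v i₀)⁻¹) • v := by
      have h1 := eq_smul_add_projAlong v i₀ p
      have h2 : projAlong v i₀ p = 0 := by
        funext i
        rw [hpar, hc, zero_mul, Pi.zero_apply]
      rwa [h2, add_zero] at h1
    set c := p i₀ * (v i₀)⁻¹ with hcdef
    have hc0 : c ≠ 0 := fun h0 => hp0 (by rw [hpv, h0, zero_smul])
    refine ⟨c • ρ, Submodule.smul_mem _ _ ?_, smul_ne_zero hc0 hρ0, ?_⟩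
    · refine mem_tanHyp_of_forms hI hρi fun d f hf hfd => ?_
      obtain ⟨g, hg, hfg⟩ := exists_eq_sum_of_mem hvI i₀ hf hfd
      have h1 := h _ (strictTransform_mem e (v := v) (i₀ := i₀) hg (hfg ▸ hf) m)
      rw [hzt] at h1
      have h2 := (aeval_tens_strictTransform e i₀ m hg p ρ).symm.trans h1
      rw [hρm, one_pow, one_mul] at h2
      have hpi : p i₀ ≠ 0 := fun h0 => hc0 (by rw [hcdef, h0, zero_mul])
      have h3 := (mul_eq_zero.1 h2).resolve_left hpi
      rw [hfg, diffAt_sum_projForm hv, projAlong_of_apply_eq_zero hρi]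
      have h4 : ∀ j, aeval p (g j) = c ^ d * eval v (g j) := fun j => by
        rw [hpv]
        exact eval_smul_of_isHomogeneous (hg j) c v
      simp only [h4, mul_assoc] at h3
      rw [← Finset.mul_sum] at h3
      exact (mul_eq_zero.1 h3).resolve_left (pow_ne_zero _ hc0)
    · rw [tens_smul_right, ← tens_smul_left, ← hpv, hzt]
  · left
    refine ⟨p, ρ, _, hp0, hpI, hρ0, hc, ?_, hzt⟩
    funext i
    rw [hpar, Pi.smul_apply, smul_eq_mul]

/-- The converse over the points different from `v`. -/
theorem eval_tens_eq_zero (hI : CompStable I) {p ρ : Fin (M + 1) → k} {c : k} (hc : c ≠ 0)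
    (hp : ∀ f ∈ I, eval p f = 0) (hpρ : projAlong v i₀ p = c • ρ) :
    ∀ f ∈ I.comap (segreHom e v i₀), eval (tens e p ρ) f = 0 := by
  intro f hf
  refine aeval_tens_eq_zero e hI hc hp (fun j => ?_) hf
  exact (congrFun hpρ j).symm.trans (eval_projForm v i₀ j p).symm

theorem coeff_zero_aeval {σ : Type} (c : σ → PowerSeries k) (g : MvPolynomial σ k) :
    PowerSeries.coeff 0 (aeval c g) = eval (fun t => PowerSeries.coeff 0 (c t)) g := by
  rw [PowerSeries.coeff_zero_eq_constantCoeff_apply, map_aeval]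
  have : (PowerSeries.constantCoeff (R := k)).comp (algebraMap k (PowerSeries k)) = RingHom.id k := by
    ext a
    simp
  rw [this]
  simp only [PowerSeries.coeff_zero_eq_constantCoeff_apply]
  rfl

theorem coeff_one_aeval {σ : ℕ} (c : Fin (σ + 1) → PowerSeries k)
    (g : MvPolynomial (Fin (σ + 1)) k) :
    PowerSeries.coeff 1 (aeval c g) =
      diffAt g (fun t => PowerSeries.coeff 0 (c t)) (fun t => PowerSeries.coeff 1 (c t)) := by
  have h1 := derivation_aeval (PowerSeries.derivative k) c g
  have h2 := congrArg (PowerSeries.coeff 0) h1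
  rw [PowerSeries.coeff_derivative, map_sum] at h2
  simp only [Nat.cast_zero, zero_add, mul_one] at h2
  rw [h2, diffAt_apply]
  refine Finset.sum_congr rfl fun t _ => ?_
  rw [← coeff_zero_aeval, PowerSeries.coeff_mul, Finset.Nat.antidiagonal_zero, Finset.sum_singleton,
    PowerSeries.coeff_derivative]
  simp only [Nat.cast_zero, zero_add, mul_one]

/-- A formal arc on the cone through `v` together with its projection divided by the parameter. -/
def IsArc (I : Ideal (MvPolynomial (Fin (M + 1)) k)) (v : Fin (M + 1) → k) (i₀ : Fin (M + 1))
    (P ρ : Fin (M + 1) → PowerSeries k) : Prop :=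
  (∀ f ∈ I, aeval P f = 0) ∧ (∀ j, PowerSeries.coeff 0 (P j) = v j) ∧
    ∀ j, PowerSeries.X * ρ j = aeval P (projForm v i₀ j)

theorem exists_isArc (hv : v i₀ ≠ 0) {P : Fin (M + 1) → PowerSeries k}
    (hP : ∀ f ∈ I, aeval P f = 0) (hPv : ∀ j, PowerSeries.coeff 0 (P j) = v j) :
    ∃ ρ, IsArc I v i₀ P ρ := by
  have h : ∀ j, ∃ r : PowerSeries k, PowerSeries.X * r = aeval P (projForm v i₀ j) := by
    intro j
    have : PowerSeries.X ∣ aeval P (projForm v i₀ j) := by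
      rw [PowerSeries.X_dvd_iff, ← PowerSeries.coeff_zero_eq_constantCoeff_apply, coeff_zero_aeval,
        funext hPv, eval_projForm, projAlong_self hv, Pi.zero_apply]
    obtain ⟨r, hr⟩ := this
    exact ⟨r, hr.symm⟩
  choose ρ hρ using h
  exact ⟨ρ, hP, hPv, hρ⟩

theorem IsArc.coeff_zero {P ρ : Fin (M + 1) → PowerSeries k} (h : IsArc I v i₀ P ρ)
    (j : Fin (M + 1)) :
    PowerSeries.coeff 0 (ρ j) = projAlong v i₀ (fun i => PowerSeries.coeff 1 (P i)) j := by
  have h1 := congrArg (PowerSeries.coeff 1) (h.2.2 j)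
  rw [PowerSeries.coeff_succ_X_mul, coeff_one_aeval, diffAt_eq_constDerivation,
    constDerivation_projForm, eval_C] at h1
  exact h1

theorem IsArc.aeval_eq_zero (hI : CompStable I) {P ρ : Fin (M + 1) → PowerSeries k}
    (h : IsArc I v i₀ P ρ) {f : MvPolynomial (Fin (M' + 1)) k}
    (hf : f ∈ I.comap (segreHom e v i₀)) : aeval (tens e P ρ) f = 0 :=
  aeval_tens_eq_zero e hI PowerSeries.X_ne_zero h.1 h.2.2 hf

theorem IsArc.coeff_zero_tens {P ρ : Fin (M + 1) → PowerSeries k} (h : IsArc I v i₀ P ρ) :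
    (fun t => PowerSeries.coeff 0 (tens e P ρ t)) =
      tens e v (projAlong v i₀ fun i => PowerSeries.coeff 1 (P i)) := by
  funext t
  rw [tens, tens, PowerSeries.coeff_mul, Finset.Nat.antidiagonal_zero, Finset.sum_singleton,
    h.2.1, h.coeff_zero]

theorem IsArc.coeff_one_tens {P ρ : Fin (M + 1) → PowerSeries k} (h : IsArc I v i₀ P ρ) :
    (fun t => PowerSeries.coeff 1 (tens e P ρ t)) =
      tens e v (fun j => PowerSeries.coeff 1 (ρ j)) +
      tens e (fun i => PowerSeries.coeff 1 (P i))
        (projAlong v i₀ fun i => PowerSeries.coeff 1 (P i)) := by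
  funext t
  rw [Pi.add_apply, tens, tens, tens, PowerSeries.coeff_mul, Finset.Nat.antidiagonal_succ]
  simp [h.2.1, ← h.coeff_zero]

/-- The limit point of an arc on the blow-up. -/
theorem IsArc.eval_eq_zero (hI : CompStable I) {P ρ : Fin (M + 1) → PowerSeries k}
    (h : IsArc I v i₀ P ρ) {f : MvPolynomial (Fin (M' + 1)) k}
    (hf : f ∈ I.comap (segreHom e v i₀)) :
    eval (tens e v (projAlong v i₀ fun i => PowerSeries.coeff 1 (P i))) f = 0 := by
  rw [← h.coeff_zero_tens e, ← coeff_zero_aeval, h.aeval_eq_zero e hI hf, map_zero]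

/-- The tangent vector of an arc on the blow-up. -/
theorem IsArc.diffAt_eq_zero (hI : CompStable I) {P ρ : Fin (M + 1) → PowerSeries k}
    (h : IsArc I v i₀ P ρ) {f : MvPolynomial (Fin (M' + 1)) k}
    (hf : f ∈ I.comap (segreHom e v i₀)) :
    diffAt f (tens e v (projAlong v i₀ fun i => PowerSeries.coeff 1 (P i)))
      (fun t => PowerSeries.coeff 1 (tens e P ρ t)) = 0 := by
  rw [← h.coeff_zero_tens e, ← coeff_one_aeval, h.aeval_eq_zero e hI hf, map_zero]

theorem aeval_taylor_coord [CharZero k] {X : Set (Pr k M)} (ev : coordRing X →ₐ[k] k)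
    (D : Derivation k (coordRing X) (coordRing X)) (f : MvPolynomial (Fin (M + 1)) k) :
    aeval (fun j => taylor D ev (coord X j)) f = taylor D ev (Ideal.Quotient.mk (coneIdeal X) f) := by
  rw [← comp_aeval_apply]
  congr 1
  have := comp_aeval_apply (φ := Ideal.Quotient.mkₐ k (coneIdeal X))
    (MvPolynomial.X : Fin (M + 1) → MvPolynomial (Fin (M + 1)) k) f
  rw [aeval_X_left_apply] at this
  exact this.symm

/-- Integral curves of derivations give arcs. -/
theorem exists_isArc_taylor [CharZero k] {X : Set (Pr k M)} (hv : v i₀ ≠ 0)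
    (hvI : ∀ f ∈ coneIdeal X, eval v f = 0) (D : Derivation k (coordRing X) (coordRing X)) :
    ∃ ρ, IsArc (coneIdeal X) v i₀ (fun j => taylor D (coneEval v hvI) (coord X j)) ρ := by
  refine exists_isArc hv (fun f hf => ?_) fun j => ?_
  · rw [aeval_taylor_coord, Ideal.Quotient.eq_zero_iff_mem.2 hf, map_zero]
  · rw [coeff_taylor]
    simp only [Nat.factorial_zero, Nat.cast_one, inv_one, one_mul, Function.iterate_zero, id_eq]
    exact (coneEval_mk v hvI _).trans (eval_X _)

end BlowupPoints

section LinearSubspace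
variable {k : Type} [Field k]

/-- The polynomial of a linear functional. -/
noncomputable def linForm {N : ℕ} (ψ : (Fin (N + 1) → k) →ₗ[k] k) : MvPolynomial (Fin (N + 1)) k :=
  ∑ t, C (ψ fun j => if t = j then 1 else 0) * MvPolynomial.X t

theorem eval_linForm {N : ℕ} (ψ : (Fin (N + 1) → k) →ₗ[k] k) (u : Fin (N + 1) → k) :
    eval u (linForm ψ) = ψ u := by
  rw [LinearMap.pi_apply_eq_sum_univ ψ u, linForm, map_sum]
  refine Finset.sum_congr rfl fun t _ => ?_
  rw [map_mul, eval_C, eval_X, mul_comm, smul_eq_mul]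

/-- A linear subspace of projective space is a variety of the expected dimension. -/
theorem isVariety_hasDim_of_submodule [IsAlgClosed k] {N r : ℕ} (U : Submodule k (Fin (N + 1) → k))
    (hU : finrank k U = r + 1) :
    IsVariety {p : Pr k N | p.submodule ≤ U} ∧ HasDim {p : Pr k N | p.submodule ≤ U} r := by
  have hinf : Infinite k := IsAlgClosed.instInfinite
  let b : Basis (Fin (r + 1)) k U := finBasisOfFinrankEq k U hU
  let lf : Fin (N + 1) → MvPolynomial (Fin (r + 1)) k := fun t => ∑ a, C ((b a : Fin (N + 1) → k) t) * MvPolynomial.X a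
  let Θ : MvPolynomial (Fin (N + 1)) k →ₐ[k] MvPolynomial (Fin (r + 1)) k := aeval lf
  have hlf : ∀ t, (lf t).IsHomogeneous 1 := fun t => by
    refine IsHomogeneous.sum _ _ _ fun a _ => ?_
    have := (isHomogeneous_C (Fin (r + 1)) ((b a : Fin (N + 1) → k) t)).mul (isHomogeneous_X k a)
    rwa [zero_add] at this
  have hevlf : ∀ (c : Fin (r + 1) → k) t, eval c (lf t) = (∑ a, c a • b a : U).1 t := by
    intro c t
    simp only [lf, map_sum, map_mul, eval_C, eval_X, Submodule.coe_sum, Submodule.coe_smul,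
      Finset.sum_apply, Pi.smul_apply, smul_eq_mul]
    exact Finset.sum_congr rfl fun a _ => mul_comm _ _
  have hev : ∀ (c : Fin (r + 1) → k) f, eval c (Θ f) = eval (∑ a, c a • b a : U).1 f := by
    intro c f
    rw [eval_aeval, funext (hevlf c)]
  set J : Ideal (MvPolynomial (Fin (N + 1)) k) := RingHom.ker Θ with hJ
  have hmem : ∀ f, f ∈ J ↔ ∀ u ∈ U, eval u f = 0 := by
    intro f
    rw [hJ, RingHom.mem_ker]
    constructor
    · intro h u hu
      have := hev (b.repr ⟨u, hu⟩) f
      rw [h, map_zero, b.sum_repr] at this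
      exact this.symm
    · intro h
      refine MvPolynomial.funext fun c => ?_
      rw [hev, map_zero]
      exact h _ (Subtype.mem _)
  have hsurj : Function.Surjective Θ := by
    rw [← AlgHom.range_eq_top, ← top_le_iff, ← adjoin_range_X, Algebra.adjoin_le_iff]
    rintro _ ⟨a, rfl⟩
    obtain ⟨g, hg⟩ := LinearMap.exists_leftInverse_of_injective U.subtype U.ker_subtype
    let ψ : (Fin (N + 1) → k) →ₗ[k] k := (b.coord a) ∘ₗ g
    refine ⟨linForm ψ, ?_⟩
    refine MvPolynomial.funext fun c => ?_
    refine (hev c _).trans ((eval_linForm _ _).trans ?_)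
    have h2 : g ((∑ a, c a • b a : U).1) = ∑ a, c a • b a :=
      congrArg (fun l => l (∑ a, c a • b a : U)) hg
    simp only [ψ, LinearMap.comp_apply, h2, eval_X, Basis.coord_apply, b.repr_sum_self]
  have hprime : J.IsPrime := RingHom.ker_isPrime _
  have hst : CompStable J := by
    intro f hf d
    rw [hJ, RingHom.mem_ker] at hf ⊢
    have h1 := congrArg (homogeneousComponent d) hf
    conv at h1 => rw [← sum_homogeneousComponent f]
    rw [map_sum, map_sum, map_zero] at h1
    have h3 : ∀ i, homogeneousComponent d (Θ (homogeneousComponent i f)) =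
        if i = d then Θ (homogeneousComponent d f) else 0 := by
      intro i
      have h4 : (Θ (homogeneousComponent i f)).IsHomogeneous (1 * i) :=
        isHomogeneous_aeval (homogeneousComponent_isHomogeneous i f) hlf
      rw [one_mul] at h4
      rw [homogeneousComponent_of_mem h4]
      by_cases hid : i = d
      · rw [hid, if_pos rfl]
      · rw [if_neg hid, if_neg (Ne.symm hid)]
    simp only [h3, Finset.sum_ite_eq', Finset.mem_range] at h1
    split_ifs at h1 with hlt
    · exact h1
    · rw [homogeneousComponent_eq_zero d f (by omega), map_zero]
  obtain ⟨t, ht⟩ : ∃ t, MvPolynomial.X t ∉ J := by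
    by_contra! h
    have h0 : (b 0 : Fin (N + 1) → k) = 0 := by
      funext t
      have := (hmem _).1 (h t) _ (b 0).2
      rwa [eval_X] at this
    exact b.ne_zero 0 (Subtype.ext h0)
  have hset : {p : Pr k N | p.submodule ≤ U} = projZero J := by
    ext p
    obtain ⟨u, hu, rfl⟩ := exists_mk_eq p
    rw [Set.mem_ofPred_eq, Projectivization.submodule_mk, Submodule.span_singleton_le_iff_mem,
      mk_mem_projZero hst hu]
    constructor
    · exact fun h f hf => (hmem f).1 hf u h
    · intro h
      by_contra hn
      obtain ⟨ψ, hψ, hU⟩ := Submodule.exists_le_ker_of_notMem hn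
      refine hψ ((eval_linForm ψ u).symm.trans (h _ ((hmem _).2 fun w hw => (eval_linForm ψ w).trans (hU hw))))
  rw [hset]
  have hvar := isVariety_projZero hst hprime ht
  refine ⟨hvar, hasDim_of_coneDim hvar ?_⟩
  have hcone := coneIdeal_projZero hst hprime ht
  have h1 := trdeg_coordRing (projZero J)
  have h2 : coordRing (projZero J) ≃ₐ[k] MvPolynomial (Fin (r + 1)) k :=
    (Ideal.quotientEquivAlgOfEq k hcone).trans (Ideal.quotientKerAlgEquivOfSurjective hsurj)
  rw [h2.trdeg_eq] at h1
  rw [MvPolynomial.trdeg_of_isDomain, Cardinal.mk_fin, Cardinal.lift_natCast] at h1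
  exact_mod_cast h1.symm

end LinearSubspace

section Blowup
variable {k : Type} [Field k] {M M' : ℕ}

/-- The properties of a point used to describe the blow-up at that point: formal arcs in all
tangent directions and a two-dimensional space of tangent directions. -/
structure IsGoodPoint (X : Set (Pr k M)) (v : Fin (M + 1) → k) (i₀ : Fin (M + 1)) : Prop where
  apply_ne : v i₀ ≠ 0
  eval_eq : ∀ f ∈ coneIdeal X, eval v f = 0
  exists_arc : ∀ w, (∀ f ∈ coneIdeal X, diffAt f v w = 0) →
    ∃ P ρ, IsArc (coneIdeal X) v i₀ P ρ ∧ ∀ i, PowerSeries.coeff 1 (P i) = w i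
  finrank_eq : finrank k (tanHyp (coneIdeal X) v i₀) = 2

/-- The blow-up of the cone along the line of `v`, as a projective set. -/
def blowup (e : Fin (M' + 1) ≃ Fin (M + 1) × Fin (M + 1)) (X : Set (Pr k M))
    (v : Fin (M + 1) → k) (i₀ : Fin (M + 1)) : Set (Pr k M') :=
  projZero ((coneIdeal X).comap (segreHom e v i₀))

theorem exists_column_ne_zero (e : Fin (M' + 1) ≃ Fin (M + 1) × Fin (M + 1))
    {z : Fin (M' + 1) → k} (hz : z ≠ 0) : ∃ m, (fun i => z (e.symm (i, m))) ≠ 0 := by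
  obtain ⟨t, ht⟩ := Function.ne_iff.1 hz
  refine ⟨(e t).2, Function.ne_iff.2 ⟨(e t).1, ?_⟩⟩
  simpa using ht

/-- The blow-down map, given by the columns of a matrix of rank one. -/
noncomputable def blowDown (e : Fin (M' + 1) ≃ Fin (M + 1) × Fin (M + 1)) (q : Pr k M') : Pr k M :=
  Projectivization.mk k _ (exists_column_ne_zero e q.rep_nonzero).choose_spec

variable (e : Fin (M' + 1) ≃ Fin (M + 1) × Fin (M + 1))

theorem ne_zero_of_tens_ne_zero {p ρ : Fin (M + 1) → k} (h : tens e p ρ ≠ 0) : p ≠ 0 ∧ ρ ≠ 0 := by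
  constructor
  · rintro rfl
    exact h (by funext t; simp [tens])
  · rintro rfl
    exact h (by funext t; simp [tens])

theorem blowDown_mk_tens {p ρ : Fin (M + 1) → k} (h : tens e p ρ ≠ 0) (hp : p ≠ 0) :
    blowDown e (Projectivization.mk k _ h) = Projectivization.mk k p hp := by
  obtain ⟨a, ha⟩ := Projectivization.exists_smul_eq_mk_rep k _ h
  unfold blowDown
  generalize_proofs h1 h2
  rw [Projectivization.mk_eq_mk_iff']
  refine ⟨a * ρ h1.choose, ?_⟩
  funext i
  have := congrFun ha (e.symm (i, h1.choose))
  rw [Pi.smul_apply, tens_apply] at this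
  rw [← this, Pi.smul_apply, smul_eq_mul, Units.smul_def, smul_eq_mul]
  ring

variable {X : Set (Pr k M)} {v : Fin (M + 1) → k} {i₀ : Fin (M + 1)}

theorem IsGoodPoint.ne_zero (hg : IsGoodPoint X v i₀) : v ≠ 0 := fun h =>
  hg.apply_ne (congrFun h i₀)

theorem mk_mem_blowup [Infinite k] {z : Fin (M' + 1) → k} (hz : z ≠ 0) :
    Projectivization.mk k z hz ∈ blowup e X v i₀ ↔
      ∀ f ∈ (coneIdeal X).comap (segreHom e v i₀), eval z f = 0 :=
  mk_mem_projZero (compStable_comap_segreHom e (compStable_coneIdeal X) v i₀) hz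

theorem IsGoodPoint.eval_tens_eq_zero [Infinite k] (hg : IsGoodPoint X v i₀)
    {u : Fin (M + 1) → k} (hu : u ∈ tanHyp (coneIdeal X) v i₀) :
    ∀ f ∈ (coneIdeal X).comap (segreHom e v i₀), eval (tens e v u) f = 0 := by
  intro f hf
  obtain ⟨P, ρ, hP, h1⟩ := hg.exists_arc u hu.1
  have := hP.eval_eq_zero e (compStable_coneIdeal X) hf
  rwa [funext h1, projAlong_of_apply_eq_zero hu.2] at this

theorem IsGoodPoint.cases [Infinite k] (hg : IsGoodPoint X v i₀) {z : Fin (M' + 1) → k}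
    (hz : z ≠ 0) (h : Projectivization.mk k z hz ∈ blowup e X v i₀) :
    (∃ (p ρ : Fin (M + 1) → k) (c : k), p ≠ 0 ∧ (∀ f ∈ coneIdeal X, eval p f = 0) ∧ ρ ≠ 0 ∧
      c ≠ 0 ∧ projAlong v i₀ p = c • ρ ∧ z = tens e p ρ) ∨
    ∃ ℓ ∈ tanHyp (coneIdeal X) v i₀, ℓ ≠ 0 ∧ z = tens e v ℓ :=
  exists_eq_tens e (compStable_coneIdeal X) hg.apply_ne hg.eval_eq hz ((mk_mem_blowup e hz).1 h)

theorem IsGoodPoint.exists_tens [Infinite k] (hg : IsGoodPoint X v i₀) {z : Fin (M' + 1) → k}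
    (hz : z ≠ 0) (h : Projectivization.mk k z hz ∈ blowup e X v i₀) :
    ∃ p ρ : Fin (M + 1) → k, p ≠ 0 ∧ ρ ≠ 0 ∧ (∀ f ∈ coneIdeal X, eval p f = 0) ∧
      z = tens e p ρ := by
  rcases hg.cases e hz h with ⟨p, ρ, c, hp, hpI, hρ, -, -, hzt⟩ | ⟨ℓ, -, hℓ, hzt⟩
  · exact ⟨p, ρ, hp, hρ, hpI, hzt⟩
  · exact ⟨v, ℓ, hg.ne_zero, hℓ, hg.eval_eq, hzt⟩

theorem IsGoodPoint.exists_mem_ne_zero (hg : IsGoodPoint X v i₀) :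
    ∃ ℓ ∈ tanHyp (coneIdeal X) v i₀, ℓ ≠ 0 := by
  have h := hg.finrank_eq
  by_contra! hn
  have : tanHyp (coneIdeal X) v i₀ = ⊥ := (Submodule.eq_bot_iff _).2 hn
  rw [this, finrank_bot] at h
  exact absurd h (by norm_num)

theorem IsGoodPoint.exists_projForm_notMem (hg : IsGoodPoint X v i₀) :
    ∃ j, projForm v i₀ j ∉ coneIdeal X := by
  obtain ⟨ℓ, hℓ, hℓ0⟩ := hg.exists_mem_ne_zero
  obtain ⟨j, hj⟩ := Function.ne_iff.1 hℓ0
  refine ⟨j, fun h => hj ?_⟩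
  have := hℓ.1 _ h
  rwa [diffAt_eq_constDerivation, constDerivation_projForm, eval_C,
    projAlong_of_apply_eq_zero hℓ.2] at this

theorem IsGoodPoint.exists_X_notMem [Infinite k] (hX : IsVariety X) (hg : IsGoodPoint X v i₀) :
    ∃ t, MvPolynomial.X t ∉ (coneIdeal X).comap (segreHom e v i₀) := by
  obtain ⟨j, hj⟩ := hg.exists_projForm_notMem
  obtain ⟨i, hi⟩ := hX.exists_X_notMem
  refine ⟨e.symm (i, j), fun h => ?_⟩
  rw [Ideal.mem_comap, segreHom_X] at h
  exact (hX.isPrime.mem_or_mem h).elim hi hj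

theorem IsGoodPoint.isVariety_blowup [IsAlgClosed k] (hX : IsVariety X) (hg : IsGoodPoint X v i₀) :
    IsVariety (blowup e X v i₀) := by
  have hinf : Infinite k := IsAlgClosed.instInfinite
  obtain ⟨t, ht⟩ := hg.exists_X_notMem e hX
  have hp := hX.isPrime
  exact isVariety_projZero (compStable_comap_segreHom e (compStable_coneIdeal X) v i₀)
    (Ideal.comap_isPrime _ _) ht

theorem IsGoodPoint.coneIdeal_blowup [IsAlgClosed k] (hX : IsVariety X)
    (hg : IsGoodPoint X v i₀) :
    coneIdeal (blowup e X v i₀) = (coneIdeal X).comap (segreHom e v i₀) := by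
  have hinf : Infinite k := IsAlgClosed.instInfinite
  obtain ⟨t, ht⟩ := hg.exists_X_notMem e hX
  have hp := hX.isPrime
  exact coneIdeal_projZero (compStable_comap_segreHom e (compStable_coneIdeal X) v i₀)
    (Ideal.comap_isPrime _ _) ht

theorem trdeg_eq_of_isAlgebraic {A : Type} [CommRing A] [IsDomain A] [Algebra k A]
    (R : Subalgebra k A) (h : Algebra.IsAlgebraic R A) : Algebra.trdeg k R = Algebra.trdeg k A := by
  have h4 := trdeg_add_eq k R (A := A)
  rwa [trdeg_eq_zero_iff.2 h, add_zero] at h4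

theorem IsGoodPoint.coneDim_blowup [IsAlgClosed k] (hX : IsVariety X) (hg : IsGoodPoint X v i₀) :
    coneDim (blowup e X v i₀) = coneDim X := by
  have hinf : Infinite k := IsAlgClosed.instInfinite
  have hdom := hX.isDomain
  have hJ := hg.coneIdeal_blowup e hX
  let Ψ : coordRing (blowup e X v i₀) →ₐ[k] coordRing X :=
    Ideal.quotientMapₐ (coneIdeal X) (segreHom e v i₀) hJ.le
  have hΨ : Function.Injective Ψ := Ideal.quotientMap_injective' (H := hJ.le) hJ.ge
  let R := Ψ.range
  have hR : ∀ i j, Ideal.Quotient.mk (coneIdeal X) (MvPolynomial.X i * projForm v i₀ j) ∈ R := by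
    intro i j
    refine ⟨Ideal.Quotient.mk _ (MvPolynomial.X (e.symm (i, j))), ?_⟩
    rw [← segreHom_X e v i₀ i j]
    rfl
  obtain ⟨j, hj⟩ := hg.exists_projForm_notMem
  set y := Ideal.Quotient.mk (coneIdeal X) (projForm v i₀ j) with hy
  have hy0 : y ≠ 0 := fun h => hj (Ideal.Quotient.eq_zero_iff_mem.1 h)
  have hyy : y * y ∈ R := by
    have h1 : projForm v i₀ j * projForm v i₀ j = MvPolynomial.X j * projForm v i₀ j -
        algebraMap k (MvPolynomial (Fin (M + 1)) k) (v j * (v i₀)⁻¹) *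
          (MvPolynomial.X i₀ * projForm v i₀ j) := by
      rw [MvPolynomial.algebraMap_eq]
      simp only [projForm]
      ring
    rw [hy, ← map_mul, h1, map_sub, map_mul (Ideal.Quotient.mk (coneIdeal X))
      (algebraMap k (MvPolynomial (Fin (M + 1)) k) _)]
    exact R.sub_mem (hR j j) (R.mul_mem (R.algebraMap_mem _) (hR i₀ j))
  have halg : Algebra.IsAlgebraic R (coordRing X) := by
    refine isAlgebraic_of_generators R (coord X) (adjoin_coord X) fun i => ?_
    refine ⟨Polynomial.C (⟨y * y, hyy⟩ : R) * Polynomial.X ^ 2 -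
      Polynomial.C ((⟨_, hR i j⟩ : R) * ⟨_, hR i j⟩), fun h => ?_, ?_⟩
    · have := congrArg (fun p => Polynomial.coeff p 2) h
      simp only [Polynomial.coeff_sub, Polynomial.coeff_C_mul, Polynomial.coeff_X_pow, if_true,
        mul_one, Polynomial.coeff_C, Polynomial.coeff_zero] at this
      norm_num at this
      have h2 := congrArg Subtype.val this
      exact mul_ne_zero hy0 hy0 h2
    · simp only [map_sub, map_mul, Polynomial.aeval_C, map_pow, Polynomial.aeval_X]
      change y * y * coord X i ^ 2 - Ideal.Quotient.mk (coneIdeal X) _ *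
        Ideal.Quotient.mk (coneIdeal X) _ = 0
      rw [map_mul, ← hy]
      change y * y * coord X i ^ 2 - coord X i * y * (coord X i * y) = 0
      ring
  have h1 := trdeg_coordRing (blowup e X v i₀)
  have h2 := trdeg_coordRing X
  have h3 := (AlgEquiv.ofInjective Ψ hΨ).trdeg_eq
  have h4 := trdeg_eq_of_isAlgebraic R halg
  rw [← h3, h1, h2] at h4
  exact_mod_cast h4

end Blowup

section BlowupProperties
variable {k : Type} [Field k] {M M' : ℕ}
variable (e : Fin (M' + 1) ≃ Fin (M + 1) × Fin (M + 1))
variable {X : Set (Pr k M)} {v : Fin (M + 1) → k} {i₀ : Fin (M + 1)}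

theorem IsGoodPoint.isMorphismOn_blowDown [Infinite k] (hg : IsGoodPoint X v i₀) :
    IsMorphismOn (blowup e X v i₀) (blowDown e) := by
  intro q hq
  obtain ⟨z, hz, rfl⟩ := exists_mk_eq q
  obtain ⟨m, hm⟩ := exists_column_ne_zero e hz
  refine ⟨fun i => MvPolynomial.X (e.symm (i, m)), IsRep.localRep (d := 1) ⟨fun i => isHomogeneous_X k _, ?_⟩ hz ?_⟩
  · intro z' hz' hq' hF
    obtain ⟨p, ρ, hp, hρ, -, rfl⟩ := hg.exists_tens e hz' hq'
    rw [blowDown_mk_tens e hz' hp, Projectivization.mk_eq_mk_iff']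
    simp only [eval_X, tens_apply] at hF ⊢
    have hρm : ρ m ≠ 0 := fun h => hF (by funext i; simp [h])
    refine ⟨(ρ m)⁻¹, ?_⟩
    funext i
    simp only [Pi.smul_apply, smul_eq_mul]
    field_simp
  · simpa only [eval_X] using hm

theorem IsGoodPoint.image_blowDown [Infinite k] (hX : IsVariety X) (hg : IsGoodPoint X v i₀) :
    blowDown e '' blowup e X v i₀ = X := by
  apply Set.Subset.antisymm
  · rintro _ ⟨q, hq, rfl⟩
    obtain ⟨z, hz, rfl⟩ := exists_mk_eq q
    obtain ⟨p, ρ, hp, hρ, hpI, rfl⟩ := hg.exists_tens e hz hq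
    rw [blowDown_mk_tens e hz hp]
    exact (hX.1.mem_iff hp).2 hpI
  · intro q hq
    obtain ⟨p, hp, rfl⟩ := exists_mk_eq q
    have hpI := (hX.1.mem_iff hp).1 hq
    by_cases h : projAlong v i₀ p = 0
    · obtain ⟨ℓ, hℓ, hℓ0⟩ := hg.exists_mem_ne_zero
      have hz := tens_ne_zero e hg.ne_zero hℓ0
      refine ⟨Projectivization.mk k _ hz, (mk_mem_blowup e hz).2 (hg.eval_tens_eq_zero e hℓ), ?_⟩
      rw [blowDown_mk_tens e hz hg.ne_zero, Projectivization.mk_eq_mk_iff']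
      have h1 := eq_smul_add_projAlong v i₀ p
      rw [h, add_zero] at h1
      have hc : p i₀ * (v i₀)⁻¹ ≠ 0 := fun h2 => hp (by rw [h1, h2, zero_smul])
      refine ⟨(p i₀ * (v i₀)⁻¹)⁻¹, ?_⟩
      generalize p i₀ * (v i₀)⁻¹ = c at h1 hc
      rw [h1, smul_smul, inv_mul_cancel₀ hc, one_smul]
    · have hz := tens_ne_zero e hp h
      refine ⟨Projectivization.mk k _ hz, (mk_mem_blowup e hz).2
        (PinchPaper.eval_tens_eq_zero e (compStable_coneIdeal X) one_ne_zero hpI (one_smul k _).symm), ?_⟩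
      exact blowDown_mk_tens e hz hp

theorem IsGoodPoint.mk_mem (hX : IsVariety X) (hg : IsGoodPoint X v i₀) (hv : v ≠ 0) :
    Projectivization.mk k v hv ∈ X :=
  (hX.1.mem_iff hv).2 hg.eval_eq

/-- Points of the blow-up away from the exceptional fibre. -/
theorem IsGoodPoint.exists_of_ne [Infinite k] (hg : IsGoodPoint X v i₀) (hv : v ≠ 0)
    {z : Fin (M' + 1) → k} (hz : z ≠ 0) (h : Projectivization.mk k z hz ∈ blowup e X v i₀)
    (hne : blowDown e (Projectivization.mk k z hz) ≠ Projectivization.mk k v hv) :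
    ∃ (p : Fin (M + 1) → k) (c : k), p ≠ 0 ∧ (∀ f ∈ coneIdeal X, eval p f = 0) ∧
      c ≠ 0 ∧ projAlong v i₀ p ≠ 0 ∧ z = c • tens e p (projAlong v i₀ p) := by
  rcases hg.cases e hz h with ⟨p, ρ, c, hp, hpI, hρ, hc, hpρ, rfl⟩ | ⟨ℓ, hℓ, hℓ0, rfl⟩
  · refine ⟨p, c⁻¹, hp, hpI, inv_ne_zero hc, ?_, ?_⟩
    · rw [hpρ]
      exact smul_ne_zero hc hρ
    · rw [hpρ, tens_smul_right, smul_smul, inv_mul_cancel₀ hc, one_smul]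
  · exact absurd (blowDown_mk_tens e hz hv) hne

theorem IsGoodPoint.injOn_blowDown [Infinite k] (hg : IsGoodPoint X v i₀) (hv : v ≠ 0) :
    InjOn (blowDown e) {q | q ∈ blowup e X v i₀ ∧ blowDown e q ≠ Projectivization.mk k v hv} := by
  rintro q ⟨hq, hqx⟩ q' ⟨hq', hqx'⟩ heq
  obtain ⟨z, hz, rfl⟩ := exists_mk_eq q
  obtain ⟨z', hz', rfl⟩ := exists_mk_eq q'
  obtain ⟨p, c, hp, -, hc, hπ, hzp⟩ := hg.exists_of_ne e hv hz hq hqx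
  obtain ⟨p', c', hp', -, hc', hπ', hzp'⟩ := hg.exists_of_ne e hv hz' hq' hqx'
  rw [← tens_smul_right] at hzp hzp'
  subst hzp hzp'
  rw [blowDown_mk_tens e hz hp, blowDown_mk_tens e hz' hp', Projectivization.mk_eq_mk_iff'] at heq
  obtain ⟨a, rfl⟩ := heq
  rw [Projectivization.mk_eq_mk_iff']
  refine ⟨a * a * c * c'⁻¹, ?_⟩
  rw [map_smul, tens_smul_left, tens_smul_right, tens_smul_right, tens_smul_right, smul_smul,
    smul_smul, smul_smul]
  congr 1
  field_simp

theorem IsGoodPoint.mem_excFiber [Infinite k] (hg : IsGoodPoint X v i₀) (hv : v ≠ 0)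
    {z : Fin (M' + 1) → k} (hz : z ≠ 0) :
    Projectivization.mk k z hz ∈ ExcFiber (blowup e X v i₀) (blowDown e) (Projectivization.mk k v hv) ↔
      ∃ ℓ ∈ tanHyp (coneIdeal X) v i₀, ℓ ≠ 0 ∧ z = tens e v ℓ := by
  constructor
  · rintro ⟨hq, hqx⟩
    rcases hg.cases e hz hq with ⟨p, ρ, c, hp, hpI, hρ, hc, hpρ, rfl⟩ | h
    · exfalso
      rw [blowDown_mk_tens e hz hp, Projectivization.mk_eq_mk_iff'] at hqx
      obtain ⟨a, rfl⟩ := hqx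
      rw [map_smul, projAlong_self hg.apply_ne, smul_zero] at hpρ
      exact smul_ne_zero hc hρ hpρ.symm
    · exact h
  · rintro ⟨ℓ, hℓ, hℓ0, rfl⟩
    exact ⟨(mk_mem_blowup e hz).2 (hg.eval_tens_eq_zero e hℓ), blowDown_mk_tens e hz hv⟩

/-- The linear map `ℓ ↦ tens e v ℓ`. -/
def tensLin (v : Fin (M + 1) → k) : (Fin (M + 1) → k) →ₗ[k] (Fin (M' + 1) → k) where
  toFun := tens e v
  map_add' := tens_add_right e v
  map_smul' c := tens_smul_right e c v

theorem tensLin_injective (hv : v ≠ 0) : Function.Injective (tensLin e v) := by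
  rw [injective_iff_map_eq_zero]
  intro a ha
  by_contra h
  exact tens_ne_zero e hv h ha

theorem IsGoodPoint.excFiber_eq [Infinite k] (hg : IsGoodPoint X v i₀) (hv : v ≠ 0) :
    ExcFiber (blowup e X v i₀) (blowDown e) (Projectivization.mk k v hv) =
      {p | p.submodule ≤ (tanHyp (coneIdeal X) v i₀).map (tensLin e v)} := by
  ext q
  obtain ⟨z, hz, rfl⟩ := exists_mk_eq q
  rw [hg.mem_excFiber e hv hz, Set.mem_ofPred_eq, Projectivization.submodule_mk,
    Submodule.span_singleton_le_iff_mem, Submodule.mem_map]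
  constructor
  · rintro ⟨ℓ, hℓ, -, rfl⟩
    exact ⟨ℓ, hℓ, rfl⟩
  · rintro ⟨ℓ, hℓ, rfl⟩
    exact ⟨ℓ, hℓ, fun h => hz (by rw [h, map_zero]), rfl⟩

theorem IsGoodPoint.isVariety_excFiber [IsAlgClosed k] (hg : IsGoodPoint X v i₀) (hv : v ≠ 0) :
    IsVariety (ExcFiber (blowup e X v i₀) (blowDown e) (Projectivization.mk k v hv)) ∧
      HasDim (ExcFiber (blowup e X v i₀) (blowDown e) (Projectivization.mk k v hv)) 1 := by
  have hinf : Infinite k := IsAlgClosed.instInfinite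
  rw [hg.excFiber_eq e hv]
  refine isVariety_hasDim_of_submodule _ ?_
  rw [← (Submodule.equivMapOfInjective _ (tensLin_injective e hv) _).finrank_eq]
  exact hg.finrank_eq

theorem diffAt_mul (f g : MvPolynomial (Fin (M + 1)) k) (p w : Fin (M + 1) → k) :
    diffAt (f * g) p w = eval p f * diffAt g p w + eval p g * diffAt f p w := by
  simp only [diffAt_eq_constDerivation, Derivation.leibniz, smul_eq_mul, map_add, map_mul]

theorem diffAt_sub (f g : MvPolynomial (Fin (M + 1)) k) (p w : Fin (M + 1) → k) :
    diffAt (f - g) p w = diffAt f p w - diffAt g p w := by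
  simp only [diffAt_eq_constDerivation, map_sub]

theorem diffAt_X (p w : Fin (M + 1) → k) (t : Fin (M + 1)) :
    diffAt (MvPolynomial.X t) p w = w t := by
  rw [diffAt_eq_constDerivation, constDerivation, mkDerivation_X, eval_C]

theorem diffAt_C (p w : Fin (M + 1) → k) (c : k) : diffAt (C c) p w = 0 := by
  rw [diffAt_eq_constDerivation]
  have : constDerivation w (C c) = 0 := (constDerivation w).map_algebraMap c
  rw [this, map_zero]

theorem diffAt_eq_zero_of_forall [Infinite k] {f : MvPolynomial (Fin (M + 1)) k}
    {p w : Fin (M + 1) → k} (h : ∀ s : k, eval (p + s • w) f = 0) : diffAt f p w = 0 := by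
  set y : Fin (M + 1) → Polynomial k := fun t => Polynomial.C (p t) + Polynomial.C (w t) * Polynomial.X
  have hev : ∀ (s : k) (g : MvPolynomial (Fin (M + 1)) k),
      Polynomial.aeval s (aeval y g) = eval (p + s • w) g := by
    intro s g
    rw [comp_aeval_apply]
    change aeval _ g = aeval _ g
    congr 2
    funext t
    simp only [y, map_add, map_mul, Polynomial.aeval_C, Polynomial.aeval_X]
    exact congrArg _ (mul_comm _ _)
  have h0 : aeval y f = 0 := Polynomial.funext fun s => by
    rw [Polynomial.eval_zero, ← h s, ← hev, Polynomial.coe_aeval_eq_eval]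
  have h1 := derivation_aeval (Polynomial.derivative' (R := k)) y f
  rw [h0, map_zero] at h1
  have h2 := congrArg (Polynomial.aeval (0 : k)) h1
  rw [map_zero, map_sum] at h2
  rw [diffAt_apply, h2]
  refine Finset.sum_congr rfl fun t _ => ?_
  rw [map_mul, hev, zero_smul, add_zero]
  simp [y]

variable {τ : Fin (M + 1) → k}

theorem exists_eq_tens_add (hv : v i₀ ≠ 0) (hτ : τ ≠ 0) {w : Fin (M' + 1) → k}
    {I : Ideal (MvPolynomial (Fin (M + 1)) k)}
    (hw : ∀ f ∈ I.comap (segreHom e v i₀), diffAt f (tens e v τ) w = 0) :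
    ∃ (b : Fin (M + 1) → k) (c : k), b i₀ = 0 ∧ w = tens e v b + c • tens e τ τ := by
  obtain ⟨m, hm⟩ := Function.ne_iff.1 hτ
  simp only [Pi.zero_apply] at hm
  set a : Fin (M + 1) → k := fun i =>
    w (e.symm (i, m)) * (τ m)⁻¹ - v i * w (e.symm (i₀, m)) * (v i₀)⁻¹ * (τ m)⁻¹ with ha
  set b : Fin (M + 1) → k := fun j => w (e.symm (i₀, j)) * (v i₀)⁻¹ with hb
  have h1 : ∀ i j, w (e.symm (i, j)) = v i * b j + τ j * a i := by
    intro i j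
    have := hw _ (minor_mem e i j i₀ m)
    simp only [diffAt_sub, diffAt_mul, diffAt_X, eval_X, tens_apply] at this
    simp only [ha, hb]
    field_simp
    linear_combination this
  have h2 : ∀ i j, τ j * a i = τ i * a j := by
    intro i j
    have := hw _ (symm_mem e i j)
    simp only [diffAt_sub, diffAt_mul, diffAt_X, eval_X, diffAt_C, eval_C, mul_zero, add_zero] at this
    have h3 := h1 i j
    have h4 := h1 j i
    simp only [hb] at h3 h4
    linear_combination this - h3 + h4
  have hbi : b i₀ = 0 := by
    have := hw _ (X_mem e hv i₀)
    rw [diffAt_X] at this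
    simp only [hb, this, zero_mul]
  refine ⟨b, a m * (τ m)⁻¹, hbi, tens_ext e fun i j => ?_⟩
  rw [Pi.add_apply, Pi.smul_apply, tens_apply, tens_apply, smul_eq_mul, h1 i j]
  have h3 : a i = τ i * a m * (τ m)⁻¹ := by
    rw [← h2 i m]
    field_simp
  rw [h3]
  ring

theorem mem_tanHyp_of_diffAt_tens {I : Ideal (MvPolynomial (Fin (M + 1)) k)} (hI : CompStable I)
    (hv : v i₀ ≠ 0) (hvI : ∀ f ∈ I, eval v f = 0) (hτ : τ ∈ tanHyp I v i₀) (hτ0 : τ ≠ 0)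
    {b : Fin (M + 1) → k} (hb : b i₀ = 0)
    (h : ∀ f ∈ I.comap (segreHom e v i₀), diffAt f (tens e v τ) (tens e v b) = 0) :
    b ∈ tanHyp I v i₀ := by
  obtain ⟨m, hm⟩ := Function.ne_iff.1 hτ0
  simp only [Pi.zero_apply] at hm
  refine mem_tanHyp_of_forms hI hb fun d f hf hfd => ?_
  obtain ⟨g, hg, rfl⟩ := exists_eq_sum_of_mem hvI i₀ hf hfd
  have h1 := h _ (strictTransform_mem e hg hf m)
  have h2 : ∑ j, eval v (g j) * τ j = 0 := by
    have := hτ.1 _ hf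
    rwa [diffAt_sum_projForm hv, projAlong_of_apply_eq_zero hτ.2] at this
  rw [diffAt_sum_projForm hv, projAlong_of_apply_eq_zero hb]
  set P : Fin (M + 1) → PowerSeries k := fun i => PowerSeries.C (v i) with hP
  set ρ : Fin (M + 1) → PowerSeries k := fun i => PowerSeries.C (τ i) + PowerSeries.X * PowerSeries.C (b i) with hρ
  have h3 := coeff_one_aeval (tens e P ρ) (strictTransform e i₀ m g)
  have e0 : (fun t => PowerSeries.coeff 0 (tens e P ρ t)) = tens e v τ := by
    funext t
    simp [tens, P, ρ]
  have e1 : (fun t => PowerSeries.coeff 1 (tens e P ρ t)) = tens e v b := by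
    funext t
    simp [tens, P, ρ, PowerSeries.coeff_C_mul]
  rw [e0, e1, h1, aeval_tens_strictTransform e i₀ m hg] at h3
  have h4 : ∀ j, aeval P (g j) = PowerSeries.C (eval v (g j)) := by
    intro j
    exact aeval_algebraMap_apply (PowerSeries k) v (g j)
  have h5 : ∑ j, aeval P (g j) * ρ j =
      PowerSeries.X * PowerSeries.C (∑ j, eval v (g j) * b j) := by
    have : ∑ j, aeval P (g j) * ρ j = PowerSeries.C (∑ j, eval v (g j) * τ j) +
        PowerSeries.X * PowerSeries.C (∑ j, eval v (g j) * b j) := by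
      rw [map_sum, map_sum, Finset.mul_sum, ← Finset.sum_add_distrib]
      refine Finset.sum_congr rfl fun j _ => ?_
      rw [h4, hρ, map_mul, map_mul]
      ring
    rw [this, h2, map_zero, zero_add]
  rw [h5, mul_left_comm, PowerSeries.coeff_succ_X_mul,
    PowerSeries.coeff_zero_eq_constantCoeff_apply] at h3
  simp only [map_mul, map_pow, PowerSeries.constantCoeff_C, hP, hρ, map_add,
    PowerSeries.constantCoeff_X, zero_mul, add_zero] at h3
  have h6 := mul_eq_zero.1 h3
  rcases h6 with h6 | h6
  · exact absurd h6 (mul_ne_zero (pow_ne_zero _ hm) hv)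
  · exact h6

theorem IsGoodPoint.diffAt_tens_eq_zero [Infinite k] (hg : IsGoodPoint X v i₀)
    (hτ : τ ∈ tanHyp (coneIdeal X) v i₀) {b : Fin (M + 1) → k}
    (hb : b ∈ tanHyp (coneIdeal X) v i₀) :
    ∀ f ∈ (coneIdeal X).comap (segreHom e v i₀), diffAt f (tens e v τ) (tens e v b) = 0 := by
  intro f hf
  refine diffAt_eq_zero_of_forall fun s => ?_
  rw [← tens_smul_right, ← tens_add_right]
  exact hg.eval_tens_eq_zero e (Submodule.add_mem _ hτ (Submodule.smul_mem _ s hb)) f hf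

theorem IsArc.apply_eq_zero {I : Ideal (MvPolynomial (Fin (M + 1)) k)} (hv : v i₀ ≠ 0)
    {P ρ : Fin (M + 1) → PowerSeries k} (h : IsArc I v i₀ P ρ) : ρ i₀ = 0 := by
  have := h.2.2 i₀
  rw [projForm_self hv, map_zero] at this
  exact (mul_eq_zero.1 this).resolve_left PowerSeries.X_ne_zero

theorem IsGoodPoint.finrank_embTangent [IsAlgClosed k] (hX : IsVariety X)
    (hg : IsGoodPoint X v i₀) (hτ : τ ∈ tanHyp (coneIdeal X) v i₀) (hτ0 : τ ≠ 0)
    (hz : tens e v τ ≠ 0) :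
    finrank k (embTangent (blowup e X v i₀) (Projectivization.mk k _ hz)) = 3 := by
  have hinf : Infinite k := IsAlgClosed.instInfinite
  obtain ⟨P, ρ, hP, hPτ⟩ := hg.exists_arc τ hτ.1
  set b₁ : Fin (M + 1) → k := fun j => PowerSeries.coeff 1 (ρ j) with hb₁
  have hb₁0 : b₁ i₀ = 0 := by
    simp only [hb₁, hP.apply_eq_zero hg.apply_ne, map_zero]
  have hw1 : ∀ f ∈ (coneIdeal X).comap (segreHom e v i₀),
      diffAt f (tens e v τ) (tens e v b₁ + tens e τ τ) = 0 := by
    intro f hf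
    have := hP.diffAt_eq_zero e (compStable_coneIdeal X) hf
    rwa [hP.coeff_one_tens e, funext hPτ, projAlong_of_apply_eq_zero hτ.2] at this
  let Φ : (tanHyp (coneIdeal X) v i₀ × k) →ₗ[k] (Fin (M' + 1) → k) :=
    ((tensLin e v).comp (Submodule.subtype _)).coprod
      ((LinearMap.id (R := k) (M := k)).smulRight (tens e v b₁ + tens e τ τ))
  have hΦ : ∀ b c, Φ (b, c) = tens e v b + c • (tens e v b₁ + tens e τ τ) := fun b c => rfl
  have hinj : Function.Injective Φ := by
    rw [injective_iff_map_eq_zero]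
    rintro ⟨b, c⟩ h
    rw [hΦ] at h
    have h1 : (b : Fin (M + 1) → k) + c • b₁ = 0 := by
      funext j
      have := congrFun h (e.symm (i₀, j))
      simp only [Pi.add_apply, Pi.smul_apply, tens_apply, hτ.2, zero_mul, add_zero, smul_eq_mul,
        Pi.zero_apply] at this ⊢
      refine (mul_eq_zero.1 ?_).resolve_left hg.apply_ne
      linear_combination this
    have h2 : c • tens e τ τ = 0 := by
      rw [smul_add, ← add_assoc, ← tens_smul_right, ← tens_add_right, h1] at h
      rw [← h]
      funext t
      simp [tens]
    have hc : c = 0 := (smul_eq_zero.1 h2).resolve_right (tens_ne_zero e hτ0 hτ0)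
    subst hc
    rw [zero_smul, add_zero] at h1
    exact Prod.ext (Subtype.ext h1) rfl
  have hrange : LinearMap.range Φ = embTangent (blowup e X v i₀) (Projectivization.mk k _ hz) := by
    ext w
    rw [mem_embTangent_mk, hg.coneIdeal_blowup e hX, LinearMap.mem_range]
    constructor
    · rintro ⟨⟨b, c⟩, rfl⟩ f hf
      rw [hΦ, map_add, map_smul, hw1 f hf, hg.diffAt_tens_eq_zero e hτ b.2 f hf, smul_zero, add_zero]
    · intro h
      obtain ⟨b, c, hb, rfl⟩ := exists_eq_tens_add e hg.apply_ne hτ0 h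
      have hb' : b - c • b₁ ∈ tanHyp (coneIdeal X) v i₀ := by
        refine mem_tanHyp_of_diffAt_tens e (compStable_coneIdeal X) hg.apply_ne hg.eval_eq hτ hτ0
          (by simp [hb, hb₁0]) fun f hf => ?_
        have h1 := h f hf
        have h2 := hw1 f hf
        have h3 : tens e v (b - c • b₁) =
            tens e v b + c • tens e τ τ - c • (tens e v b₁ + tens e τ τ) := by
          funext t
          simp [tens]
          ring
        rw [h3, map_sub, h1, map_smul, h2, smul_zero, sub_zero]
      refine ⟨(⟨_, hb'⟩, c), ?_⟩
      rw [hΦ]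
      funext t
      simp [tens]
      ring
  rw [← hrange, LinearMap.finrank_range_of_inj hinj, finrank_prod, hg.finrank_eq, finrank_self]

theorem IsGoodPoint.isBlowupAt [IsAlgClosed k] (hX : IsVariety X) (hdim : HasDim X 2)
    (hg : IsGoodPoint X v i₀) (hv : v ≠ 0) :
    IsBlowupAt (blowup e X v i₀) X (blowDown e) (Projectivization.mk k v hv) := by
  have hinf : Infinite k := IsAlgClosed.instInfinite
  refine ⟨hg.mk_mem hX hv, hg.isVariety_blowup e hX,
    hasDim_of_coneDim (hg.isVariety_blowup e hX) ?_, hg.isMorphismOn_blowDown e,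
    hg.image_blowDown e hX, hg.injOn_blowDown e hv, (hg.isVariety_excFiber e hv).1,
    (hg.isVariety_excFiber e hv).2, fun q hq => ?_⟩
  · rw [hg.coneDim_blowup e hX, coneDim_of_hasDim hX hdim]
  · obtain ⟨z, hz, rfl⟩ := exists_mk_eq q
    obtain ⟨ℓ, hℓ, hℓ0, rfl⟩ := (hg.mem_excFiber e hv hz).1 hq
    exact hg.finrank_embTangent e hX hℓ hℓ0 hz

end BlowupProperties

section ResolvedProjection
variable {k : Type} [Field k] {M M' N N' : ℕ}

/-- The forms obtained from `F` by applying a linear map. -/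
noncomputable def mapForms (L : (Fin (N + 1) → k) →ₗ[k] (Fin (N' + 1) → k))
    (F : Fin (N + 1) → MvPolynomial (Fin (M + 1)) k) (i : Fin (N' + 1)) :
    MvPolynomial (Fin (M + 1)) k :=
  ∑ j, L (Pi.single j 1) i • F j

variable {L : (Fin (N + 1) → k) →ₗ[k] (Fin (N' + 1) → k)}
  {F : Fin (N + 1) → MvPolynomial (Fin (M + 1)) k}

theorem linearMap_mapForms (θ : MvPolynomial (Fin (M + 1)) k →ₗ[k] k) (i : Fin (N' + 1)) :
    θ (mapForms L F i) = L (fun j => θ (F j)) i := by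
  rw [mapForms, map_sum, LinearMap.pi_apply_eq_sum_univ L, Finset.sum_apply]
  refine Finset.sum_congr rfl fun j _ => ?_
  have : (fun i => if j = i then (1 : k) else 0) = Pi.single j 1 := by
    funext i
    simp [Pi.single_apply, eq_comm]
  rw [map_smul, Pi.smul_apply, smul_eq_mul, smul_eq_mul, this, mul_comm]

theorem eval_mapForms (u : Fin (M + 1) → k) (i : Fin (N' + 1)) :
    eval u (mapForms L F i) = L (fun j => eval u (F j)) i :=
  linearMap_mapForms (aeval u).toLinearMap i

theorem diffAt_mapForms (u w : Fin (M + 1) → k) (i : Fin (N' + 1)) :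
    diffAt (mapForms L F i) u w = L (fun j => diffAt (F j) u w) i := by
  simp only [diffAt_eq_constDerivation]
  exact linearMap_mapForms ((aeval u).toLinearMap.comp (constDerivation w).toLinearMap) i

theorem coeff_aeval_mapForms (P : Fin (M + 1) → PowerSeries k) (n : ℕ) (i : Fin (N' + 1)) :
    PowerSeries.coeff n (aeval P (mapForms L F i)) =
      L (fun j => PowerSeries.coeff n (aeval P (F j))) i :=
  linearMap_mapForms ((PowerSeries.coeff n).comp (aeval P).toLinearMap) i

theorem mapForms_isHomogeneous {d : ℕ} (hF : ∀ i, (F i).IsHomogeneous d) (i : Fin (N' + 1)) :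
    (mapForms L F i).IsHomogeneous d :=
  IsHomogeneous.sum _ _ _ fun j _ => by
    rw [MvPolynomial.smul_eq_C_mul]
    simpa using (isHomogeneous_C _ _).mul (hF j)

/-- The inner projection on the blow-up: the projection of `φ` away from the exceptional fibre, and
the projection of the differential of `F` on it. -/
noncomputable def resolvedProj (e : Fin (M' + 1) ≃ Fin (M + 1) × Fin (M + 1))
    (φ : Pr k M → Pr k N) (L : (Fin (N + 1) → k) →ₗ[k] (Fin (N' + 1) → k))
    (F : Fin (N + 1) → MvPolynomial (Fin (M + 1)) k) (v : Fin (M + 1) → k) (i₀ : Fin (M + 1))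
    (q : Pr k M') : Pr k N' :=
  open Classical in
  if h : L (φ (blowDown e q)).rep ≠ 0 then Projectivization.mk k _ h
  else if h : L (fun i => diffAt (F i) v fun j => q.rep (e.symm (i₀, j))) ≠ 0 then
    Projectivization.mk k _ h
  else Projectivization.mk k (fun _ => 1) (Function.ne_iff.2 ⟨0, one_ne_zero⟩)

variable (e : Fin (M' + 1) ≃ Fin (M + 1) × Fin (M + 1))
variable {X : Set (Pr k M)} {φ : Pr k M → Pr k N} {v : Fin (M + 1) → k} {i₀ : Fin (M + 1)}

theorem resolvedProj_eq_of_ne {q : Pr k M'} {w : Fin (N + 1) → k} (hw : w ≠ 0)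
    (hφ : φ (blowDown e q) = Projectivization.mk k w hw) (hL : L w ≠ 0) :
    resolvedProj e φ L F v i₀ q = Projectivization.mk k _ hL := by
  obtain ⟨a, ha⟩ := Projectivization.exists_smul_eq_mk_rep k w hw
  have hr : L (φ (blowDown e q)).rep = (a : k) • L w := by
    rw [hφ, ← ha, Units.smul_def, map_smul]
  have h : L (φ (blowDown e q)).rep ≠ 0 := by
    rw [hr]
    exact smul_ne_zero a.ne_zero hL
  rw [resolvedProj, dif_pos h, Projectivization.mk_eq_mk_iff']
  exact ⟨a, hr.symm⟩

theorem resolvedProj_mk_tens {ℓ : Fin (M + 1) → k} (hv : v i₀ ≠ 0) (hz : tens e v ℓ ≠ 0)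
    (hv0 : v ≠ 0) (hL : L (φ (Projectivization.mk k v hv0)).rep = 0)
    (hLℓ : L (fun i => diffAt (F i) v ℓ) ≠ 0) :
    resolvedProj e φ L F v i₀ (Projectivization.mk k _ hz) = Projectivization.mk k _ hLℓ := by
  obtain ⟨a, ha⟩ := Projectivization.exists_smul_eq_mk_rep k _ hz
  have hr : (fun i => diffAt (F i) v fun j =>
      (Projectivization.mk k _ hz).rep (e.symm (i₀, j))) = ((a : k) * v i₀) • fun i => diffAt (F i) v ℓ := by
    have : (fun j => (Projectivization.mk k _ hz).rep (e.symm (i₀, j))) = ((a : k) * v i₀) • ℓ := by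
      funext j
      rw [← ha, Units.smul_def, Pi.smul_apply, tens_apply, Pi.smul_apply, smul_eq_mul, smul_eq_mul,
        mul_assoc]
    rw [this]
    funext i
    rw [map_smul, Pi.smul_apply]
  have h : L (fun i => diffAt (F i) v fun j =>
      (Projectivization.mk k _ hz).rep (e.symm (i₀, j))) ≠ 0 := by
    rw [hr, map_smul]
    exact smul_ne_zero (mul_ne_zero a.ne_zero hv) hLℓ
  rw [resolvedProj, dif_neg, dif_pos h, Projectivization.mk_eq_mk_iff']
  · refine ⟨(a : k) * v i₀, ?_⟩
    rw [hr, map_smul]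
  · rw [blowDown_mk_tens e hz hv0, not_not, hL]

/-- The strict transforms of the coefficients of the projected forms along the blow-up. -/
theorem exists_strictTransform_coeffs {d : ℕ} (hF : ∀ i, (F i).IsHomogeneous (d + 1))
    (hL : L (fun j => eval v (F j)) = 0) (i₀ : Fin (M + 1)) :
    ∃ H : Fin (N' + 1) → Fin (M + 1) → MvPolynomial (Fin (M + 1)) k,
      (∀ i j, (H i j).IsHomogeneous d) ∧ ∀ i, mapForms L F i = ∑ j, H i j * projForm v i₀ j := by
  have : ∀ i, ∃ g : Fin (M + 1) → MvPolynomial (Fin (M + 1)) k, (∀ j, (g j).IsHomogeneous d) ∧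
      mapForms L F i = ∑ j, g j * projForm v i₀ j := fun i =>
    exists_eq_sum_projForm (mapForms_isHomogeneous hF i) (by rw [eval_mapForms, hL, Pi.zero_apply])
  choose H h1 h2 using this
  exact ⟨H, h1, h2⟩

section Coeffs
variable {d : ℕ} {H : Fin (N' + 1) → Fin (M + 1) → MvPolynomial (Fin (M + 1)) k}

theorem smul_eval_tens_strictTransform
    (hH : ∀ i j, (H i j).IsHomogeneous d)
    (hHF : ∀ i, mapForms L F i = ∑ j, H i j * projForm v i₀ j)
    {p ρ : Fin (M + 1) → k} {c : k}
    (hp : projAlong v i₀ p = c • ρ) (m : Fin (M + 1)) :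
    (c • fun i => eval (tens e p ρ) (strictTransform e i₀ m (H i))) =
      (ρ m ^ d * p i₀) • L fun j => eval p (F j) := by
  funext i
  have h1 : eval (tens e p ρ) (strictTransform e i₀ m (H i)) =
      ρ m ^ d * p i₀ * ∑ j, eval p (H i j) * ρ j :=
    aeval_tens_strictTransform e i₀ m (hH i) p ρ
  have h2 := eval_mapForms (L := L) (F := F) p i
  rw [hHF, map_sum] at h2
  rw [Pi.smul_apply, Pi.smul_apply, smul_eq_mul, smul_eq_mul, h1, ← h2, mul_left_comm,
    Finset.mul_sum (a := c)]
  congr 1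
  refine Finset.sum_congr rfl fun j _ => ?_
  rw [map_mul, eval_projForm, hp, Pi.smul_apply, smul_eq_mul]
  ring

theorem eval_tens_strictTransform
    (hH : ∀ i j, (H i j).IsHomogeneous d)
    (hHF : ∀ i, mapForms L F i = ∑ j, H i j * projForm v i₀ j)
    {ℓ : Fin (M + 1) → k} (hv : v i₀ ≠ 0) (hℓ : ℓ i₀ = 0)
    (m : Fin (M + 1)) :
    (fun i => eval (tens e v ℓ) (strictTransform e i₀ m (H i))) =
      (ℓ m ^ d * v i₀) • L fun j => diffAt (F j) v ℓ := by
  funext i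
  have h1 : eval (tens e v ℓ) (strictTransform e i₀ m (H i)) =
      ℓ m ^ d * v i₀ * ∑ j, eval v (H i j) * ℓ j :=
    aeval_tens_strictTransform e i₀ m (hH i) v ℓ
  have h2 := diffAt_mapForms (L := L) (F := F) v ℓ i
  rw [hHF, diffAt_sum_projForm hv, projAlong_of_apply_eq_zero hℓ] at h2
  rw [h1, h2, Pi.smul_apply, smul_eq_mul]

end Coeffs

theorem IsGoodPoint.isRep_strictTransform [Infinite k] (hX : IsVariety X) (hg : IsGoodPoint X v i₀)
    (hv : v ≠ 0)
    {d : ℕ} {H : Fin (N' + 1) → Fin (M + 1) → MvPolynomial (Fin (M + 1)) k}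
    (hF : IsRep X φ (d + 1) F) (hL0 : L (φ (Projectivization.mk k v hv)).rep = 0)
    (hH : ∀ i j, (H i j).IsHomogeneous d)
    (hHF : ∀ i, mapForms L F i = ∑ j, H i j * projForm v i₀ j) (m : Fin (M + 1)) :
    IsRep (blowup e X v i₀) (resolvedProj e φ L F v i₀) (d + 1)
      fun i => strictTransform e i₀ m (H i) := by
  refine ⟨fun i => strictTransform_isHomogeneous e i₀ m (hH i), fun z hz hq hG => ?_⟩
  rcases hg.cases e hz hq with ⟨p, ρ, c, hp, hpI, hρ, hc, hpρ, rfl⟩ | ⟨ℓ, hℓ, hℓ0, rfl⟩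
  · have h1 := smul_eval_tens_strictTransform e hH hHF hpρ m
    have h2 : ρ m ^ d * p i₀ ≠ 0 ∧ (L fun j => eval p (F j)) ≠ 0 := by
      rw [← smul_ne_zero_iff, ← h1]
      exact smul_ne_zero hc hG
    have h3 : (fun j => eval p (F j)) ≠ 0 := fun h => h2.2 (by rw [h, map_zero])
    rw [resolvedProj_eq_of_ne e h3 _ h2.2, Projectivization.mk_eq_mk_iff']
    · refine ⟨(ρ m ^ d * p i₀)⁻¹ * c, ?_⟩
      rw [← smul_smul, h1, smul_smul, inv_mul_cancel₀ h2.1, one_smul]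
    · rw [blowDown_mk_tens e hz hp]
      exact hF.2 p hp ((hX.1.mem_iff hp).2 hpI) h3
  · have h1 := eval_tens_strictTransform e hH hHF hg.apply_ne hℓ.2 m
    have h2 : ℓ m ^ d * v i₀ ≠ 0 ∧ (L fun j => diffAt (F j) v ℓ) ≠ 0 := by
      rw [← smul_ne_zero_iff, ← h1]
      exact hG
    rw [resolvedProj_mk_tens e hg.apply_ne hz hv hL0 h2.2, Projectivization.mk_eq_mk_iff']
    refine ⟨(ℓ m ^ d * v i₀)⁻¹, ?_⟩
    rw [h1, smul_smul, inv_mul_cancel₀ h2.1, one_smul]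

theorem map_ne_zero_of_ker {w : Fin (N + 1) → k} (hw : w ≠ 0) {y : Pr k N}
    (hker : LinearMap.ker L = y.submodule) (h : Projectivization.mk k w hw ≠ y) : L w ≠ 0 := by
  intro h0
  obtain ⟨u, hu, rfl⟩ := exists_mk_eq y
  rw [← LinearMap.mem_ker, hker, Projectivization.submodule_mk, Submodule.mem_span_singleton] at h0
  obtain ⟨a, ha⟩ := h0
  exact h ((Projectivization.mk_eq_mk_iff' _ _ _ _ _).2 ⟨a, ha⟩)

theorem IsGoodPoint.resolvesInnerProj [Infinite k] (hX : IsVariety X) (hφ : IsMorphismOn X φ)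
    (hg : IsGoodPoint X v i₀) (hv : v ≠ 0) {d : ℕ} (hF : IsRep X φ (d + 1) F)
    (hker : LinearMap.ker L = (φ (Projectivization.mk k v hv)).submodule)
    (hL : L (fun j => eval v (F j)) = 0)
    (hinj : ∀ ℓ ∈ tanHyp (coneIdeal X) v i₀, ℓ ≠ 0 → (L fun j => diffAt (F j) v ℓ) ≠ 0)
    (hiso : ∀ q ∈ X, φ q = φ (Projectivization.mk k v hv) → q = Projectivization.mk k v hv) :
    ResolvesInnerProj X φ (Projectivization.mk k v hv) (blowup e X v i₀) (blowDown e)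
      (resolvedProj e φ L F v i₀) L := by
  have hL0 : L (φ (Projectivization.mk k v hv)).rep = 0 := by
    rw [← LinearMap.mem_ker, hker, Projectivization.submodule_eq]
    exact Submodule.mem_span_singleton_self _
  refine ⟨fun q hq => ?_, hker, fun q hq hne w hw hqw hLw =>
    resolvedProj_eq_of_ne e hw hqw.symm hLw⟩
  obtain ⟨z, hz, rfl⟩ := exists_mk_eq q
  by_cases hqE : blowDown e (Projectivization.mk k z hz) = Projectivization.mk k v hv
  · obtain ⟨τ, hτ, hτ0, rfl⟩ := (hg.mem_excFiber e hv hz).1 ⟨hq, hqE⟩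
    obtain ⟨H, hH, hHF⟩ := exists_strictTransform_coeffs hF.1 hL i₀
    obtain ⟨m, hm⟩ := Function.ne_iff.1 hτ0
    refine ⟨_, (hg.isRep_strictTransform e hX hv hF hL0 hH hHF m).localRep hz ?_⟩
    rw [eval_tens_strictTransform e hH hHF hg.apply_ne hτ.2 m]
    exact smul_ne_zero (mul_ne_zero (pow_ne_zero _ hm) hg.apply_ne) (hinj τ hτ hτ0)
  · obtain ⟨p, ρ, hp, hρ, hpI, rfl⟩ := hg.exists_tens e hz hq
    rw [blowDown_mk_tens e hz hp] at hqE
    have hpX := (hX.1.mem_iff hp).2 hpI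
    obtain ⟨d', F', hF', hF'p⟩ := exists_isRep hφ hp hpX
    obtain ⟨m, hm⟩ := Function.ne_iff.1 hρ
    have hcol : ∀ p' ρ', (fun i => eval (tens e p' ρ') (colPoly e m (mapForms L F' i))) =
        ρ' m ^ (d' + 1) • L fun j => eval p' (F' j) := by
      intro p' ρ'
      funext i
      rw [Pi.smul_apply, smul_eq_mul, ← eval_mapForms]
      exact aeval_tens_colPoly e m (mapForms_isHomogeneous hF'.1 i) p' ρ'
    refine ⟨fun i => colPoly e m (mapForms L F' i), IsRep.localRep (d := d' + 1)
      ⟨fun i => colPoly_isHomogeneous e m (mapForms_isHomogeneous hF'.1 i),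
        fun z' hz' hq' hG => ?_⟩ hz ?_⟩
    · obtain ⟨p', ρ', hp', hρ', hpI', rfl⟩ := hg.exists_tens e hz' hq'
      have h2 : ρ' m ^ (d' + 1) ≠ 0 ∧ (L fun j => eval p' (F' j)) ≠ 0 := by
        rw [← smul_ne_zero_iff, ← hcol]
        exact hG
      have h3 : (fun j => eval p' (F' j)) ≠ 0 := fun h => h2.2 (by rw [h, map_zero])
      rw [resolvedProj_eq_of_ne e h3 _ h2.2, Projectivization.mk_eq_mk_iff']
      · refine ⟨(ρ' m ^ (d' + 1))⁻¹, ?_⟩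
        rw [hcol, smul_smul, inv_mul_cancel₀ h2.1, one_smul]
      · rw [blowDown_mk_tens e hz' hp']
        exact hF'.2 p' hp' ((hX.1.mem_iff hp').2 hpI') h3
    · rw [hcol]
      refine smul_ne_zero (pow_ne_zero _ hm) (map_ne_zero_of_ker hF'p hker ?_)
      rw [← hF'.2 p hp hpX hF'p]
      exact fun h => hqE (hiso _ hpX h)

end ResolvedProjection

section GoodPoint
variable {k : Type} [Field k] {M N : ℕ}

theorem diffAt_self {f : MvPolynomial (Fin (M + 1)) k} {d : ℕ} (hf : f.IsHomogeneous d)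
    (v : Fin (M + 1) → k) : diffAt f v v = d * eval v f := by
  have h := congrArg (eval v) hf.sum_X_mul_pderiv
  rw [map_sum, nsmul_eq_mul, map_mul, map_natCast] at h
  rw [diffAt_apply, ← h]
  refine Finset.sum_congr rfl fun j _ => ?_
  rw [map_mul, eval_X, mul_comm]

theorem diffAt_self_eq_zero {I : Ideal (MvPolynomial (Fin (M + 1)) k)} (hI : CompStable I)
    {v : Fin (M + 1) → k} (hv : ∀ f ∈ I, eval v f = 0) : ∀ f ∈ I, diffAt f v v = 0 := by
  intro f hf
  rw [diffAt_eq_sum_components]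
  refine Finset.sum_eq_zero fun d _ => ?_
  rw [diffAt_self (homogeneousComponent_isHomogeneous d f), hv _ (hI f hf d), mul_zero]

theorem exists_linearMap_ker_eq (hN : 1 ≤ N) {y : Fin (N + 1) → k} (hy : y ≠ 0) :
    ∃ L : (Fin (N + 1) → k) →ₗ[k] (Fin (N - 1 + 1) → k), LinearMap.ker L = k ∙ y := by
  have h1 := Submodule.finrank_quotient_add_finrank (k ∙ y)
  rw [finrank_span_singleton hy, finrank_fin_fun] at h1
  have h2 : finrank k ((Fin (N + 1) → k) ⧸ (k ∙ y)) = finrank k (Fin (N - 1 + 1) → k) := by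
    rw [finrank_fin_fun]
    omega
  refine ⟨(LinearEquiv.ofFinrankEq _ _ h2).toLinearMap.comp (Submodule.mkQ _), ?_⟩
  rw [LinearEquiv.ker_comp, Submodule.ker_mkQ]

variable {X : Set (Pr k M)} {v : Fin (M + 1) → k} {i₀ : Fin (M + 1)}

theorem isGoodPoint_of_frame [CharZero k] [Infinite k]
    (hv : v i₀ ≠ 0) (hvI : ∀ f ∈ coneIdeal X, eval v f = 0)
    {δ : Fin 3 → Derivation k (coordRing X) (coordRing X)}
    (hli : LinearIndependent k fun i j => coneEval v hvI (δ i (coord X j)))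
    (hT : ∀ w : Fin (M + 1) → k, (∀ f ∈ coneIdeal X, diffAt f v w = 0) →
      w ∈ Submodule.span k (range fun i j => coneEval v hvI (δ i (coord X j)))) :
    IsGoodPoint X v i₀ := by
  have hv0 : v ≠ 0 := fun h => hv (congrFun h i₀)
  have hder : ∀ (D : Derivation k (coordRing X) (coordRing X)), ∀ f ∈ coneIdeal X,
      diffAt f v (fun j => coneEval v hvI (D (coord X j))) = 0 := by
    intro D f hf
    rw [← coneEval_derivation, Ideal.Quotient.eq_zero_iff_mem.2 hf, map_zero, map_zero]
  refine ⟨hv, hvI, fun w hw => ?_, ?_⟩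
  · obtain ⟨c, hc⟩ := (Submodule.mem_span_range_iff_exists_fun k).1 (hT w hw)
    obtain ⟨ρ, hρ⟩ := exists_isArc_taylor (i₀ := i₀) hv hvI (∑ i, c i • δ i)
    refine ⟨_, ρ, hρ, fun j => ?_⟩
    rw [coeff_taylor, ← hc, Finset.sum_apply]
    simp only [Nat.factorial_one, Nat.cast_one, inv_one, one_mul, Function.iterate_one]
    rw [derivation_sum_apply, map_sum]
    refine Finset.sum_congr rfl fun i _ => ?_
    rw [Derivation.smul_apply, map_smul, Pi.smul_apply]
  · set S := Submodule.span k (range fun i j => coneEval v hvI (δ i (coord X j))) with hS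
    have hSr : finrank k S = 3 := by
      rw [hS, finrank_span_eq_card hli, Fintype.card_fin]
    have hmem : ∀ w, w ∈ S ↔ ∀ f ∈ coneIdeal X, diffAt f v w = 0 := by
      refine fun w => ⟨fun hw f hf => ?_, hT w⟩
      have : S ≤ LinearMap.ker (diffAt f v) := by
        rw [hS, Submodule.span_le]
        rintro _ ⟨i, rfl⟩
        exact hder (δ i) f hf
      exact this hw
    have hsup : tanHyp (coneIdeal X) v i₀ ⊔ (k ∙ v) = S := by
      apply le_antisymm
      · refine sup_le (fun w hw => (hmem w).2 hw.1) ?_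
        rw [Submodule.span_singleton_le_iff_mem, hmem]
        exact diffAt_self_eq_zero (compStable_coneIdeal X) hvI
      · intro w hw
        rw [eq_smul_add_projAlong v i₀ w, add_comm (_ • v) _]
        refine Submodule.add_mem_sup ⟨fun f hf => ?_, projAlong_apply_self hv w⟩
          (Submodule.smul_mem _ _ (Submodule.mem_span_singleton_self v))
        have h1 : projAlong v i₀ w = w - (w i₀ * (v i₀)⁻¹) • v :=
          eq_sub_of_add_eq' (eq_smul_add_projAlong v i₀ w).symm
        rw [h1, map_sub, map_smul, (hmem w).1 hw f hf,
          diffAt_self_eq_zero (compStable_coneIdeal X) hvI f hf, smul_zero, sub_zero]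
    have hinf : tanHyp (coneIdeal X) v i₀ ⊓ (k ∙ v) = ⊥ := by
      rw [Submodule.eq_bot_iff]
      rintro w ⟨hw, hwv⟩
      obtain ⟨a, rfl⟩ := Submodule.mem_span_singleton.1 hwv
      have h1 : a * v i₀ = 0 := hw.2
      rw [(mul_eq_zero.1 h1).resolve_right hv, zero_smul]
    have h := Submodule.finrank_sup_add_finrank_inf_eq (tanHyp (coneIdeal X) v i₀) (k ∙ v)
    rw [hsup, hinf, hSr, finrank_bot, finrank_span_singleton hv0] at h
    omega

end GoodPoint

section Ramification
variable {k : Type} [Field k] {M M' N N' : ℕ}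

theorem jacobian_apply (F : Fin (N + 1) → MvPolynomial (Fin (M + 1)) k) (v w : Fin (M + 1) → k) :
    jacobian F v w = fun i => diffAt (F i) v w := by
  funext i
  rw [diffAt_apply, jacobian, Matrix.mulVecLin_apply]
  rfl

theorem jacobian_smul {F : Fin (N + 1) → MvPolynomial (Fin (M + 1)) k} {d : ℕ}
    (hF : ∀ i, (F i).IsHomogeneous d) (c : k) (v : Fin (M + 1) → k) :
    jacobian F (c • v) = c ^ (d - 1) • jacobian F v := by
  refine LinearMap.ext fun w => funext fun i => ?_
  rw [LinearMap.smul_apply, jacobian_apply, jacobian_apply, Pi.smul_apply, smul_eq_mul]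
  exact diffAt_smul_of_isHomogeneous (hF i) c v w

theorem RamifiedAt.finrank_le {Z : Set (Pr k M)} {ψ : Pr k M → Pr k N} {z : Fin (M + 1) → k}
    {hz : z ≠ 0} (h : RamifiedAt Z ψ (Projectivization.mk k z hz)) {d : ℕ}
    {G : Fin (N + 1) → MvPolynomial (Fin (M + 1)) k} (hG : IsRep Z ψ d G)
    (hG0 : (fun i => eval z (G i)) ≠ 0) :
    finrank k ((embTangent Z (Projectivization.mk k z hz)).map (jacobian G z)) ≤ 2 := by
  obtain ⟨a, ha⟩ := Projectivization.exists_smul_eq_mk_rep k z hz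
  have h1 := h G (hG.localRep hz hG0)
  rw [← ha, Units.smul_def, jacobian_smul hG.1,
    Submodule.map_smul _ _ _ (pow_ne_zero _ a.ne_zero)] at h1
  exact h1

variable {L : (Fin (N + 1) → k) →ₗ[k] (Fin (N' + 1) → k)}
  {F : Fin (N + 1) → MvPolynomial (Fin (M + 1)) k}
  {v τ : Fin (M + 1) → k} {i₀ : Fin (M + 1)}
  (e : Fin (M' + 1) ≃ Fin (M + 1) × Fin (M + 1))
  {d : ℕ} {H : Fin (N' + 1) → Fin (M + 1) → MvPolynomial (Fin (M + 1)) k}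

theorem jacobian_strictTransform_tens
    (hH : ∀ i j, (H i j).IsHomogeneous d)
    (hHF : ∀ i, mapForms L F i = ∑ j, H i j * projForm v i₀ j)
    (hv : v i₀ ≠ 0) (hτ : τ i₀ = 0) {b : Fin (M + 1) → k}
    (hb : b i₀ = 0) (m : Fin (M + 1)) :
    ∃ κ : k, jacobian (fun i => strictTransform e i₀ m (H i)) (tens e v τ) (tens e v b) =
      κ • L (jacobian F v τ) + (τ m ^ d * v i₀) • L (jacobian F v b) := by
  set P : Fin (M + 1) → PowerSeries k := fun i => PowerSeries.C (v i) with hP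
  set ρ : Fin (M + 1) → PowerSeries k :=
    fun i => PowerSeries.C (τ i) + PowerSeries.X * PowerSeries.C (b i) with hρ
  refine ⟨PowerSeries.coeff 1 (ρ m ^ d * P i₀), ?_⟩
  have e0 : (fun t => PowerSeries.coeff 0 (tens e P ρ t)) = tens e v τ := by
    funext t
    simp [tens, P, ρ]
  have e1 : (fun t => PowerSeries.coeff 1 (tens e P ρ t)) = tens e v b := by
    funext t
    simp [tens, P, ρ, PowerSeries.coeff_C_mul]
  have hL : ∀ w : Fin (M + 1) → k, w i₀ = 0 → ∀ i, L (jacobian F v w) i =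
      ∑ j, eval v (H i j) * w j := by
    intro w hw i
    rw [jacobian_apply, ← diffAt_mapForms, hHF, diffAt_sum_projForm hv,
      projAlong_of_apply_eq_zero hw]
  funext i
  have h3 := coeff_one_aeval (tens e P ρ) (strictTransform e i₀ m (H i))
  rw [e0, e1, aeval_tens_strictTransform e i₀ m (hH i)] at h3
  have h4 : ∀ j, aeval P (H i j) = PowerSeries.C (eval v (H i j)) := fun j =>
    aeval_algebraMap_apply (PowerSeries k) v (H i j)
  have h5 : ∑ j, aeval P (H i j) * ρ j = PowerSeries.C (L (jacobian F v τ) i) +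
      PowerSeries.X * PowerSeries.C (L (jacobian F v b) i) := by
    rw [hL τ hτ, hL b hb, map_sum, map_sum, Finset.mul_sum, ← Finset.sum_add_distrib]
    refine Finset.sum_congr rfl fun j _ => ?_
    rw [h4, hρ, map_mul, map_mul]
    ring
  have h6 : PowerSeries.coeff 0 (ρ m ^ d * P i₀) = τ m ^ d * v i₀ := by
    simp [P, ρ]
  generalize ρ m ^ d * P i₀ = K at h3 h6 ⊢
  rw [h5, mul_add, map_add, mul_left_comm K, PowerSeries.coeff_succ_X_mul,
    PowerSeries.coeff_mul_C, PowerSeries.coeff_mul_C, h6] at h3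
  exact (congrFun (jacobian_apply _ _ _) i).trans h3.symm

theorem jacobian_strictTransform_arc
    (hH : ∀ i j, (H i j).IsHomogeneous d)
    (hHF : ∀ i, mapForms L F i = ∑ j, H i j * projForm v i₀ j)
    {I : Ideal (MvPolynomial (Fin (M + 1)) k)}
    {P ρ : Fin (M + 1) → PowerSeries k} (hP : IsArc I v i₀ P ρ)
    (hτ : projAlong v i₀ (fun j => PowerSeries.coeff 1 (P j)) = τ)
    (hL : L (fun j => eval v (F j)) = 0) (m : Fin (M + 1)) :
    ∃ κ : k, jacobian (fun i => strictTransform e i₀ m (H i)) (tens e v τ)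
      (fun t => PowerSeries.coeff 1 (tens e P ρ t)) =
      κ • L (jacobian F v fun j => PowerSeries.coeff 1 (P j)) +
        (τ m ^ d * v i₀) • L (fun j => PowerSeries.coeff 2 (aeval P (F j))) := by
  refine ⟨PowerSeries.coeff 1 (ρ m ^ d * P i₀), ?_⟩
  funext i
  have h3 := coeff_one_aeval (tens e P ρ) (strictTransform e i₀ m (H i))
  rw [hP.coeff_zero_tens e, hτ] at h3
  have h7 : PowerSeries.X * aeval (tens e P ρ) (strictTransform e i₀ m (H i)) =
      ρ m ^ d * P i₀ * aeval P (mapForms L F i) := by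
    rw [aeval_tens_strictTransform e i₀ m (hH i), hHF, map_sum, mul_left_comm, Finset.mul_sum]
    congr 1
    refine Finset.sum_congr rfl fun j _ => ?_
    rw [map_mul, ← hP.2.2 j]
    ring
  have hPv : (fun j => PowerSeries.coeff 0 (P j)) = v := funext hP.2.1
  have h0 : PowerSeries.coeff 0 (aeval P (mapForms L F i)) = 0 := by
    rw [coeff_zero_aeval, hPv, eval_mapForms, hL, Pi.zero_apply]
  have h1 : PowerSeries.coeff 1 (aeval P (mapForms L F i)) =
      L (jacobian F v fun j => PowerSeries.coeff 1 (P j)) i := by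
    rw [coeff_one_aeval, hPv, diffAt_mapForms, jacobian_apply]
  have h6 : PowerSeries.coeff 0 (ρ m ^ d * P i₀) = τ m ^ d * v i₀ := by
    have := hP.2.1 i₀
    have h8 := hP.coeff_zero m
    rw [hτ] at h8
    rw [PowerSeries.coeff_zero_eq_constantCoeff_apply] at this h8 ⊢
    rw [map_mul, map_pow, this, h8]
  have h9 := congrArg (PowerSeries.coeff 2) h7
  rw [PowerSeries.coeff_succ_X_mul, h3, PowerSeries.coeff_mul,
    Finset.Nat.sum_antidiagonal_eq_sum_range_succ_mk, Finset.sum_range_succ, Finset.sum_range_succ,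
    Finset.sum_range_one] at h9
  simp only [Nat.sub_self, Nat.sub_zero, Nat.reduceSub, h6, h0, h1, mul_zero, add_zero,
    coeff_aeval_mapForms] at h9
  exact (congrFun (jacobian_apply _ _ _) i).trans (h9.trans (add_comm _ _))

theorem IsGoodPoint.map_coeff_two_mem
    (hH : ∀ i j, (H i j).IsHomogeneous d)
    (hHF : ∀ i, mapForms L F i = ∑ j, H i j * projForm v i₀ j)
    [IsAlgClosed k] [CharZero k] {X : Set (Pr k M)}
    {φ : Pr k M → Pr k N} (hX : IsVariety X) (hg : IsGoodPoint X v i₀) (hv : v ≠ 0)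
    (hF : IsRep X φ (d + 1) F) (hL0 : L (φ (Projectivization.mk k v hv)).rep = 0)
    (hL : L (fun j => eval v (F j)) = 0)
    (hinj : ∀ ℓ ∈ tanHyp (coneIdeal X) v i₀, L (jacobian F v ℓ) = 0 → ℓ = 0)
    (hz : tens e v τ ≠ 0)
    (hram : RamifiedAt (blowup e X v i₀) (resolvedProj e φ L F v i₀) (Projectivization.mk k _ hz))
    {P ρ : Fin (M + 1) → PowerSeries k} (hP : IsArc (coneIdeal X) v i₀ P ρ)
    (hPτ : projAlong v i₀ (fun j => PowerSeries.coeff 1 (P j)) = τ)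
    (hPt : ∀ f ∈ coneIdeal X, diffAt f v (fun j => PowerSeries.coeff 1 (P j)) = 0) :
    L (fun j => PowerSeries.coeff 2 (aeval P (F j))) ∈
      (tanHyp (coneIdeal X) v i₀).map (L.comp (jacobian F v)) := by
  have hinf : Infinite k := IsAlgClosed.instInfinite
  have hτ0 : τ ≠ 0 := (ne_zero_of_tens_ne_zero e hz).2
  have hτdecomp := eq_smul_add_projAlong v i₀ fun j => PowerSeries.coeff 1 (P j)
  rw [hPτ] at hτdecomp
  have hτ : τ ∈ tanHyp (coneIdeal X) v i₀ := by
    refine ⟨fun f hf => ?_, by rw [← hPτ]; exact projAlong_apply_self hg.apply_ne _⟩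
    have h1 := hPt f hf
    rwa [hτdecomp, map_add, map_smul,
      diffAt_self_eq_zero (compStable_coneIdeal X) hg.eval_eq f hf, smul_zero, zero_add] at h1
  obtain ⟨m, hm⟩ := Function.ne_iff.1 hτ0
  have hm' : τ m ≠ 0 := hm
  set κ₀ : k := τ m ^ d * v i₀ with hκ₀
  have hκ : κ₀ ≠ 0 := mul_ne_zero (pow_ne_zero _ hm') hg.apply_ne
  set G : Fin (N' + 1) → MvPolynomial (Fin (M' + 1)) k :=
    fun i => strictTransform e i₀ m (H i) with hG
  have hGz : (fun i => eval (tens e v τ) (G i)) = κ₀ • L (jacobian F v τ) := by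
    rw [jacobian_apply]
    exact eval_tens_strictTransform e hH hHF hg.apply_ne hτ.2 m
  have hGz0 : (fun i => eval (tens e v τ) (G i)) ≠ 0 := by
    rw [hGz]
    exact smul_ne_zero hκ fun h => hτ0 (hinj τ hτ h)
  have hGrep := hg.isRep_strictTransform e hX hv hF hL0 hH hHF m
  have hle := hram.finrank_le hGrep hGz0
  set E := embTangent (blowup e X v i₀) (Projectivization.mk k _ hz) with hE
  have hEb : ∀ b ∈ tanHyp (coneIdeal X) v i₀, tens e v b ∈ E := by
    intro b hb
    rw [hE, mem_embTangent_mk, hg.coneIdeal_blowup e hX]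
    exact hg.diffAt_tens_eq_zero e hτ hb
  have hJz : jacobian G (tens e v τ) (tens e v τ) = ((d + 1 : ℕ) * κ₀) • L (jacobian F v τ) := by
    rw [mul_smul, ← hGz, jacobian_apply]
    funext i
    exact diffAt_self (hGrep.1 i) _
  have hτV : L (jacobian F v τ) ∈ E.map (jacobian G (tens e v τ)) := by
    have h1 : ((d + 1 : ℕ) * κ₀ : k) ≠ 0 := mul_ne_zero (Nat.cast_ne_zero.2 (Nat.succ_ne_zero d)) hκ
    rw [← Submodule.smul_mem_iff _ h1, ← hJz]
    exact Submodule.mem_map_of_mem (hEb τ hτ)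
  have hsub : (tanHyp (coneIdeal X) v i₀).map (L.comp (jacobian F v)) ≤
      E.map (jacobian G (tens e v τ)) := by
    rintro _ ⟨b, hb, rfl⟩
    obtain ⟨κ, h1⟩ := jacobian_strictTransform_tens e hH hHF hg.apply_ne hτ.2 hb.2 m
    rw [← Submodule.smul_mem_iff _ hκ]
    have h2 : κ₀ • (L.comp (jacobian F v)) b =
        jacobian G (tens e v τ) (tens e v b) - κ • L (jacobian F v τ) :=
      eq_sub_of_add_eq' h1.symm
    rw [h2]
    exact Submodule.sub_mem _ (Submodule.mem_map_of_mem (hEb b hb)) (Submodule.smul_mem _ _ hτV)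
  have hrank : finrank k ((tanHyp (coneIdeal X) v i₀).map (L.comp (jacobian F v))) = 2 := by
    rw [← hg.finrank_eq]
    have hinj' : Function.Injective
        ((L.comp (jacobian F v)).domRestrict (tanHyp (coneIdeal X) v i₀)) := by
      rw [injective_iff_map_eq_zero]
      exact fun b h => Subtype.ext (hinj b b.2 h)
    rw [← LinearMap.finrank_range_of_inj hinj', LinearMap.range_domRestrict]
  have heq := Submodule.eq_of_le_of_finrank_le hsub (hle.trans hrank.ge)
  obtain ⟨κ, h3⟩ := jacobian_strictTransform_arc e hH hHF hP hPτ hL m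
  have hLv : L (jacobian F v v) = 0 := by
    have : jacobian F v v = ((d + 1 : ℕ) : k) • fun j => eval v (F j) := by
      rw [jacobian_apply]
      funext i
      exact diffAt_self (hF.1 i) v
    rw [this, map_smul, hL, smul_zero]
  have hLw : L (jacobian F v fun j => PowerSeries.coeff 1 (P j)) = L (jacobian F v τ) := by
    rw [hτdecomp, map_add, map_smul, map_add, map_smul, hLv, smul_zero, zero_add]
  rw [heq, ← Submodule.smul_mem_iff _ hκ, eq_sub_of_add_eq' h3.symm, hLw]
  refine Submodule.sub_mem _ (Submodule.mem_map_of_mem ?_) (Submodule.smul_mem _ _ hτV)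
  rw [hE, mem_embTangent_mk, hg.coneIdeal_blowup e hX, ← hPτ]
  exact fun f hf => hP.diffAt_eq_zero e (compStable_coneIdeal X) hf

end Ramification

section SecondOrder
variable {k : Type} [Field k] [IsAlgClosed k] [CharZero k] {M N : ℕ}
  {X : Set (Pr k M)} {φ : Pr k M → Pr k N} {v : Fin (M + 1) → k} {i₀ : Fin (M + 1)}
  {F : Fin (N + 1) → MvPolynomial (Fin (M + 1)) k} {d : ℕ}

/-- If the inner projection from `v` ramifies along the exceptional curve, then the second order
terms of `F` along arcs with nonzero velocity are tangent to the image. -/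
theorem IsGoodPoint.coeff_two_mem (hX : IsVariety X) (hdim : HasDim X 2) (hφ : IsMorphismOn X φ)
    (hg : IsGoodPoint X v i₀) (hv : v ≠ 0) (hF : IsRep X φ (d + 1) F)
    (hFv : (fun j => eval v (F j)) ≠ 0)
    (hdF : ∀ w ∈ embTangent X (Projectivization.mk k v hv), jacobian F v w = 0 → w = 0)
    (hiso : ∀ q ∈ X, φ q = φ (Projectivization.mk k v hv) → q = Projectivization.mk k v hv)
    (hram : ∀ (M' : ℕ) (Xt : Set (Pr k M')) (β : Pr k M' → Pr k M) (φt : Pr k M' → Pr k (N - 1))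
      (L : (Fin (N + 1) → k) →ₗ[k] (Fin (N - 1 + 1) → k)),
      IsBlowupAt Xt X β (Projectivization.mk k v hv) →
      ResolvesInnerProj X φ (Projectivization.mk k v hv) Xt β φt L →
      ExcFiber Xt β (Projectivization.mk k v hv) ⊆ RamLocus Xt φt)
    {P ρ : Fin (M + 1) → PowerSeries k} (hP : IsArc (coneIdeal X) v i₀ P ρ)
    (hPt : (fun j => PowerSeries.coeff 1 (P j)) ∈ embTangent X (Projectivization.mk k v hv))
    (hPτ : projAlong v i₀ (fun j => PowerSeries.coeff 1 (P j)) ≠ 0) :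
    (fun j => PowerSeries.coeff 2 (aeval P (F j))) ∈
      (embTangent X (Projectivization.mk k v hv)).map (jacobian F v) := by
  have hinf : Infinite k := IsAlgClosed.instInfinite
  set T := embTangent X (Projectivization.mk k v hv) with hT
  have hTmem : ∀ w, w ∈ T ↔ ∀ f ∈ coneIdeal X, diffAt f v w = 0 := fun w => mem_embTangent_mk hv
  have hvT : v ∈ T := (hTmem v).2 (diffAt_self_eq_zero (compStable_coneIdeal X) hg.eval_eq)
  have hJv : jacobian F v v = ((d + 1 : ℕ) : k) • fun j => eval v (F j) := by
    rw [jacobian_apply]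
    funext i
    exact diffAt_self (hF.1 i) v
  have hd0 : ((d + 1 : ℕ) : k) ≠ 0 := Nat.cast_ne_zero.2 (Nat.succ_ne_zero d)
  have hTmap : ∀ a : k, (a • fun j => eval v (F j)) ∈ T.map (jacobian F v) := by
    intro a
    refine ⟨(a * ((d + 1 : ℕ) : k)⁻¹) • v, Submodule.smul_mem _ _ hvT, ?_⟩
    rw [map_smul, hJv, smul_smul, mul_assoc, inv_mul_cancel₀ hd0, mul_one]
  have htan : ∀ ℓ ∈ tanHyp (coneIdeal X) v i₀, ℓ ∈ T := fun ℓ hℓ => (hTmem ℓ).2 hℓ.1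
  have hN : 1 ≤ N := by
    have hinj : Function.Injective
        ((jacobian F v).domRestrict (tanHyp (coneIdeal X) v i₀)) := by
      rw [injective_iff_map_eq_zero]
      exact fun b h => Subtype.ext (hdF b (htan b b.2) h)
    have := LinearMap.finrank_le_finrank_of_injective hinj
    rw [hg.finrank_eq, finrank_fin_fun] at this
    omega
  obtain ⟨L, hLker⟩ := exists_linearMap_ker_eq hN hFv
  have hφv := hF.2 v hv (hg.mk_mem hX hv) hFv
  have hker : LinearMap.ker L = (φ (Projectivization.mk k v hv)).submodule := by
    rw [hφv, Projectivization.submodule_mk, hLker]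
  have hL : L (fun j => eval v (F j)) = 0 := by
    rw [← LinearMap.mem_ker, hLker]
    exact Submodule.mem_span_singleton_self _
  have hL0 : L (φ (Projectivization.mk k v hv)).rep = 0 := by
    rw [← LinearMap.mem_ker, hker, Projectivization.submodule_eq]
    exact Submodule.mem_span_singleton_self _
  have hinj : ∀ ℓ ∈ tanHyp (coneIdeal X) v i₀, L (jacobian F v ℓ) = 0 → ℓ = 0 := by
    intro ℓ hℓ h
    rw [← LinearMap.mem_ker, hLker, Submodule.mem_span_singleton] at h
    obtain ⟨a, ha⟩ := h
    have h1 : ℓ - (a * ((d + 1 : ℕ) : k)⁻¹) • v = 0 := by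
      refine hdF _ (Submodule.sub_mem _ (htan ℓ hℓ) (Submodule.smul_mem _ _ hvT)) ?_
      rw [map_sub, map_smul, hJv, smul_smul, mul_assoc, inv_mul_cancel₀ hd0, mul_one, ha, sub_self]
    have h2 : 0 = a * ((d + 1 : ℕ) : k)⁻¹ * v i₀ := by
      rw [← hℓ.2]
      exact congrFun (sub_eq_zero.1 h1) i₀
    rw [sub_eq_zero.1 h1, (mul_eq_zero.1 h2.symm).resolve_right hg.apply_ne, zero_smul]
  have hM : (M + 1) * M + M + 1 = (M + 1) * (M + 1) := by ring
  let e : Fin ((M + 1) * M + M + 1) ≃ Fin (M + 1) × Fin (M + 1) :=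
    (finCongr hM).trans finProdFinEquiv.symm
  obtain ⟨H, hH, hHF⟩ := exists_strictTransform_coeffs hF.1 hL i₀
  have hres := hg.resolvesInnerProj e hX hφ hv hF hker hL (fun ℓ hℓ hℓ0 h => hℓ0 (hinj ℓ hℓ (by
    rw [jacobian_apply]
    exact h))) hiso
  have hz : tens e v (projAlong v i₀ fun j => PowerSeries.coeff 1 (P j)) ≠ 0 := tens_ne_zero e hv hPτ
  have hτ : projAlong v i₀ (fun j => PowerSeries.coeff 1 (P j)) ∈ tanHyp (coneIdeal X) v i₀ := by
    refine ⟨(hTmem _).1 ?_, projAlong_apply_self hg.apply_ne _⟩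
    have h1 := eq_sub_of_add_eq'
      (eq_smul_add_projAlong v i₀ fun j => PowerSeries.coeff 1 (P j)).symm
    rw [h1]
    exact Submodule.sub_mem _ hPt (Submodule.smul_mem _ _ hvT)
  have hexc := (hram _ _ _ _ L (hg.isBlowupAt e hX hdim hv) hres
    ((hg.mem_excFiber e hv hz).2 ⟨_, hτ, hPτ, rfl⟩)).2
  obtain ⟨b, hb, h⟩ := hg.map_coeff_two_mem e hH hHF hX hv hF hL0 hL hinj hz hexc hP rfl
    ((hTmem _).1 hPt)
  have h1 : (fun j => PowerSeries.coeff 2 (aeval P (F j))) - jacobian F v b ∈ LinearMap.ker L := by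
    rw [LinearMap.mem_ker, map_sub, ← h]
    exact sub_self _
  rw [hLker, Submodule.mem_span_singleton] at h1
  obtain ⟨a, ha⟩ := h1
  rw [eq_add_of_sub_eq ha.symm]
  exact Submodule.add_mem _ (hTmap a) (Submodule.mem_map_of_mem (htan b hb))

end SecondOrder

section SecondOrderDerivations
variable {k : Type} [Field k] [CharZero k] {M N : ℕ}
  {X : Set (Pr k M)} {φ : Pr k M → Pr k N} {v : Fin (M + 1) → k}
  {F : Fin (N + 1) → MvPolynomial (Fin (M + 1)) k} {d : ℕ}

theorem derivation_apply_apply_mem_of_ne {A V ι : Type} [CommRing A] [Algebra k A]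
    (ev : A →ₐ[k] k) (f : ι → A) (S : Submodule k (ι → k)) [AddCommGroup V] [Module k V]
    (θ : Derivation k A A →ₗ[k] V)
    (h : ∀ D, θ D ≠ 0 → (fun j => ev (D (D (f j)))) ∈ S) {β : Derivation k A A} (hβ : θ β ≠ 0)
    (D : Derivation k A A) : (fun j => ev (D (D (f j)))) ∈ S := by
  by_cases hD : θ D = 0
  · have h1 := h (D + β) (by rwa [map_add, hD, zero_add])
    have h2 := h (D + (2 : k) • β) (by
      rw [map_add, hD, zero_add, map_smul]
      exact smul_ne_zero two_ne_zero hβ)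
    have h3 : (fun j => ev (D (D (f j)))) = (2 : k) • (fun j => ev ((D + β) ((D + β) (f j)))) -
        (fun j => ev ((D + (2 : k) • β) ((D + (2 : k) • β) (f j)))) +
        (2 : k) • (fun j => ev (β (β (f j)))) := by
      funext j
      simp only [Pi.add_apply, Pi.sub_apply, Pi.smul_apply, Derivation.add_apply,
        Derivation.smul_apply, map_add, Derivation.map_smul, map_smul, smul_eq_mul]
      ring
    rw [h3]
    exact Submodule.add_mem _ (Submodule.sub_mem _ (Submodule.smul_mem _ _ h1) h2)
      (Submodule.smul_mem _ _ (h β hβ))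
  · exact h D hD

theorem second_order_mem_span [IsAlgClosed k] (hX : IsVariety X) (hdim : HasDim X 2) (hφ : IsMorphismOn X φ)
    (hv : v ≠ 0) (hvI : ∀ f ∈ coneIdeal X, eval v f = 0) (hF : IsRep X φ (d + 1) F)
    (hFv : (fun j => eval v (F j)) ≠ 0)
    {δ : Fin 3 → Derivation k (coordRing X) (coordRing X)}
    (hT : ∀ w : Fin (M + 1) → k, (∀ f ∈ coneIdeal X, diffAt f v w = 0) →
      w ∈ Submodule.span k (range fun i j => coneEval v hvI (δ i (coord X j))))
    (hli : LinearIndependent k fun i j =>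
      coneEval v hvI (δ i (Ideal.Quotient.mk (coneIdeal X) (F j))))
    (hiso : ∀ q ∈ X, φ q = φ (Projectivization.mk k v hv) → q = Projectivization.mk k v hv)
    (hram : ∀ (M' : ℕ) (Xt : Set (Pr k M')) (β : Pr k M' → Pr k M) (φt : Pr k M' → Pr k (N - 1))
      (L : (Fin (N + 1) → k) →ₗ[k] (Fin (N - 1 + 1) → k)),
      IsBlowupAt Xt X β (Projectivization.mk k v hv) →
      ResolvesInnerProj X φ (Projectivization.mk k v hv) Xt β φt L →
      ExcFiber Xt β (Projectivization.mk k v hv) ⊆ RamLocus Xt φt)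
    (D : Derivation k (coordRing X) (coordRing X)) :
    (fun j => coneEval v hvI (D (D (Ideal.Quotient.mk (coneIdeal X) (F j))))) ∈
      Submodule.span k (range fun i j =>
        coneEval v hvI (δ i (Ideal.Quotient.mk (coneIdeal X) (F j)))) := by
  have hinf : Infinite k := IsAlgClosed.instInfinite
  obtain ⟨i₀, hi₀⟩ := Function.ne_iff.1 hv
  set u : Fin 3 → Fin (M + 1) → k := fun i j => coneEval v hvI (δ i (coord X j)) with hu
  have hJ : ∀ E : Derivation k (coordRing X) (coordRing X),
      jacobian F v (fun j => coneEval v hvI (E (coord X j))) =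
        fun j => coneEval v hvI (E (Ideal.Quotient.mk (coneIdeal X) (F j))) := by
    intro E
    rw [jacobian_apply]
    exact funext fun j => (coneEval_derivation E v hvI (F j)).symm
  have hli' : LinearIndependent k (jacobian F v ∘ u) := by
    have : jacobian F v ∘ u = fun i j =>
        coneEval v hvI (δ i (Ideal.Quotient.mk (coneIdeal X) (F j))) := funext fun i => hJ (δ i)
    rwa [this]
  have hg : IsGoodPoint X v i₀ := isGoodPoint_of_frame hi₀ hvI (hli'.of_comp _) hT
  have hspan : ∀ w ∈ embTangent X (Projectivization.mk k v hv), ∃ c : Fin 3 → k,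
      ∑ i, c i • u i = w := fun w hw =>
    (Submodule.mem_span_range_iff_exists_fun k).1 (hT w ((mem_embTangent_mk hv).1 hw))
  have hdF : ∀ w ∈ embTangent X (Projectivization.mk k v hv), jacobian F v w = 0 → w = 0 := by
    intro w hw h0
    obtain ⟨c, rfl⟩ := hspan w hw
    rw [map_sum] at h0
    simp only [map_smul] at h0
    have hc := Fintype.linearIndependent_iff.1 hli' c h0
    simp [hc]
  have hmap : (embTangent X (Projectivization.mk k v hv)).map (jacobian F v) ≤
      Submodule.span k (range fun i j =>
        coneEval v hvI (δ i (Ideal.Quotient.mk (coneIdeal X) (F j)))) := by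
    rintro _ ⟨w, hw, rfl⟩
    obtain ⟨c, rfl⟩ := hspan w hw
    rw [map_sum]
    refine Submodule.sum_mem _ fun i _ => ?_
    rw [map_smul, hJ]
    exact Submodule.smul_mem _ _ (Submodule.subset_span ⟨i, rfl⟩)
  let vel : Derivation k (coordRing X) (coordRing X) →ₗ[k] (Fin (M + 1) → k) :=
    { toFun := fun E j => coneEval v hvI (E (coord X j))
      map_add' := fun E E' => funext fun j => map_add (coneEval v hvI) _ _
      map_smul' := fun c E => funext fun j => map_smul (coneEval v hvI) c _ }
  obtain ⟨a, ha⟩ : ∃ a, projAlong v i₀ (u a) ≠ 0 := by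
    by_contra! hall
    have hbot : tanHyp (coneIdeal X) v i₀ = ⊥ := by
      rw [Submodule.eq_bot_iff]
      intro w hw
      obtain ⟨c, hc⟩ := hspan w ((mem_embTangent_mk hv).2 hw.1)
      rw [← projAlong_of_apply_eq_zero (v := v) hw.2, ← hc, map_sum]
      exact Finset.sum_eq_zero fun i _ => by rw [map_smul, hall, smul_zero]
    have := hg.finrank_eq
    rw [hbot, finrank_bot] at this
    omega
  refine derivation_apply_apply_mem_of_ne (coneEval v hvI)
    (fun j => Ideal.Quotient.mk (coneIdeal X) (F j)) _ ((projAlong v i₀).comp vel) (fun E hE => ?_)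
    (β := δ a) ha D
  obtain ⟨ρ, hρ⟩ := exists_isArc_taylor (i₀ := i₀) hi₀ hvI E
  have hvel : (fun j => PowerSeries.coeff 1 (taylor E (coneEval v hvI) (coord X j))) = vel E := by
    funext j
    rw [coeff_taylor]
    simp only [Nat.factorial_one, Nat.cast_one, inv_one, one_mul, Function.iterate_one]
    rfl
  have h1 := hmap (hg.coeff_two_mem hX hdim hφ hv hF hFv hdF hiso hram hρ (by
    rw [hvel, mem_embTangent_mk]
    intro f hf
    have := coneEval_derivation E v hvI f
    rw [Ideal.Quotient.eq_zero_iff_mem.2 hf, map_zero, map_zero] at this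
    exact this.symm) (by
    rw [hvel]
    exact hE))
  have h2 : (fun j => PowerSeries.coeff 2
      (aeval (fun j => taylor E (coneEval v hvI) (coord X j)) (F j))) =
      (2 : k)⁻¹ • fun j => coneEval v hvI (E (E (Ideal.Quotient.mk (coneIdeal X) (F j)))) := by
    funext j
    rw [aeval_taylor_coord, coeff_taylor]
    simp [Nat.factorial]
  rw [h2] at h1
  exact (Submodule.smul_mem_iff _ (inv_ne_zero two_ne_zero)).1 h1

end SecondOrderDerivations

section Globalisation
variable {k : Type} [Field k]

theorem symmetrized_second_order_mem {A ι : Type} [CommRing A] [Algebra k A] (ev : A →ₐ[k] k)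
    (f : ι → A) (S : Submodule k (ι → k))
    (h : ∀ D : Derivation k A A, (fun t => ev (D (D (f t)))) ∈ S) (D E : Derivation k A A) :
    (fun t => ev (D (E (f t)) + E (D (f t)))) ∈ S := by
  have h1 : (fun t => ev (D (E (f t)) + E (D (f t)))) =
      (fun t => ev ((D + E) ((D + E) (f t)))) - (fun t => ev (D (D (f t)))) -
        fun t => ev (E (E (f t))) := by
    funext t
    simp only [Pi.sub_apply, Derivation.add_apply, map_add]
    ring
  rw [h1]
  exact Submodule.sub_mem _ (Submodule.sub_mem _ (h _) (h _)) (h _)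

theorem exists_second_order_relation [CharZero k] {A ι : Type} [CommRing A] [IsDomain A]
    [Algebra k A] {n : ℕ} {b : Fin n → A} (hb : IsTranscendenceBasis k b) {d : A} (hd : d ≠ 0)
    {δ : Fin n → Derivation k A A} (hδ : ∀ i j, δ i (b j) = if i = j then d else 0)
    (f : ι → A) {e : A} (he : e ≠ 0) (i j : Fin n) {c : Fin n → A}
    (hc : ∀ t, e * (δ i (δ j (f t)) + δ j (δ i (f t))) = ∑ a, c a * δ a (f t)) :
    ∃ e' : A, e' ≠ 0 ∧ ∃ c' : Fin n → A, ∀ t, e' * δ i (δ j (f t)) = ∑ a, c' a * δ a (f t) := by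
  refine ⟨algebraMap k A 2 * (d * e), ?_, fun a => d * c a + e * (⁅δ i, δ j⁆ (b a)), fun t => ?_⟩
  · refine mul_ne_zero ?_ (mul_ne_zero hd he)
    rw [Ne, map_eq_zero_iff _ (algebraMap k A).injective]
    exact two_ne_zero
  · have h1 := frame_span hb hδ ⁅δ i, δ j⁆ (f t)
    rw [Derivation.commutator_apply] at h1
    simp only [add_mul, mul_assoc, Finset.sum_add_distrib, ← Finset.mul_sum]
    rw [← h1, ← hc t, map_ofNat]
    ring

variable [IsAlgClosed k] [CharZero k] {M N : ℕ} {X : Set (Pr k M)} {φ : Pr k M → Pr k N}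

theorem finrank_span_le_of_ramified (hX : IsVariety X) (hdim : HasDim X 2)
    (hφ : IsMorphismOn X φ) (hbir : GenericallyInjectiveOn X φ)
    (hram : ForGeneralPointOn X (fun x =>
      ∀ (M' : ℕ) (Xt : Set (Pr k M')) (β : Pr k M' → Pr k M)
        (φt : Pr k M' → Pr k (N - 1)) (L : (Fin (N + 1) → k) →ₗ[k] (Fin (N - 1 + 1) → k)),
        IsBlowupAt Xt X β x → ResolvesInnerProj X φ x Xt β φt L →
        ExcFiber Xt β x ⊆ RamLocus Xt φt))
    {m : ℕ} {F : Fin (N + 1) → MvPolynomial (Fin (M + 1)) k} (hF : IsRep X φ (m + 1) F)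
    {j₀ : Fin (N + 1)} (hF0 : Ideal.Quotient.mk (coneIdeal X) (F j₀) ≠ 0)
    [IsDomain (coordRing X)] {b : Fin 3 → coordRing X} (hb : IsTranscendenceBasis k b)
    {d : coordRing X} (hd : d ≠ 0) {δ : Fin 3 → Derivation k (coordRing X) (coordRing X)}
    (hδ : ∀ i j, δ i (b j) = if i = j then d else 0) :
    finrank k (Submodule.span k (range fun j => Ideal.Quotient.mk (coneIdeal X) (F j))) ≤ 3 := by
  obtain ⟨Z, hZ, hXZ, hram⟩ := hram
  obtain ⟨g, hgZ, hgX⟩ : ∃ g ∈ coneIdeal Z, g ∉ coneIdeal X := by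
    by_contra! h
    exact hXZ (hZ.subset_of_coneIdeal_le h)
  have hli := hF.linearIndependent_derivation hX hbir hd hδ hF0
  obtain ⟨e, he, V, hV⟩ := exists_dual_vectors _ hli
  obtain ⟨hiso, hisoX, hisolated⟩ := exists_isolated_fibre hX hφ hbir
    (coneDim_of_hasDim hX hdim) hF hF0 δ hli
  obtain ⟨h, hh, htan⟩ := exists_tangent_span hb hδ
  set f : Fin (N + 1) → coordRing X := fun j => Ideal.Quotient.mk (coneIdeal X) (F j) with hf
  have hmk : ∀ {p : MvPolynomial (Fin (M + 1)) k}, p ∉ coneIdeal X →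
      Ideal.Quotient.mk (coneIdeal X) p ≠ 0 := fun hp h0 => hp (Ideal.Quotient.eq_zero_iff_mem.1 h0)
  refine finrank_span_le_of_second_order hb hd hδ hF.1 fun i j =>
    exists_second_order_relation hb hd hδ f he i j
      (c := fun a => ∑ l, (δ i (δ j (f l)) + δ j (δ i (f l))) * V l a) fun t => ?_
  by_contra hne
  have hs : d * h * e * f j₀ * Ideal.Quotient.mk (coneIdeal X) hiso *
      Ideal.Quotient.mk (coneIdeal X) g * (e * (δ i (δ j (f t)) + δ j (δ i (f t))) -
        ∑ a, (∑ l, (δ i (δ j (f l)) + δ j (δ i (f l))) * V l a) * δ a (f t)) ≠ 0 :=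
    mul_ne_zero (mul_ne_zero (mul_ne_zero (mul_ne_zero (mul_ne_zero (mul_ne_zero hd hh) he) hF0)
      (hmk hisoX)) (hmk hgX)) (sub_ne_zero.2 hne)
  obtain ⟨v, hv, hvX, hvI, hev⟩ := exists_coneEval_ne_zero hs
  simp only [map_mul, mul_ne_zero_iff] at hev
  obtain ⟨⟨⟨⟨⟨⟨hd', hh'⟩, he'⟩, hF0'⟩, hiso'⟩, hg'⟩, hrel⟩ := hev
  rw [coneEval_mk] at hiso' hg'
  rw [hf, coneEval_mk] at hF0'
  have hvZ : Projectivization.mk k v hv ∉ Z := fun hz => hg' (mem_coneIdeal.1 hgZ v hv hz)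
  have hS := second_order_mem_span hX hdim hφ hv hvI hF
    (fun h0 => hF0' (congrFun h0 j₀)) (htan v hvI hd' hh')
    (linearIndependent_of_dual_vectors hV (coneEval v hvI) he')
    (hisolated v hv hvX hiso') (hram _ ⟨hvX, hvZ⟩)
  refine hrel ?_
  rw [map_sub, sub_eq_zero]
  exact eq_sum_of_mem_span_of_dual_vectors hV (coneEval v hvI)
    (w := fun t => δ i (δ j (f t)) + δ j (δ i (f t)))
    (symmetrized_second_order_mem (coneEval v hvI) f _ hS (δ i) (δ j)) t

end Globalisation

/-- **Proposition.** If `X` is any surface and `φ : X → ℙ^N` is birational onto its image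
`Y = φ(X)`, and the resolved inner projection from a general point is ramified along the
whole exceptional curve, then `Y` is a 2-plane. -/
theorem stmt_3
    (k : Type) [Field k] [IsAlgClosed k] [CharZero k]
    (M N : ℕ)
    (X : Set (Pr k M)) (φ : Pr k M → Pr k N)
    (hX : IsVariety X) (hdim : HasDim X 2)
    (hmor : IsMorphismOn X φ) (hbir : GenericallyInjectiveOn X φ)
    (hram : ForGeneralPointOn X (fun x =>
      ∀ (M' : ℕ) (Xt : Set (Pr k M')) (β : Pr k M' → Pr k M)
        (φt : Pr k M' → Pr k (N - 1)) (L : (Fin (N + 1) → k) →ₗ[k] (Fin (N - 1 + 1) → k)),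
        IsBlowupAt Xt X β x → ResolvesInnerProj X φ x Xt β φt L →
        ExcFiber Xt β x ⊆ RamLocus Xt φt)) :
    Is2Plane (φ '' X) := by
  have hinf : Infinite k := IsAlgClosed.instInfinite
  have hdom := hX.isDomain
  obtain ⟨p, hp⟩ := hX.2.1
  obtain ⟨v, hv, rfl⟩ := exists_mk_eq p
  obtain ⟨m, F, hF, hFv⟩ := exists_isRep hmor hv hp
  obtain ⟨j₀, hj₀⟩ := Function.ne_iff.1 hFv
  have hF0 : Ideal.Quotient.mk (coneIdeal X) (F j₀) ≠ 0 := fun h =>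
    hj₀ (mem_coneIdeal.1 (Ideal.Quotient.eq_zero_iff_mem.1 h) v hv hp)
  have htr := trdeg_coordRing X
  rw [coneDim_of_hasDim hX hdim] at htr
  obtain ⟨b, hb⟩ := exists_transcendenceBasis_of_trdeg htr
  obtain ⟨d, hd, δ, hδ⟩ := exists_frame (coord X) (adjoin_coord X) b hb
  exact is2Plane_of_finrank_span_le hX hmor hF δ
    (hF.linearIndependent_derivation hX hbir hd hδ hF0)
    (finrank_span_le_of_ramified hX hdim hmor hbir hram hF hF0 hb hd hδ)

end PinchPaper
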